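/- arXiv:2303.04312 — 3 statements merged into one kernel-verified Lean document; each statement's English description precedes it below -/
import Mathlib

section
/- Let p be a prime with p ≡ 1 (mod 4) and let q = p^r with q ≡ 1 (mod 8). Suppose e₁, f₁ ∈ ℤ satisfy q = e₁² + 4f₁² with e₁ ≡ 1 (mod 4) and p not dividing e₁. For ℓ ≥ 1 let e_ℓ = Re((e₁ + 2f₁·i)^ℓ) = (1/2)(e₁ + 2f₁·i)^ℓ + (1/2)(e₁ − 2f₁·i)^ℓ. Then for every ℓ ≥ 1, the number of triangles in the generalized Paley graph Γ(4, q^ℓ) is K_3(Γ(4, q^ℓ)) = q^ℓ (q^ℓ − 1)(q^ℓ − 6e_ℓ − 11) / (2⁷ · 3). -/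
open Complex

/-- The number of cliques of size `n` in a graph `G`. -/
noncomputable def SimpleGraph.cliqueCount {V : Type*} (G : SimpleGraph V) (n : ℕ) : ℕ :=
  Nat.card {s : Finset V // G.IsNClique n s}

/-- The generalized Paley graph `Γ(k,q)` on a finite field `F` with `q` elements: distinct
`x, y` are adjacent iff `y - x` is a `k`-th power of a nonzero element of `F`. -/
def paleyGraph (F : Type*) [Field F] (k : ℕ) : SimpleGraph F :=
  SimpleGraph.fromRel fun x y => ∃ z : F, z ≠ 0 ∧ y - x = z ^ k

/-- being a nonzero fourth power -/
def IsFourth {F : Type*} [Field F] (x : F) : Prop := ∃ z : F, z ≠ 0 ∧ x = z ^ 4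

section chars
variable {F R : Type*} [Field F] [Fintype F] [CommRing R] [IsDomain R]

lemma char_eq_one_iff (χ : MulChar F R) (h : orderOf χ = 4) (x : F) :
    χ x = 1 ↔ IsFourth x := by
  classical
  constructor
  · intro hx
    have hx0 : x ≠ 0 := by
      rintro rfl
      rw [MulChar.map_zero] at hx
      exact zero_ne_one hx
    obtain ⟨g, hg⟩ := IsCyclic.exists_generator (α := Fˣ)
    obtain ⟨k, hk⟩ := (Submonoid.mem_powers_iff _ _).1
      ((mem_powers_iff_mem_zpowers).2 (hg (Units.mk0 x hx0)))
    have hxg : x = (g : F) ^ k := by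
      have := congrArg Units.val hk
      simpa using this.symm
    have h1 : χ ^ k = 1 := by
      rw [MulChar.eq_one_iff]
      intro a
      obtain ⟨j, hj⟩ := (Submonoid.mem_powers_iff _ _).1
        ((mem_powers_iff_mem_zpowers).2 (hg a))
      rw [← hj, MulChar.pow_apply_coe]
      push_cast
      rw [map_pow, ← pow_mul, mul_comm, pow_mul, ← map_pow, ← hxg, hx, one_pow]
    have h2 := orderOf_dvd_of_pow_eq_one h1
    rw [h] at h2
    obtain ⟨m, rfl⟩ := h2
    exact ⟨(g : F) ^ m, by simp, by rw [hxg]; ring⟩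
  · rintro ⟨z, hz, rfl⟩
    have : χ ^ 4 = 1 := h ▸ pow_orderOf_eq_one χ
    rw [map_pow, ← MulChar.pow_apply' χ (by norm_num), this,
      MulChar.one_apply (isUnit_iff_ne_zero.2 hz)]

open Classical in
lemma four_ite (χ : MulChar F R) (h : orderOf χ = 4) (x : F) :
    (4 : R) * (if IsFourth x then 1 else 0) =
      (1 : MulChar F R) x + χ x + (χ ^ 2) x + (χ ^ 3) x := by
  by_cases hx0 : x = 0
  · subst hx0
    have : ¬ IsFourth (0 : F) := by
      rintro ⟨z, hz, h0⟩
      exact hz (pow_eq_zero_iff (by norm_num) |>.1 h0.symm)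
    simp only [this, if_false, MulChar.map_zero]; ring
  · rw [MulChar.one_apply (isUnit_iff_ne_zero.2 hx0), MulChar.pow_apply' χ (by norm_num),
      MulChar.pow_apply' χ (by norm_num)]
    by_cases hx : IsFourth x
    · rw [(char_eq_one_iff χ h x).2 hx]
      simp [hx]; norm_num
    · have h1 : χ x - 1 ≠ 0 := fun h' => hx ((char_eq_one_iff χ h x).1 (sub_eq_zero.1 h'))
      have h4 : (χ x) ^ 4 = 1 := by
        have : χ ^ 4 = 1 := h ▸ pow_orderOf_eq_one χ
        rw [← MulChar.pow_apply' χ (by norm_num), this,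
          MulChar.one_apply (isUnit_iff_ne_zero.2 hx0)]
      simp only [hx, if_false, mul_zero]
      apply mul_left_cancel₀ h1
      linear_combination -h4

open Classical in
lemma card_fourth (χ : MulChar F R) (h : orderOf χ = 4) :
    (4 : R) * ((Finset.univ.filter (fun x : F => IsFourth x)).card : R) = Fintype.card F - 1 := by
  have hne : ∀ j, 0 < j → j < 4 → χ ^ j ≠ 1 := fun j h0 hj =>
    pow_ne_one_of_lt_orderOf h0.ne' (h ▸ hj)
  rw [Finset.card_filter]
  push_cast
  rw [Finset.mul_sum]
  simp_rw [four_ite χ h, Finset.sum_add_distrib]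
  rw [MulChar.sum_eq_zero_of_ne_one (hne 2 (by norm_num) (by norm_num)),
    MulChar.sum_eq_zero_of_ne_one (hne 3 (by norm_num) (by norm_num)),
    MulChar.sum_eq_zero_of_ne_one (χ := χ) (by simpa using hne 1 (by norm_num) (by norm_num)),
    MulChar.sum_one_eq_card_units, Fintype.card_units, Nat.cast_sub Fintype.card_pos]
  simp

lemma jacobi_swap (χ ψ : MulChar F R) (h : χ (-1) = 1) :
    jacobiSum χ ψ = jacobiSum χ (χ * ψ)⁻¹ := by
  classical
  rw [jacobiSum_eq_sum_sdiff, jacobiSum_eq_sum_sdiff]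
  refine Finset.sum_bij' (fun a _ ↦ a / (a - 1)) (fun a _ ↦ a / (a - 1)) ?_ ?_ ?_ ?_ ?_
  · intro a ha
    simp only [Finset.mem_sdiff, Finset.mem_univ, Finset.mem_insert, Finset.mem_singleton,
      not_or, true_and] at ha ⊢
    have : a - 1 ≠ 0 := sub_ne_zero.2 ha.2
    refine ⟨div_ne_zero ha.1 this, ?_⟩
    rw [div_eq_one_iff_eq this]
    intro h
    have : (1 : F) = 0 := by linear_combination h
    exact one_ne_zero this
  · intro a ha
    simp only [Finset.mem_sdiff, Finset.mem_univ, Finset.mem_insert, Finset.mem_singleton,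
      not_or, true_and] at ha ⊢
    have : a - 1 ≠ 0 := sub_ne_zero.2 ha.2
    refine ⟨div_ne_zero ha.1 this, ?_⟩
    rw [div_eq_one_iff_eq this]
    intro h
    have : (1 : F) = 0 := by linear_combination h
    exact one_ne_zero this
  · intro a ha
    simp only [Finset.mem_sdiff, Finset.mem_univ, Finset.mem_insert, Finset.mem_singleton,
      not_or, true_and] at ha
    have : a - 1 ≠ 0 := sub_ne_zero.2 ha.2
    have e : a / (a - 1) - 1 = 1 / (a - 1) := by field_simp; ring
    rw [e]; field_simp
  · intro a ha
    simp only [Finset.mem_sdiff, Finset.mem_univ, Finset.mem_insert, Finset.mem_singleton,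
      not_or, true_and] at ha
    have : a - 1 ≠ 0 := sub_ne_zero.2 ha.2
    have e : a / (a - 1) - 1 = 1 / (a - 1) := by field_simp; ring
    rw [e]; field_simp
  · intro a ha
    simp only [Finset.mem_sdiff, Finset.mem_univ, Finset.mem_insert, Finset.mem_singleton,
      not_or, true_and] at ha
    have h1 : a - 1 ≠ 0 := sub_ne_zero.2 ha.2
    have h1' : 1 - a ≠ 0 := sub_ne_zero.2 (Ne.symm ha.2)
    have e : 1 - a / (a - 1) = (1 - a)⁻¹ := by
      refine eq_inv_of_mul_eq_one_left ?_; field_simp; ring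
    have e2 : a = a / (a - 1) * ((1 - a) * -1) := by field_simp; ring
    rw [e, MulChar.inv_apply', inv_inv, MulChar.mul_apply]
    conv_lhs => enter [1]; rw [e2]
    rw [map_mul, map_mul, h]
    ring

open Classical in
/-- number of x with x and 1 - x both nonzero fourth powers -/
noncomputable def fourN (F : Type*) [Field F] [Fintype F] : ℕ :=
  (Finset.univ.filter (fun x : F => IsFourth x ∧ IsFourth (1 - x))).card

lemma fourN_formula (χ : MulChar F R) (h : orderOf χ = 4) (h1 : χ (-1) = 1) :
    (16 : R) * (fourN F : R) = Fintype.card F - 11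
      + 3 * (jacobiSum χ χ + jacobiSum (χ ^ 3) (χ ^ 3)) := by
  classical
  have h4 : χ ^ 4 = 1 := h ▸ pow_orderOf_eq_one χ
  have hne : ∀ j, 0 < j → j < 4 → χ ^ j ≠ 1 := fun j h0 hj =>
    pow_ne_one_of_lt_orderOf h0.ne' (h ▸ hj)
  have n1 : χ ≠ 1 := by simpa using hne 1 (by norm_num) (by norm_num)
  have n2 := hne 2 (by norm_num) (by norm_num)
  have n3 := hne 3 (by norm_num) (by norm_num)
  have i1 : χ⁻¹ = χ ^ 3 := inv_eq_of_mul_eq_one_right (by rw [← h4]; rw [pow_succ' χ 3])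
  have i2 : (χ ^ 2)⁻¹ = χ ^ 2 := inv_eq_of_mul_eq_one_right (by rw [← pow_add, h4])
  have i3 : (χ ^ 3)⁻¹ = χ := inv_eq_of_mul_eq_one_right (by rw [← h4]; rw [pow_succ χ 3])
  have e12 : jacobiSum χ χ = jacobiSum χ (χ ^ 2) := by
    rw [jacobi_swap χ χ h1, ← pow_two, i2]
  have e32 : jacobiSum (χ ^ 3) (χ ^ 3) = jacobiSum (χ ^ 3) (χ ^ 2) := by
    rw [jacobi_swap (χ ^ 3) (χ ^ 3) (by rw [MulChar.pow_apply' χ (by norm_num), h1, one_pow]),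
      ← pow_add, show 3 + 3 = 4 + 2 by norm_num, pow_add, h4, one_mul, i2]
  have e13 : jacobiSum χ (χ ^ 3) = -1 := by rw [← i1, jacobiSum_nontrivial_inv n1, h1]
  have e22 : jacobiSum (χ ^ 2) (χ ^ 2) = -1 := by
    conv_lhs => enter [2]; rw [← i2]
    rw [jacobiSum_nontrivial_inv n2, MulChar.pow_apply' χ (by norm_num), h1, one_pow]
  have key : (16 : R) * (fourN F : R) = ∑ x : F,
      ((1 : MulChar F R) x + χ x + (χ ^ 2) x + (χ ^ 3) x) *
      ((1 : MulChar F R) (1 - x) + χ (1 - x) + (χ ^ 2) (1 - x) + (χ ^ 3) (1 - x)) := by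
    rw [fourN, Finset.card_filter]
    push_cast
    rw [Finset.mul_sum]
    refine Finset.sum_congr rfl fun x _ => ?_
    rw [← four_ite χ h, ← four_ite χ h]
    by_cases a : IsFourth x <;> by_cases b : IsFourth (1 - x) <;> simp [a, b]
    norm_num
  rw [key]
  have : ∀ x : F, ((1 : MulChar F R) x + χ x + (χ ^ 2) x + (χ ^ 3) x) *
      ((1 : MulChar F R) (1 - x) + χ (1 - x) + (χ ^ 2) (1 - x) + (χ ^ 3) (1 - x)) =
      (1 : MulChar F R) x * (1 : MulChar F R) (1 - x) + (1 : MulChar F R) x * χ (1 - x)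
      + (1 : MulChar F R) x * (χ ^ 2) (1 - x) + (1 : MulChar F R) x * (χ ^ 3) (1 - x)
      + (χ x * (1 : MulChar F R) (1 - x) + χ x * χ (1 - x)
      + χ x * (χ ^ 2) (1 - x) + χ x * (χ ^ 3) (1 - x))
      + ((χ ^ 2) x * (1 : MulChar F R) (1 - x) + (χ ^ 2) x * χ (1 - x)
      + (χ ^ 2) x * (χ ^ 2) (1 - x) + (χ ^ 2) x * (χ ^ 3) (1 - x))
      + ((χ ^ 3) x * (1 : MulChar F R) (1 - x) + (χ ^ 3) x * χ (1 - x)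
      + (χ ^ 3) x * (χ ^ 2) (1 - x) + (χ ^ 3) x * (χ ^ 3) (1 - x)) := fun x => by ring
  simp_rw [this, Finset.sum_add_distrib]
  change jacobiSum 1 1 + jacobiSum 1 χ + jacobiSum 1 (χ ^ 2) + jacobiSum 1 (χ ^ 3)
    + (jacobiSum χ 1 + jacobiSum χ χ + jacobiSum χ (χ ^ 2) + jacobiSum χ (χ ^ 3))
    + (jacobiSum (χ ^ 2) 1 + jacobiSum (χ ^ 2) χ + jacobiSum (χ ^ 2) (χ ^ 2)
      + jacobiSum (χ ^ 2) (χ ^ 3))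
    + (jacobiSum (χ ^ 3) 1 + jacobiSum (χ ^ 3) χ + jacobiSum (χ ^ 3) (χ ^ 2)
      + jacobiSum (χ ^ 3) (χ ^ 3)) = _
  rw [jacobiSum_comm χ 1, jacobiSum_comm (χ ^ 2) 1, jacobiSum_comm (χ ^ 3) 1,
    jacobiSum_comm (χ ^ 2) χ, jacobiSum_comm (χ ^ 3) χ, jacobiSum_comm (χ ^ 2) (χ ^ 3),
    jacobiSum_one_one, jacobiSum_one_nontrivial n1, jacobiSum_one_nontrivial n2,
    jacobiSum_one_nontrivial n3, e13, e22, ← e12, ← e32]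
  ring

end chars

lemma choose_not_dvd (p : ℕ) (hp : p.Prime) (hp4 : p % 4 = 1) (n : ℕ) :
    ¬ p ∣ Nat.choose (3 * ((p ^ n - 1) / 4)) ((p ^ n - 1) / 4) := by
  have := Fact.mk hp
  obtain ⟨c, hc⟩ : ∃ c, p = 4 * c + 1 := ⟨p / 4, by omega⟩
  have hc0 : 0 < c := by
    rcases Nat.eq_zero_or_pos c with h | h
    · subst h; exact absurd hp (by rw [hc]; norm_num)
    · exact h
  have hpow : ∀ n, ∃ m, p ^ n = 4 * m + 1 := by
    intro n
    induction n with
    | zero => exact ⟨0, by simp⟩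
    | succ n ih =>
      obtain ⟨m, hm⟩ := ih
      exact ⟨p * m + c, by rw [pow_succ, hm]; nlinarith⟩
  induction n with
  | zero => simpa using hp.one_lt.ne'
  | succ n ih =>
    obtain ⟨m, hm⟩ := hpow n
    have h1 : (p ^ n - 1) / 4 = m := by omega
    have h2 : (p ^ (n + 1) - 1) / 4 = p * m + c := by
      have : p ^ (n + 1) = 4 * (p * m + c) + 1 := by rw [pow_succ, hm]; nlinarith
      omega
    rw [h1] at ih
    rw [h2]
    have L := Choose.choose_modEq_choose_mod_mul_choose_div_nat
      (n := 3 * (p * m + c)) (k := p * m + c) (p := p)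
    have a1 : 3 * (p * m + c) = 3 * c + p * (3 * m) := by ring
    have a2 : (p * m + c) = c + p * m := by ring
    rw [a1, a2, Nat.add_mul_mod_self_left, Nat.add_mul_mod_self_left,
      Nat.add_mul_div_left _ _ hp.pos, Nat.add_mul_div_left _ _ hp.pos,
      Nat.mod_eq_of_lt (show 3 * c < p by omega), Nat.mod_eq_of_lt (show c < p by omega),
      Nat.div_eq_of_lt (show 3 * c < p by omega), Nat.div_eq_of_lt (show c < p by omega),
      zero_add, zero_add] at L
    rw [a1, a2, L.dvd_iff dvd_rfl, hp.dvd_mul]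
    rintro (h | h)
    · have h5 : p ∣ (3 * c).factorial := by
        rw [← Nat.choose_mul_factorial_mul_factorial (show c ≤ 3 * c by omega)]
        exact (h.mul_right _).mul_right _
      have := (hp.dvd_factorial).1 h5
      omega
    · exact ih h

section
variable {F : Type*} [Field F] [Fintype F]

lemma sum_pow_eq (k : ℕ) (hk : k ≠ 0) :
    ∑ x : F, x ^ k = if Fintype.card F - 1 ∣ k then -1 else 0 := by
  classical
  rw [← FiniteField.sum_pow_units F k]
  let φ : Fˣ ↪ F := ⟨fun x ↦ x, Units.val_injective⟩
  have : Finset.univ.map φ = Finset.univ \ {0} := by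
    ext x
    simpa only [Finset.mem_map, Finset.mem_univ, Function.Embedding.coeFn_mk, true_and,
      Finset.mem_sdiff, Finset.mem_singleton, φ] using! isUnit_iff_ne_zero
  calc
    ∑ x : F, x ^ k = ∑ x ∈ Finset.univ \ {(0 : F)}, x ^ k := by
      rw [← Finset.sum_sdiff ({0} : Finset F).subset_univ, Finset.sum_singleton, zero_pow hk,
        add_zero]
    _ = ∑ x : Fˣ, (x ^ k : F) := by simp [φ, ← this]

lemma orderFour (m : ℕ) (hm : Fintype.card F = 4 * m + 1) :
    ∃ χ : MulChar F F, orderOf χ = 4 ∧ ∀ x, χ x = x ^ m := by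
  classical
  have hm0 : m ≠ 0 := by
    rintro rfl
    exact absurd (Fintype.one_lt_card (α := F)) (by omega)
  let χ : MulChar F F := MulChar.ofUnitHom (powMonoidHom m)
  have hχ : ∀ x, χ x = x ^ m := by
    intro x
    by_cases hx : x = 0
    · subst hx; rw [MulChar.map_zero, zero_pow hm0]
    · have := MulChar.ofUnitHom_coe (R' := F) (powMonoidHom m) (Units.mk0 x hx)
      rw [Units.val_mk0] at this
      rw [show χ x = _ from this]; simp
  refine ⟨χ, ?_, hχ⟩
  have : Fact (Nat.Prime 2) := ⟨Nat.prime_two⟩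
  refine orderOf_eq_prime_pow (p := 2) (n := 1) ?_ ?_
  · intro h
    obtain ⟨g, hg⟩ := IsCyclic.exists_ofOrder_eq_natCard (α := Fˣ)
    have h1 := congrArg (fun ψ : MulChar F F => ψ (g : F)) h
    beta_reduce at h1
    rw [MulChar.one_apply_coe, MulChar.pow_apply_coe, hχ, ← pow_mul] at h1
    have h2 : g ^ (m * 2 ^ 1) = 1 := by ext; simpa using h1
    have h3 := orderOf_dvd_of_pow_eq_one h2
    rw [hg, Nat.card_eq_fintype_card, Fintype.card_units, hm] at h3
    have := Nat.le_of_dvd (by omega) h3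
    omega
  · rw [MulChar.eq_one_iff]
    intro a
    rw [MulChar.pow_apply_coe, hχ, ← pow_mul]
    have := FiniteField.pow_card_sub_one_eq_one (a : F) a.ne_zero
    rw [hm] at this
    rw [← this]; congr 1; omega

lemma sum_lt (a b : ℕ) (h : a + b < Fintype.card F - 1) :
    ∑ x : F, x ^ a * (1 - x) ^ b = 0 := by
  have : ∀ x : F, x ^ a * (1 - x) ^ b =
      ∑ j ∈ Finset.range (b + 1), (-1) ^ j * (b.choose j : F) * x ^ (a + j) := by
    intro x
    rw [show (1 - x) = -x + 1 by ring, add_pow, Finset.mul_sum]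
    refine Finset.sum_congr rfl fun j _ => ?_
    rw [neg_pow, pow_add]; ring
  simp_rw [this]
  rw [Finset.sum_comm]
  refine Finset.sum_eq_zero fun j hj => ?_
  rw [← Finset.mul_sum, FiniteField.sum_pow_lt_card_sub_one, mul_zero]
  have := Finset.mem_range.1 hj
  omega

lemma sum_big (m : ℕ) (hm : Fintype.card F = 4 * m + 1) :
    ∑ x : F, x ^ (3 * m) * (1 - x) ^ (3 * m) = - ((-1) ^ m * ((3 * m).choose m : F)) := by
  have hm0 : m ≠ 0 := by
    rintro rfl
    exact absurd (Fintype.one_lt_card (α := F)) (by omega)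
  have : ∀ x : F, x ^ (3 * m) * (1 - x) ^ (3 * m) =
      ∑ j ∈ Finset.range (3 * m + 1), (-1) ^ j * ((3 * m).choose j : F) * x ^ (3 * m + j) := by
    intro x
    rw [show (1 - x) = -x + 1 by ring, add_pow, Finset.mul_sum]
    refine Finset.sum_congr rfl fun j _ => ?_
    rw [neg_pow, pow_add]; ring
  simp_rw [this]
  rw [Finset.sum_comm, Finset.sum_eq_single m]
  · rw [← Finset.mul_sum, sum_pow_eq _ (by omega), if_pos]
    · ring
    · rw [hm]; exact ⟨1, by omega⟩
  · intro j hj hjm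
    rw [← Finset.mul_sum, sum_pow_eq _ (by omega), if_neg, mul_zero]
    rw [hm]
    have := Finset.mem_range.1 hj
    rintro ⟨t, ht⟩
    have h1 : 4 * m + 1 - 1 = 4 * m := by omega
    rw [h1] at ht
    have : t = 1 := by
      rcases t with _ | _ | t
      · omega
      · rfl
      · exfalso; rw [show 4 * m * (t + 1 + 1) = 4 * (m * t) + 8 * m by ring] at ht; omega
    subst this; omega
  · intro h; exact absurd (Finset.mem_range.2 (by omega)) h

lemma fourN_modp (m : ℕ) (hm : Fintype.card F = 4 * m + 1) (hm2 : Even m) :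
    (16 : F) * (fourN F : F) = - 11 - 3 * ((3 * m).choose m : F) := by
  obtain ⟨χ, h4, hχ⟩ := orderFour m hm
  rw [fourN_formula χ h4 (by rw [hχ, hm2.neg_one_pow])]
  have hm0 : m ≠ 0 := by
    rintro rfl
    exact absurd (Fintype.one_lt_card (α := F)) (by omega)
  have e1 : jacobiSum χ χ = 0 := by
    rw [jacobiSum]
    simp_rw [hχ]
    exact sum_lt _ _ (by omega)
  have e3 : jacobiSum (χ ^ 3) (χ ^ 3) = - ((3 * m).choose m : F) := by
    have h3 : ∀ x, (χ ^ 3) x = x ^ (3 * m) := fun x => by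
      rw [MulChar.pow_apply' χ (by norm_num), hχ, ← pow_mul, mul_comm]
    rw [jacobiSum]
    simp_rw [h3]
    rw [sum_big m hm, hm2.neg_one_pow, one_mul]
  rw [e1, e3, FiniteField.cast_card_eq_zero]
  ring
end

lemma gauss_prim : IsPrimitiveRoot (⟨0, 1⟩ : GaussianInt) 4 := by
  rw [IsPrimitiveRoot.iff_orderOf]
  have : Fact (Nat.Prime 2) := ⟨Nat.prime_two⟩
  exact orderOf_eq_prime_pow (p := 2) (n := 1) (by decide) (by decide)

lemma exists_ab (F : Type*) [Field F] [Fintype F] (hQ : Fintype.card F % 8 = 1) :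
    ∃ a b : ℤ, a ^ 2 + b ^ 2 = Fintype.card F ∧
      16 * (fourN F : ℤ) = Fintype.card F - 11 - 6 * a ∧
      ∃ χ : MulChar F GaussianInt, orderOf χ = 4 := by
  obtain ⟨χ, hχ⟩ := MulChar.exists_mulChar_orderOf F (n := 4) (by omega) gauss_prim
  have h4 : χ ^ 4 = 1 := hχ ▸ pow_orderOf_eq_one χ
  have hne : ∀ j, 0 < j → j < 4 → χ ^ j ≠ 1 := fun j h0 hj =>
    pow_ne_one_of_lt_orderOf h0.ne' (hχ ▸ hj)
  have n1 : χ ≠ 1 := by simpa using hne 1 (by norm_num) (by norm_num)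
  have n2 := hne 2 (by norm_num) (by norm_num)
  have i1 : χ⁻¹ = χ ^ 3 := inv_eq_of_mul_eq_one_right (by rw [← h4]; rw [pow_succ' χ 3])
  have hm1 : χ (-1) = 1 := by
    rw [char_eq_one_iff χ hχ]
    obtain ⟨ψ, h, hψ⟩ := orderFour (F := F) (Fintype.card F / 4) (by omega)
    rw [← char_eq_one_iff ψ h, hψ]
    exact Even.neg_one_pow (by rw [Nat.even_iff]; omega)
  have hstar : χ.ringHomComp (starRingEnd GaussianInt) = χ ^ 3 := by
    refine MulChar.ext fun a => ?_
    have h1 : (χ a) ^ 4 = 1 := by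
      rw [← MulChar.pow_apply_coe, h4, MulChar.one_apply_coe]
    have h2 : (χ a).norm = 1 := by
      rw [Zsqrtd.norm_eq_one_iff' (by norm_num)]
      exact IsUnit.of_pow_eq_one h1 (by norm_num)
    have h3 := Zsqrtd.norm_eq_mul_conj (χ a)
    rw [h2] at h3
    rw [MulChar.pow_apply_coe]
    change star (χ a) = _
    calc star (χ a) = (χ a) ^ 4 * star (χ a) := by rw [h1, one_mul]
      _ = (χ a) ^ 3 * (χ a * star (χ a)) := by ring
      _ = _ := by rw [← h3]; simp
  have hJ3 : jacobiSum (χ ^ 3) (χ ^ 3) = star (jacobiSum χ χ) := by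
    rw [← hstar, jacobiSum_ringHomComp]; rfl
  have hnorm : (jacobiSum χ χ) * star (jacobiSum χ χ) = Fintype.card F := by
    rw [← hJ3, ← i1]
    apply GaussianInt.toComplex_injective
    have hinj := GaussianInt.toComplex_injective
    rw [map_mul, ← jacobiSum_ringHomComp, ← jacobiSum_ringHomComp, ← MulChar.ringHomComp_inv]
    rw [jacobiSum_mul_jacobiSum_inv, map_natCast]
    · rw [ringChar.eq_zero]
      exact (CharP.ringChar_ne_zero_of_finite F).symm
    · exact (MulChar.ringHomComp_ne_one_iff hinj).2 n1
    · exact (MulChar.ringHomComp_ne_one_iff hinj).2 n1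
    · rw [← MulChar.ringHomComp_mul, ← pow_two]
      exact (MulChar.ringHomComp_ne_one_iff hinj).2 n2
  refine ⟨-(jacobiSum χ χ).re, -(jacobiSum χ χ).im, ?_, ?_, χ, hχ⟩
  · have := congrArg Zsqrtd.re hnorm
    simp at this
    rw [← this]; ring
  · have h := fourN_formula χ hχ hm1
    rw [hJ3] at h
    have := congrArg Zsqrtd.re h
    simp [Zsqrtd.re_mul] at this
    linarith

lemma assoc_pow (p : ℕ) (π A : GaussianInt) (hπ : Prime π) (hπ' : Prime (star π))
    (hp : π * star π = p) (n : ℕ) (hA : A.norm = (p : ℤ) ^ n) (hpA : ¬ (p : GaussianInt) ∣ A)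
    (hco : IsCoprime π (star π)) :
    Associated A (π ^ n) ∨ Associated A (star π ^ n) := by
  have hNp : π.norm = p := by
    have h := Zsqrtd.norm_eq_mul_conj π
    rw [hp] at h
    exact_mod_cast h
  have hdiv : A ∣ π ^ n * star π ^ n := by
    rw [← mul_pow, hp]
    have h := Zsqrtd.norm_eq_mul_conj A
    rw [hA] at h
    push_cast at h
    rw [h]; exact dvd_mul_right _ _
  have hassoc : ∀ B : GaussianInt, B.norm = (p : ℤ) ^ n → A ∣ B → Associated A B := by
    rintro B hB ⟨c, rfl⟩
    rw [Zsqrtd.norm_mul, hA] at hB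
    have hp0 : (p : ℤ) ^ n ≠ 0 := by
      apply pow_ne_zero
      rw [← hNp]
      intro h
      exact hπ.ne_zero (GaussianInt.norm_eq_zero.1 h)
    have hc : c.norm = 1 := by
      apply mul_left_cancel₀ hp0
      rw [hB, mul_one]
    have hu := (Zsqrtd.norm_eq_one_iff' (by norm_num) c).1 hc
    exact ⟨hu.unit, rfl⟩
  have hpow : ∀ B : GaussianInt, B.norm = p → (B ^ n).norm = (p : ℤ) ^ n := by
    intro B hB
    rw [← hB]; exact map_pow Zsqrtd.normMonoidHom B n
  by_cases h1 : π ∣ A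
  · left
    have h2 : ¬ star π ∣ A := fun h => hpA (hp ▸ hco.mul_dvd h1 h)
    have : IsCoprime A (star π ^ n) :=
      (((Prime.coprime_iff_not_dvd hπ').2 h2).pow_left).symm
    exact hassoc _ (hpow _ hNp) (this.dvd_of_dvd_mul_right hdiv)
  · right
    have : IsCoprime A (π ^ n) :=
      (((Prime.coprime_iff_not_dvd hπ).2 h1).pow_left).symm
    exact hassoc _ (hpow _ (by rw [Zsqrtd.norm_conj, hNp])) (this.dvd_of_dvd_mul_left hdiv)

lemma prime_of_norm (p : ℕ) (hp : p.Prime) (π : GaussianInt) (h : π.norm = p) : Prime π := by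
  rw [← irreducible_iff_prime]
  constructor
  · intro hu
    rw [← Zsqrtd.norm_eq_one_iff' (by norm_num), h] at hu
    exact hp.one_lt.ne' (by exact_mod_cast hu)
  · rintro a b rfl
    rw [Zsqrtd.norm_mul] at h
    have h2 : a.norm.natAbs * b.norm.natAbs = p := by
      rw [← Int.natAbs_mul, h]; simp
    rw [← Zsqrtd.norm_eq_one_iff, ← Zsqrtd.norm_eq_one_iff]
    rw [← h2] at hp
    rcases Nat.prime_mul_iff.1 hp with ⟨_, h⟩ | ⟨_, h⟩
    · exact Or.inr h
    · exact Or.inl h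

lemma norm_one_cases (u : GaussianInt) (h : IsUnit u) :
    u = 1 ∨ u = -1 ∨ u = ⟨0, 1⟩ ∨ u = ⟨0, -1⟩ := by
  rw [← Zsqrtd.norm_eq_one_iff' (by norm_num), Zsqrtd.norm_def] at h
  obtain ⟨x, y⟩ := u
  simp only at h
  have hx : x ≤ 1 := by nlinarith [mul_self_nonneg y]
  have hx' : -1 ≤ x := by nlinarith [mul_self_nonneg y]
  have hy : y ≤ 1 := by nlinarith [mul_self_nonneg x]
  have hy' : -1 ≤ y := by nlinarith [mul_self_nonneg x]
  interval_cases x <;> interval_cases y <;> simp_all [Zsqrtd.ext_iff]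

/-- primary associates coincide -/
lemma primary_eq (A B : GaussianInt) (h : Associated A B) (hA : A.re % 4 = 1)
    (hA' : A.im % 2 = 0) (hB : B.re % 4 = 1) (hB' : B.im % 2 = 0) : A = B := by
  obtain ⟨u, rfl⟩ := h
  rcases norm_one_cases u u.isUnit with h | h | h | h
  · rw [h, mul_one]
  all_goals
    rw [h] at hB hB'
    simp at hB hB'
    omega

lemma re_eq (p r q : ℕ) (e₁ f₁ : ℤ)
    (hp : p.Prime) (hp4 : p % 4 = 1) (hqpr : q = p ^ r) (hq8 : q % 8 = 1)
    (hef : (q : ℤ) = e₁ ^ 2 + 4 * f₁ ^ 2) (he4 : e₁ % 4 = 1) (hpe : ¬ (p : ℤ) ∣ e₁)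
    (ℓ : ℕ) (a b : ℤ) (hab : a ^ 2 + b ^ 2 = (q : ℤ) ^ ℓ) (ha : a % 4 = 1) (hpa : ¬ (p : ℤ) ∣ a) :
    a = ((⟨e₁, 2 * f₁⟩ : GaussianInt) ^ ℓ).re := by
  have := Fact.mk hp
  obtain ⟨x, y, hxy⟩ := Nat.Prime.sq_add_sq (p := p) (by omega)
  set π : GaussianInt := ⟨x, y⟩ with hπdef
  have hN : π.norm = p := by
    rw [Zsqrtd.norm_def, ← hxy]; push_cast; simp only [hπdef]; ring
  have hpp : π * star π = p := by
    rw [← Zsqrtd.norm_eq_mul_conj, hN]; simp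
  have hP := prime_of_norm p hp π hN
  have hP' := prime_of_norm p hp (star π) (by rw [Zsqrtd.norm_conj, hN])
  have hco : IsCoprime π (star π) := by
    rw [Prime.coprime_iff_not_dvd hP]
    intro h
    -- π ∣ π + star π = 2 x, so p ∣ 4 x ^ 2
    have h1 : π ∣ ((2 * x : ℤ) : GaussianInt) := by
      have : ((2 * x : ℤ) : GaussianInt) = π + star π := by
        rw [hπdef]; ext <;> simp; ring
      rw [this]; exact dvd_add dvd_rfl h
    obtain ⟨c, hc⟩ := h1
    have h2 := congrArg Zsqrtd.norm hc
    rw [Zsqrtd.norm_mul, hN, Zsqrtd.norm_intCast] at h2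
    have h3 : (p : ℤ) ∣ (2 * x) * (2 * x) := ⟨_, h2⟩
    have h4 : p ∣ (2 * x) * (2 * x) := by exact_mod_cast h3
    have h5 : p ∣ x := by
      rcases (hp.dvd_mul).1 h4 with h | h <;> rcases (hp.dvd_mul).1 h with h | h <;>
        first
        | exact h
        | (have := Nat.le_of_dvd (by norm_num) h; have := hp.two_le; omega)
    have hx0 : x ≠ 0 := by
      rintro rfl
      have : p = y * y := by rw [← hxy]; ring
      rw [this] at hp
      have hy1 : y ≠ 1 := by rintro rfl; exact absurd hp (by norm_num)
      exact Nat.not_prime_mul hy1 hy1 hp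
    have h6 := Nat.le_of_dvd (Nat.pos_of_ne_zero hx0) h5
    have h7 := hp.two_le
    nlinarith
  set E : GaussianInt := ⟨e₁, 2 * f₁⟩ with hE
  have hEN : E.norm = (p : ℤ) ^ r := by
    rw [Zsqrtd.norm_def]
    have : ((q : ℕ) : ℤ) = (p : ℤ) ^ r := by rw [hqpr]; push_cast; rfl
    rw [← this, hef]; simp only [hE]; ring
  have hnd : ∀ A : GaussianInt, ¬ (p : ℤ) ∣ A.re → ¬ (p : GaussianInt) ∣ A := by
    intro A hA h
    have h' : ((p : ℤ) : GaussianInt) ∣ A := by simpa using h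
    exact hA ((Zsqrtd.intCast_dvd _ _).1 h').1
  set A : GaussianInt := ⟨a, b⟩ with hAdef
  have hAN : A.norm = (p : ℤ) ^ (r * ℓ) := by
    rw [Zsqrtd.norm_def]
    have : ((q : ℕ) : ℤ) ^ ℓ = (p : ℤ) ^ (r * ℓ) := by rw [hqpr]; push_cast; rw [pow_mul]
    rw [← this, ← hab]; simp only [hAdef]; ring
  have hE1 := assoc_pow p π E hP hP' hpp r hEN (hnd E hpe) hco
  have hA1 := assoc_pow p π A hP hP' hpp (r * ℓ) hAN (hnd A hpa) hco
  have hA2 : Associated A (E ^ ℓ) ∨ Associated A (star (E ^ ℓ)) := by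
    have st : ∀ {X Y : GaussianInt}, Associated X Y → Associated (star X) (star Y) := by
      intro X Y h
      exact h.map (starRingEnd GaussianInt)
    rcases hE1 with h | h
    · have h2 := h.pow_pow (n := ℓ)
      rw [← pow_mul] at h2
      rcases hA1 with h3 | h3
      · exact Or.inl (h3.trans h2.symm)
      · have h4 := st h2
        rw [star_pow π] at h4
        exact Or.inr (h3.trans h4.symm)
    · have h2 := h.pow_pow (n := ℓ)
      rw [← pow_mul] at h2
      rcases hA1 with h3 | h3
      · have h4 := st h2
        rw [star_pow (star π), star_star] at h4
        exact Or.inr (h3.trans h4.symm)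
      · exact Or.inl (h3.trans h2.symm)
  have hf : f₁ % 2 = 0 := by
    have h1 : (q : ℤ) % 8 = 1 := by omega
    by_contra hf
    obtain ⟨s, hs⟩ : ∃ s, e₁ = 4 * s + 1 := ⟨e₁ / 4, by omega⟩
    obtain ⟨t, ht⟩ : ∃ t, f₁ = 2 * t + 1 := ⟨f₁ / 2, by omega⟩
    rw [hs, ht] at hef
    have : (q : ℤ) = 8 * (2 * s ^ 2 + s + 2 * t ^ 2 + 2 * t) + 5 := by rw [hef]; ring
    omega
  have hEl : ∀ n, (E ^ n).re % 4 = 1 ∧ (E ^ n).im % 4 = 0 := by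
    intro n
    induction n with
    | zero => simp
    | succ n ih =>
      obtain ⟨s, hs⟩ : ∃ s, e₁ = 4 * s + 1 := ⟨e₁ / 4, by omega⟩
      obtain ⟨t, ht⟩ : ∃ t, 2 * f₁ = 4 * t := ⟨f₁ / 2, by omega⟩
      obtain ⟨u, hu⟩ : ∃ u, (E ^ n).re = 4 * u + 1 := ⟨(E ^ n).re / 4, by omega⟩
      obtain ⟨v, hv⟩ : ∃ v, (E ^ n).im = 4 * v := ⟨(E ^ n).im / 4, by omega⟩
      rw [pow_succ, Zsqrtd.re_mul, Zsqrtd.im_mul, hu, hv]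
      simp only [hE, hs, ht]
      constructor
      · ring_nf; omega
      · ring_nf; omega
  have hb : b % 2 = 0 := by
    have hq : Odd ((q : ℤ) ^ ℓ) := Odd.pow (by rw [Int.odd_iff]; omega)
    rw [← hab] at hq
    have ha' : Odd (a ^ 2) := Odd.pow (by rw [Int.odd_iff]; omega)
    have : Even (b ^ 2) := by
      by_contra h
      rw [Int.not_even_iff_odd] at h
      exact (Int.not_even_iff_odd.2 hq) (ha'.add_odd h)
    rw [Int.even_pow] at this
    exact Int.even_iff.1 this.1
  obtain ⟨g1, g2⟩ := hEl ℓ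
  rcases hA2 with h | h
  · have := primary_eq _ _ h ha hb g1 (by omega)
    rw [← this]
  · have := primary_eq _ _ h ha hb (by rw [Zsqrtd.re_star]; exact g1) (by rw [Zsqrtd.im_star]; omega)
    have := congrArg Zsqrtd.re this
    rw [Zsqrtd.re_star] at this
    exact this

open Classical in
lemma six_cliques {V : Type*} [Fintype V] (G : SimpleGraph V) :
    6 * G.cliqueCount 3 = (Finset.univ.filter (fun t : V × V × V =>
      G.Adj t.1 t.2.1 ∧ G.Adj t.1 t.2.2 ∧ G.Adj t.2.1 t.2.2)).card := by
  have hc : G.cliqueCount 3 = (Finset.univ.filter (fun s : Finset V => G.IsNClique 3 s)).card := by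
    rw [SimpleGraph.cliqueCount, Nat.card_eq_fintype_card, Fintype.card_subtype]
  rw [hc]
  rw [Finset.card_eq_sum_card_fiberwise (f := fun t : V × V × V => ({t.1, t.2.1, t.2.2} : Finset V))
    (t := Finset.univ.filter (fun s : Finset V => G.IsNClique 3 s))]
  · rw [Finset.sum_const_nat (m := 6), mul_comm]
    intro s hs
    rw [Finset.mem_filter] at hs
    obtain ⟨a, b, c, hab, hac, hbc, rfl⟩ := SimpleGraph.is3Clique_iff.1 hs.2
    have nab := hab.ne
    have nac := hac.ne
    have nbc := hbc.ne
    have : ((Finset.univ.filter (fun t : V × V × V =>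
      G.Adj t.1 t.2.1 ∧ G.Adj t.1 t.2.2 ∧ G.Adj t.2.1 t.2.2)).filter
        (fun t => ({t.1, t.2.1, t.2.2} : Finset V) = {a, b, c})) =
        {(a, b, c), (a, c, b), (b, a, c), (b, c, a), (c, a, b), (c, b, a)} := by
      ext ⟨x, y, z⟩
      simp only [Finset.mem_filter, Finset.mem_univ, true_and, Finset.mem_insert,
        Finset.mem_singleton, Prod.mk.injEq]
      constructor
      · rintro ⟨⟨h1, h2, h3⟩, h⟩
        have n1 := h1.ne
        have n2 := h2.ne
        have n3 := h3.ne
        have hx : x ∈ ({a, b, c} : Finset V) := by rw [← h]; simp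
        have hy : y ∈ ({a, b, c} : Finset V) := by rw [← h]; simp
        have hz : z ∈ ({a, b, c} : Finset V) := by rw [← h]; simp
        simp only [Finset.mem_insert, Finset.mem_singleton] at hx hy hz
        clear h h1 h2 h3 hs
        grind
      · have h1 := hab.symm
        have h2 := hac.symm
        have h3 := hbc.symm
        rintro (⟨rfl, rfl, rfl⟩ | ⟨rfl, rfl, rfl⟩ | ⟨rfl, rfl, rfl⟩ | ⟨rfl, rfl, rfl⟩ |
          ⟨rfl, rfl, rfl⟩ | ⟨rfl, rfl, rfl⟩) <;>
        refine ⟨⟨by assumption, by assumption, by assumption⟩, ?_⟩ <;>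
        (ext w; simp only [Finset.mem_insert, Finset.mem_singleton]; try tauto)
    rw [this]
    simp [nab, nac, nbc, nab.symm, nac.symm, nbc.symm]
  · intro t ht
    simp only [Finset.coe_filter, Finset.mem_univ, true_and, Set.mem_ofPred_eq] at ht ⊢
    exact SimpleGraph.is3Clique_iff.2 ⟨_, _, _, ht.1, ht.2.1, ht.2.2, rfl⟩

section
variable {F : Type*} [Field F]

lemma IsFourth.ne_zero {x : F} (h : IsFourth x) : x ≠ 0 := by
  obtain ⟨z, hz, rfl⟩ := h
  exact pow_ne_zero _ hz

lemma IsFourth.mul {x y : F} (h : IsFourth x) (h' : IsFourth y) : IsFourth (x * y) := by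
  obtain ⟨z, hz, rfl⟩ := h
  obtain ⟨w, hw, rfl⟩ := h'
  exact ⟨z * w, mul_ne_zero hz hw, by ring⟩

lemma IsFourth.div {x y : F} (h : IsFourth x) (h' : IsFourth y) : IsFourth (x / y) := by
  obtain ⟨z, hz, rfl⟩ := h
  obtain ⟨w, hw, rfl⟩ := h'
  exact ⟨z / w, div_ne_zero hz hw, by rw [div_pow]⟩

lemma adj_iff (h : IsFourth (-1 : F)) (x y : F) :
    (paleyGraph F 4).Adj x y ↔ IsFourth (y - x) := by
  rw [paleyGraph, SimpleGraph.fromRel_adj]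
  change x ≠ y ∧ (IsFourth (y - x) ∨ IsFourth (x - y)) ↔ _
  constructor
  · rintro ⟨_, h' | h'⟩
    · exact h'
    · have := h.mul h'
      rwa [show -1 * (x - y) = y - x by ring] at this
  · intro h'
    exact ⟨fun e => h'.ne_zero (by rw [e, sub_self]), Or.inl h'⟩

open Classical in
lemma triangles_eq [Fintype F] (h : IsFourth (-1 : F)) :
    6 * (paleyGraph F 4).cliqueCount 3 =
      Fintype.card F * ((Finset.univ.filter (fun x : F => IsFourth x)).card * fourN F) := by
  rw [six_cliques, fourN, ← Finset.card_product, ← Finset.card_univ, ← Finset.card_product]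
  simp only [adj_iff h]
  refine Finset.card_bij' (fun t _ => (t.1, t.2.1 - t.1, (t.2.2 - t.1) / (t.2.1 - t.1)))
    (fun t _ => (t.1, t.1 + t.2.1, t.1 + t.2.1 * t.2.2)) ?_ ?_ ?_ ?_
  · rintro ⟨x, y, z⟩ ht
    simp only [Finset.mem_filter, Finset.mem_univ, true_and, Finset.mem_product] at ht ⊢
    obtain ⟨h1, h2, h3⟩ := ht
    refine ⟨h1, h2.div h1, ?_⟩
    have := (h.mul h3).div h1
    have h0 := h1.ne_zero
    rwa [show -1 * (z - y) / (y - x) = 1 - (z - x) / (y - x) by field_simp; ring] at this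
  · rintro ⟨x, d, t⟩ ht
    simp only [Finset.mem_filter, Finset.mem_univ, true_and, Finset.mem_product] at ht ⊢
    obtain ⟨h1, h2, h3⟩ := ht
    refine ⟨by simpa using h1, by simpa using h1.mul h2, ?_⟩
    have := h.mul (h1.mul h3)
    rwa [show -1 * (d * (1 - t)) = x + d * t - (x + d) by ring] at this
  · rintro ⟨x, y, z⟩ ht
    simp only [Finset.mem_filter, Finset.mem_univ, true_and] at ht
    have h0 := ht.1.ne_zero
    simp only [Prod.mk.injEq, true_and]
    constructor
    · ring
    · field_simp; ring
  · rintro ⟨x, d, t⟩ ht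
    simp only [Finset.mem_filter, Finset.mem_univ, true_and, Finset.mem_product] at ht
    have h0 := ht.1.ne_zero
    simp only [Prod.mk.injEq, true_and]
    constructor
    · ring
    · rw [add_sub_cancel_left, add_sub_cancel_left]; field_simp
end

/-- Let `p ≡ 1 (mod 4)` be prime, `q = p^r ≡ 1 (mod 8)`, with `q = e₁² + 4f₁²`,
`e₁ ≡ 1 (mod 4)`, `p ∤ e₁`. With `e_ℓ = ½(e₁+2f₁·i)^ℓ + ½(e₁-2f₁·i)^ℓ`, the number of
triangles in `Γ(4, q^ℓ)` is `q^ℓ(q^ℓ-1)(q^ℓ-6e_ℓ-11)/(2⁷·3)` for every `ℓ ≥ 1`. -/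
theorem triangleCount_paley_four_ext (p r q : ℕ) (e₁ f₁ : ℤ)
    (hp : p.Prime) (hp4 : p % 4 = 1) (hqpr : q = p ^ r) (hq8 : q % 8 = 1)
    (hef : (q : ℤ) = e₁ ^ 2 + 4 * f₁ ^ 2) (he4 : e₁ % 4 = 1) (hpe : ¬ (p : ℤ) ∣ e₁)
    (ℓ : ℕ) (hℓ : 1 ≤ ℓ)
    (F : Type*) [Field F] [Fintype F] (hF : Fintype.card F = q ^ ℓ) :
    (2 ^ 7 * 3 : ℂ) * ((paleyGraph F 4).cliqueCount 3 : ℂ) =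
      (q : ℂ) ^ ℓ * ((q : ℂ) ^ ℓ - 1) *
        ((q : ℂ) ^ ℓ -
          6 * ((1 / 2 : ℂ) * ((e₁ : ℂ) + 2 * (f₁ : ℂ) * I) ^ ℓ +
            (1 / 2 : ℂ) * ((e₁ : ℂ) - 2 * (f₁ : ℂ) * I) ^ ℓ) - 11) := by
  have hQ8 : Fintype.card F % 8 = 1 := by
    rw [hF, Nat.pow_mod, hq8, one_pow]; norm_num
  obtain ⟨a, b, hab, hN, χ, hχ⟩ := exists_ab F hQ8
  obtain ⟨m, hm⟩ : ∃ m, Fintype.card F = 4 * m + 1 := ⟨Fintype.card F / 4, by omega⟩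
  have hm2 : Even m := by rw [Nat.even_iff]; omega
  have ha4 : a % 4 = 1 := by omega
  have hneg : IsFourth (-1 : F) := by
    obtain ⟨ψ, h, hψ⟩ := orderFour (F := F) m hm
    rw [← char_eq_one_iff ψ h, hψ, hm2.neg_one_pow]
  have hQp : Fintype.card F = p ^ (r * ℓ) := by rw [hF, hqpr, pow_mul]
  -- the characteristic is `p`
  have hchar : CharP F p := by
    have := Fact.mk hp
    exact charP_of_card_eq_prime_pow (f := r * ℓ) (by rw [← hQp])
  have hpa : ¬ (p : ℤ) ∣ a := by
    intro hd
    have h1 : ((a : ℤ) : F) = 0 := (CharP.intCast_eq_zero_iff F p a).2 hd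
    have h2 := fourN_modp (F := F) m hm hm2
    have h3 := congrArg (Int.cast : ℤ → F) hN
    push_cast at h3
    rw [h1, FiniteField.cast_card_eq_zero, h2] at h3
    have h4 : ((3 * (3 * m).choose m : ℕ) : F) = 0 := by
      push_cast; linear_combination -h3
    rw [CharP.cast_eq_zero_iff F p, hp.dvd_mul] at h4
    rcases h4 with h | h
    · have := Nat.le_of_dvd (by norm_num) h
      have := hp.two_le
      omega
    · have := choose_not_dvd p hp hp4 (r * ℓ)
      rw [← hQp, hm, show (4 * m + 1 - 1) / 4 = m by omega] at this
      exact this h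
  have hre := re_eq p r q e₁ f₁ hp hp4 hqpr hq8 hef he4 hpe ℓ a b
    (by rw [hab, hF]; push_cast; rfl) ha4 hpa
  -- the complex expression is `a`
  have hc : (1 / 2 : ℂ) * ((e₁ : ℂ) + 2 * (f₁ : ℂ) * I) ^ ℓ +
            (1 / 2 : ℂ) * ((e₁ : ℂ) - 2 * (f₁ : ℂ) * I) ^ ℓ = a := by
    set E : GaussianInt := ⟨e₁, 2 * f₁⟩ with hE
    have c1 : (e₁ : ℂ) + 2 * (f₁ : ℂ) * I = GaussianInt.toComplex E := by
      rw [GaussianInt.toComplex_def]; simp [hE]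
    have c2 : (e₁ : ℂ) - 2 * (f₁ : ℂ) * I = GaussianInt.toComplex (star E) := by
      rw [GaussianInt.toComplex_def]; simp [hE]; ring
    rw [c1, c2, ← map_pow, ← map_pow, ← star_pow, hre, GaussianInt.toComplex_def,
      GaussianInt.toComplex_def, Zsqrtd.re_star, Zsqrtd.im_star]
    push_cast; ring
  rw [hc]
  classical
  have hT := triangles_eq hneg
  have hD := card_fourth χ hχ
  have hD' : 4 * ((Finset.univ.filter (fun x : F => IsFourth x)).card : ℤ)
      = Fintype.card F - 1 := by
    have := congrArg Zsqrtd.re hD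
    simp at this
    convert this using 3
  set d := (Finset.univ.filter (fun x : F => IsFourth x)).card with hd
  have hT' := congrArg (Nat.cast : ℕ → ℂ) hT
  have hD'' := congrArg (Int.cast : ℤ → ℂ) hD'
  have hN' := congrArg (Int.cast : ℤ → ℂ) hN
  have hF' := congrArg (Nat.cast : ℕ → ℂ) hF
  push_cast at hT' hD'' hN' hF'
  rw [← hF']
  linear_combination 64 * hT' + (Fintype.card F : ℂ) * (16 * (fourN F : ℂ)) * hD''
    + (Fintype.card F : ℂ) * ((Fintype.card F : ℂ) - 1) * hN'
end

section
/- Let (R,𝔪) be a finite commutative local ring with identity, with maximal ideal of size |𝔪| = q^β and residue field R/𝔪 of size q = p^r (p prime), where gcd(2,|R|) = 1 and q ≡ 1 (mod 4). Let x, y ∈ ℤ with q = x² + 4y², and such that p does not divide x when p ≡ 1 (mod 4). Then the number of cliques of size 4 in G_R(2) is K_4(G_R(2)) = q^(4β+1) (q−1)((q−9)² − 16y²) / (2⁹ · 3). -/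
/-- The `k`-unitary Cayley graph `G_R(k)` of a commutative ring `R`: distinct `x, y ∈ R` are
adjacent iff `y - x = u^k` for some unit `u ∈ R^*` (symmetrized; under the hypotheses of the
theorem below this relation is already symmetric). -/
def unitaryCayleyGraph (R : Type*) [CommRing R] (k : ℕ) : SimpleGraph R :=
  SimpleGraph.fromRel fun x y => ∃ u : Rˣ, y - x = (u : R) ^ k

section QCsums
set_option linter.unusedSectionVars false
variable {F : Type*} [Field F] [Fintype F] [DecidableEq F]

/-- The quadratic character as a plain function. -/
def qc (t : F) : ℤ := quadraticChar F t

@[simp] lemma qc_zero : qc (0 : F) = 0 := by unfold qc; exact MulChar.map_zero _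
@[simp] lemma qc_one : qc (1 : F) = 1 := map_one _
lemma qc_mul (s t : F) : qc (s * t) = qc s * qc t := map_mul _ _ _
lemma qc_card_sqrts (hF : ringChar F ≠ 2) (a : F) :
    ((Finset.univ.filter fun x : F => x ^ 2 = a).card : ℤ) = qc a + 1 := by
  rw [qc, ← quadraticChar_card_sqrts hF a]
  congr 2
  ext; simp

lemma qc_sum (hF : ringChar F ≠ 2) : ∑ t : F, qc t = 0 :=
  quadraticChar_sum_zero hF

lemma qc_sq (t : F) : qc t * qc t = if t = 0 then 0 else 1 := by
  split_ifs with h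
  · simp [h]
  · have := quadraticChar_sq_one h
    rw [← this, qc]; ring

lemma qc_sq' {t : F} (h : t ≠ 0) : qc t * qc t = 1 := by
  simp [qc_sq, h]

lemma qc_inv (t : F) : qc t⁻¹ = qc t := by
  by_cases h : t = 0
  · simp [h]
  · have h1 : qc t * qc t⁻¹ = 1 := by
      rw [← qc_mul, mul_inv_cancel₀ h, qc_one]
    have h2 := qc_sq' h
    have : qc t * (qc t * qc t⁻¹) = qc t * 1 := by rw [h1]
    rw [← mul_assoc, h2] at this
    linarith

lemma qc_neg (h1 : qc (-1 : F) = 1) (t : F) : qc (-t) = qc t := by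
  rw [← neg_one_mul, qc_mul, h1, one_mul]

lemma qc_comm (h1 : qc (-1 : F) = 1) (s t : F) :
    qc (s - t) = qc (t - s) := by
  rw [← neg_sub, qc_neg h1]

lemma qc_sum_translate (H : F → ℤ) (a : F) : ∑ t, H (t - a) = ∑ t, H t :=
  Fintype.sum_equiv (Equiv.subRight a) _ _ (fun _ => rfl)

lemma sum_reflect (H : F → ℤ) (a : F) : ∑ t, H (a - t) = ∑ t, H t :=
  Fintype.sum_equiv (Equiv.subLeft a) _ _ (fun _ => rfl)

lemma sum_scale (H : F → ℤ) {a : F} (ha : a ≠ 0) : ∑ t, H (a * t) = ∑ t, H t :=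
  Fintype.sum_equiv (Equiv.mulLeft₀ a ha) _ _ (fun _ => rfl)

lemma sum_inv (H : F → ℤ) : ∑ t, H (t⁻¹) = ∑ t, H t :=
  Fintype.sum_equiv (Equiv.inv F) _ _ (fun _ => rfl)

lemma sum_ite_ne (H : F → ℤ) (a : F) : ∑ t, (if t = a then 0 else 1) * H t = ∑ t, H t - H a := by
  have : ∀ t, (if t = a then (0:ℤ) else 1) * H t = H t - if t = a then H t else 0 := by
    intro t; split_ifs <;> simp
  simp_rw [this, Finset.sum_sub_distrib]
  simp

lemma sum_qc_lin (hF : ringChar F ≠ 2) {a : F} (ha : a ≠ 0) (b : F) :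
    ∑ t, qc (b - a * t) = 0 := by
  rw [sum_scale (fun t => qc (b - t)) ha, sum_reflect (fun t => qc t), qc_sum hF]

lemma sum_qc_lin' (hF : ringChar F ≠ 2) (b : F) :
    ∑ t, qc (t - b) = 0 := by
  rw [qc_sum_translate (fun t => qc t), qc_sum hF]

lemma sum_qc_quad0 (hF : ringChar F ≠ 2) (c : F) :
    ∑ t, qc t * qc (t - c) =
      (if c = 0 then (Fintype.card F : ℤ) else 0) - 1 := by
  split_ifs with h
  · subst h
    have := sum_ite_ne (F := F) (fun _ => 1) 0
    simp only [sub_zero, qc_sq]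
    simpa using this
  · have e : ∀ t, qc t * qc (t - c) =
        (if t⁻¹ = 0 then 0 else 1) * qc (1 - c * t⁻¹) := by
      intro t
      by_cases ht : t = 0
      · simp [ht]
      · have : t - c = t * (1 - c * t⁻¹) := by field_simp
        rw [this, qc_mul, ← mul_assoc, qc_sq]
        simp [ht]
    simp_rw [e]
    rw [sum_inv (fun u => (if u = 0 then 0 else 1) * qc (1 - c * u)),
      sum_ite_ne, sum_qc_lin hF h]
    simp

lemma sum_qc_quad (hF : ringChar F ≠ 2) (a b : F) :
    ∑ t, qc (t - a) * qc (t - b) =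
      (if a = b then (Fintype.card F : ℤ) else 0) - 1 := by
  have := qc_sum_translate (fun t => qc t * qc (t - (b - a))) a
  rw [sum_qc_quad0 hF] at this
  simp only [sub_eq_zero, sub_sub_sub_cancel_right] at this
  rw [this]
  simp only [eq_comm]

/-- The sum over squares. -/
lemma sum_sq (hF : ringChar F ≠ 2) (H : F → ℤ) :
    ∑ c, H (c ^ 2) = ∑ a, (1 + qc a) * H a := by
  rw [← Finset.sum_fiberwise Finset.univ (fun c : F => c ^ 2)]
  refine Finset.sum_congr rfl fun a _ => ?_
  have := qc_card_sqrts hF a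
  rw [Finset.sum_congr rfl (g := fun _ => H a)]
  · rw [Finset.sum_const, nsmul_eq_mul, add_comm, ← this]
  · intro c hc; simp at hc; rw [hc]

lemma sum_nonsq (hF : ringChar F ≠ 2) {g : F} (hg : qc g = -1) (H : F → ℤ) :
    ∑ c, H (g * c ^ 2) = ∑ a, (1 - qc a) * H a := by
  have hg0 : g ≠ 0 := by rintro rfl; simp at hg
  rw [sum_sq hF (fun x => H (g * x)), ← sum_scale (fun a => (1 - qc a) * H a) hg0]
  refine Finset.sum_congr rfl fun a _ => ?_
  rw [qc_mul, hg]; ring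

/-- substitution z = s + w / s -/
lemma sum_add_inv (hF : ringChar F ≠ 2) {w : F} (hw : w ≠ 0) (H : F → ℤ) :
    ∑ s, (if s = 0 then 0 else 1) * H (s + w * s⁻¹) =
      ∑ z, (1 + qc (z ^ 2 - 4 * w)) * H z := by
  have h2 : (2 : F) ≠ 0 := Ring.two_ne_zero hF
  have : ∑ s, (if s = 0 then 0 else 1) * H (s + w * s⁻¹) =
      ∑ s ∈ Finset.univ.filter (fun s : F => s ≠ 0), H (s + w * s⁻¹) := by
    rw [Finset.sum_filter]
    refine Finset.sum_congr rfl fun s _ => ?_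
    by_cases h : s = 0 <;> simp [h]
  rw [this, ← Finset.sum_fiberwise _ (fun s : F => s + w * s⁻¹)]
  refine Finset.sum_congr rfl fun z _ => ?_
  have hc := qc_card_sqrts hF (z ^ 2 - 4 * w)
  rw [Finset.sum_congr rfl (g := fun _ => H z)]
  · rw [Finset.sum_const, nsmul_eq_mul, add_comm, ← hc]
    congr 2
    refine Finset.card_bij' (fun s _ => s - w * s⁻¹) (fun d _ => (z + d) / 2) ?_ ?_ ?_ ?_
    · intro s hs
      simp at hs ⊢
      obtain ⟨h0, rfl⟩ := hs
      field_simp; ring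
    · intro d hd
      simp at hd ⊢
      have h0 : z + d ≠ 0 := by
        intro h
        have : d = - z := by linear_combination h
        rw [this] at hd
        have : (2 * 2) * w = 0 := by linear_combination hd
        simp [h2, hw] at this
      refine ⟨⟨h0, h2⟩, ?_⟩
      field_simp
      linear_combination hd
    · intro s hs
      simp at hs ⊢
      obtain ⟨h0, rfl⟩ := hs
      field_simp; ring
    · intro d hd
      simp at hd ⊢
      have h0 : z + d ≠ 0 := by
        intro h
        have : d = - z := by linear_combination h
        rw [this] at hd
        have : (2 * 2) * w = 0 := by linear_combination hd
        simp [h2, hw] at this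
      field_simp
      linear_combination -hd
  · intro c hc; simp at hc; rw [hc.2]


/-- Jacobsthal sum -/
def jsum (a : F) : ℤ := ∑ m : F, qc m * qc (m ^ 2 - a)

lemma jsum_twist (hF : ringChar F ≠ 2) (g c : F) : jsum (g * c ^ 2) = qc c * jsum g := by
  unfold jsum
  by_cases hc : c = 0
  · subst hc
    simp only [ne_eq, OfNat.ofNat_ne_zero, not_false_eq_true, zero_pow, mul_zero, sub_zero,
      qc_zero, zero_mul]
    rw [← qc_sum (F := F) hF]
    refine Finset.sum_congr rfl fun m _ => ?_
    rw [pow_two, qc_mul, qc_sq]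
    by_cases h : m = 0 <;> simp [h]
  · rw [← sum_scale _ hc, Finset.mul_sum]
    refine Finset.sum_congr rfl fun m _ => ?_
    have : (c * m) ^ 2 - g * c ^ 2 = c * c * (m ^ 2 - g) := by ring
    rw [this, qc_mul, qc_mul, qc_mul, qc_sq' hc]; ring

lemma jsum_alt (h1 : qc (-1 : F) = 1) {g : F} (hg : g ≠ 0) :
    ∑ c, qc (1 - g * c ^ 2) * qc c = jsum g := by
  unfold jsum
  rw [← sum_scale (fun m => qc m * qc (m ^ 2 - g)) hg]
  refine Finset.sum_congr rfl fun m _ => ?_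
  have : (g * m) ^ 2 - g = g * (g * m ^ 2 - 1) := by ring
  rw [this, qc_mul, qc_mul, qc_comm h1]
  linear_combination - qc m * qc (g * m ^ 2 - 1) * qc_sq' hg

lemma sum_qcjsum (hF : ringChar F ≠ 2) (h1 : qc (-1 : F) = 1) {g : F} (hg : qc g = -1) :
    2 * ∑ b : F, qc b * (qc (1 - b) * jsum b) = jsum (1 : F) ^ 2 - jsum g ^ 2 := by
  have hg0 : g ≠ 0 := by rintro rfl; simp at hg
  have e1 := sum_sq hF (fun b : F => qc (1 - b) * jsum b)
  have e2 := sum_nonsq hF hg (fun b : F => qc (1 - b) * jsum b)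
  have f1 : ∑ c : F, qc (1 - c ^ 2) * jsum (c ^ 2) = jsum (1 : F) ^ 2 := by
    rw [pow_two]; nth_rw 2 [← jsum_alt h1 one_ne_zero]
    rw [Finset.mul_sum]
    refine Finset.sum_congr rfl fun m _ => ?_
    have := jsum_twist hF 1 m
    rw [one_mul] at this ⊢
    rw [this]; ring
  have f2 : ∑ c : F, qc (1 - g * c ^ 2) * jsum (g * c ^ 2) = jsum g ^ 2 := by
    rw [pow_two]; nth_rw 2 [← jsum_alt h1 hg0]
    rw [Finset.mul_sum]
    refine Finset.sum_congr rfl fun m _ => ?_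
    rw [jsum_twist hF g m]; ring
  rw [← f1, ← f2, e1, e2, ← Finset.sum_sub_distrib, Finset.mul_sum]
  refine Finset.sum_congr rfl fun m _ => ?_
  ring

lemma jsum_sq_total (hF : ringChar F ≠ 2) (h1 : qc (-1 : F) = 1) :
    ∑ a : F, jsum a ^ 2 = 2 * Fintype.card F * (Fintype.card F - 1) := by
  have h2 : (2 : F) ≠ 0 := Ring.two_ne_zero hF
  have e : ∀ a : F, jsum a ^ 2 = ∑ m : F, ∑ n : F, qc m * qc n * (qc (a - m ^ 2) * qc (a - n ^ 2)) := by
    intro a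
    rw [jsum, pow_two, Finset.sum_mul_sum]
    refine Finset.sum_congr rfl fun m _ => Finset.sum_congr rfl fun n _ => ?_
    rw [qc_comm h1 (m ^ 2), qc_comm h1 (n ^ 2)]; ring
  simp_rw [e]
  rw [Finset.sum_comm]
  have e2 : ∀ m : F, ∑ a : F, ∑ n : F, qc m * qc n * (qc (a - m ^ 2) * qc (a - n ^ 2)) =
      Fintype.card F * (2 * if m = 0 then 0 else 1) := by
    intro m
    rw [Finset.sum_comm]
    simp_rw [← Finset.mul_sum, sum_qc_quad hF, mul_sub, mul_one, Finset.sum_sub_distrib,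
      ← Finset.mul_sum, qc_sum hF]
    rw [mul_zero, sub_zero]
    by_cases hm : m = 0
    · simp [hm]
    have hmm : m ≠ -m := by
      intro h
      have : 2 * m = 0 := by linear_combination h
      simp [h2, hm] at this
    have : ∀ n : F, (qc m * qc n * if m ^ 2 = n ^ 2 then (Fintype.card F : ℤ) else 0) =
        (if n = m then (Fintype.card F : ℤ) else 0) + if n = -m then (Fintype.card F : ℤ) else 0 := by
      intro n
      by_cases a1 : n = m
      · subst a1
        simp [qc_sq' hm, hmm]
      by_cases a2 : n = -m
      · subst a2
        simp [qc_sq' hm, hmm.symm, qc_neg h1]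
      have : ¬ m ^ 2 = n ^ 2 := by
        intro h
        rcases sq_eq_sq_iff_eq_or_eq_neg.mp h.symm with h | h
        · exact a1 h
        · exact a2 h
      simp [a1, a2, this]
    simp_rw [this, Finset.sum_add_distrib]
    simp [hm]; ring
  simp_rw [e2]
  rw [← Finset.mul_sum, ← Finset.mul_sum]
  have := sum_ite_ne (F := F) (fun _ => 1) 0
  simp only [mul_one] at this
  rw [this]; simp; ring

lemma jsum_sq_add (hF : ringChar F ≠ 2) (h1 : qc (-1 : F) = 1) {g : F} (hg : qc g = -1) :
    jsum (1 : F) ^ 2 + jsum g ^ 2 = 4 * Fintype.card F := by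
  have e1 := sum_sq hF (fun b : F => jsum b ^ 2)
  have e2 := sum_nonsq hF hg (fun b : F => jsum b ^ 2)
  have f : ∀ g : F, ∑ c : F, jsum (g * c ^ 2) ^ 2 = (Fintype.card F - 1) * jsum g ^ 2 := by
    intro g
    simp_rw [jsum_twist hF, mul_pow, pow_two (qc _), qc_sq]
    have := sum_ite_ne (F := F) (fun _ => jsum g ^ 2) 0
    rw [this]; simp; ring
  have f1 := f 1
  have f2 := f g
  simp only [one_mul] at f1
  rw [e1] at f1
  rw [e2] at f2
  have := jsum_sq_total hF h1
  have h3 : 2 * ∑ a : F, jsum a ^ 2 = (Fintype.card F - 1) * (jsum (1 : F) ^ 2 + jsum g ^ 2) := by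
    rw [mul_add, ← f1, ← f2, ← Finset.sum_add_distrib, Finset.mul_sum]
    refine Finset.sum_congr rfl fun m _ => ?_
    ring
  rw [this] at h3
  have hc : (1 : ℤ) < Fintype.card F := by exact_mod_cast Fintype.one_lt_card
  have : ((Fintype.card F : ℤ) - 1) ≠ 0 := by linarith
  apply mul_left_cancel₀ this
  linear_combination -h3


/-- the double sum D -/
def dsum (F : Type*) [Field F] [Fintype F] [DecidableEq F] : ℤ :=
  ∑ t : F, ∑ s : F, qc t * qc (t - 1) * (qc s * qc (s - 1) * qc (s - t))

lemma dsum_step1 (hF : ringChar F ≠ 2) :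
    dsum F = ∑ t : F, qc t * ∑ z : F, qc (t - 1) * qc (z ^ 2 - 4 * t) * qc (z - (1 + t)) := by
  unfold dsum
  refine Finset.sum_congr rfl fun t _ => ?_
  by_cases ht : t = 0
  · simp [ht]
  simp_rw [mul_assoc]
  rw [← Finset.mul_sum, ← Finset.mul_sum, ← Finset.mul_sum]
  congr 2
  have e : ∀ s : F, qc s * (qc (s - 1) * qc (s - t)) =
      (if s = 0 then 0 else 1) * qc ((s + t * s⁻¹) - (1 + t)) := by
    intro s
    by_cases hs : s = 0
    · simp [hs]
    · have : (s + t * s⁻¹) - (1 + t) = s⁻¹ * ((s - 1) * (s - t)) := by field_simp; ring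
      rw [this, qc_mul, qc_mul, qc_inv]; simp [hs]
  simp_rw [e]
  rw [sum_add_inv hF ht (fun z => qc (z - (1 + t)))]
  simp_rw [add_mul, one_mul, Finset.sum_add_distrib]
  rw [sum_qc_lin' hF, zero_add]

lemma dsum_two (hF : ringChar F ≠ 2) (h1 : qc (-1 : F) = 1) :
    ∑ t : F, ∑ z : F, qc (t - 1) * qc (z ^ 2 - 4 * t) * qc (z - (1 + t)) = 1 := by
  have h2 : (2 : F) ≠ 0 := Ring.two_ne_zero hF
  have h4 : (4 : F) ≠ 0 := by
    rw [show (4 : F) = 2 * 2 by norm_num]; simp [h2]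
  rw [← sum_reflect _ 1]
  have e : ∀ e : F, ∑ z : F, qc (1 - e - 1) * qc (z ^ 2 - 4 * (1 - e)) * qc (z - (1 + (1 - e))) =
      ∑ h : F, qc h * ((if e⁻¹ = 0 then 0 else 1) * qc ((1 + h) ^ 2 - 4 * h * e⁻¹)) := by
    intro e
    by_cases he : e = 0
    · simp [he]
    rw [← sum_reflect _ (2 - e), ← sum_scale _ he]
    refine Finset.sum_congr rfl fun h _ => ?_
    have a1 : 1 - e - 1 = - e := by ring
    have a2 : (2 - e - e * h) ^ 2 - 4 * (1 - e) = e * e * ((1 + h) ^ 2 - 4 * h * e⁻¹) := by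
      field_simp; ring
    have a3 : 2 - e - e * h - (1 + (1 - e)) = - (e * h) := by ring
    rw [a1, a2, a3, qc_neg h1, qc_neg h1, qc_mul, qc_mul, qc_mul, qc_sq' he]
    simp only [inv_eq_zero, he, if_false]
    linear_combination qc h * qc ((1 + h) ^ 2 - 4 * h * e⁻¹) * qc_sq' he
  simp_rw [e]
  rw [Finset.sum_comm]
  have e3 : ∀ h : F, ∑ e : F, qc h * ((if e⁻¹ = 0 then 0 else 1) * qc ((1 + h) ^ 2 - 4 * h * e⁻¹))
      = - ((if h = -1 then 0 else 1) * qc h) := by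
    intro h
    by_cases hh : h = 0
    · simp [hh]
    rw [← Finset.mul_sum,
      sum_inv (fun u => (if u = 0 then 0 else 1) * qc ((1 + h) ^ 2 - 4 * h * u)), sum_ite_ne,
      sum_qc_lin hF (mul_ne_zero h4 hh), mul_zero, sub_zero, pow_two, qc_mul, qc_sq]
    have : (1 + h = 0) ↔ h = -1 := by
      constructor
      · intro h; linear_combination h
      · intro h; linear_combination h
    simp only [this]; ring
  simp_rw [e3]
  rw [Finset.sum_neg_distrib, sum_ite_ne, qc_sum hF, h1]; norm_num

lemma dsum_one (hF : ringChar F ≠ 2) (h1 : qc (-1 : F) = 1) :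
    ∑ v : F, ∑ z : F, qc (v ^ 2 - 1) * qc (z ^ 2 - 4 * v ^ 2) * qc (z - (1 + v ^ 2)) =
      ∑ b : F, qc b * (qc (1 - b) * jsum b) + 1 := by
  have h2 : (2 : F) ≠ 0 := Ring.two_ne_zero hF
  have q22 := qc_sq' h2
  rw [← sum_reflect _ 1, ← sum_scale _ h2]
  have e : ∀ n : F, ∑ z : F, qc ((1 - 2 * n) ^ 2 - 1) * qc (z ^ 2 - 4 * (1 - 2 * n) ^ 2) *
        qc (z - (1 + (1 - 2 * n) ^ 2)) =
      ∑ b : F, (if n⁻¹ = 0 then 0 else 1) * (qc b * qc (1 - b) *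
        (qc (n⁻¹ - 1) * qc ((n⁻¹ - 1) ^ 2 - b))) := by
    intro n
    by_cases hn : n = 0
    · simp [hn]
    have hn2 : (2 * n) * (2 * n) ≠ 0 := by simp [h2, hn]
    have q1 := qc_sq' hn
    rw [← qc_sum_translate _ (- (2 * (1 - 2 * n))), ← sum_scale _ hn2, ← sum_reflect _ 1]
    refine Finset.sum_congr rfl fun b _ => ?_
    have a1 : (1 - 2 * n) ^ 2 - 1 = - (2 * 2 * (n * n) * (n⁻¹ - 1)) := by
      field_simp; ring
    have a2 : (2 * n * (2 * n) * (1 - b) - -(2 * (1 - 2 * n))) ^ 2 - 4 * (1 - 2 * n) ^ 2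
        = 2 * 2 * (n * n) * (1 - b) * (2 * 2 * (n * n) * ((n⁻¹ - 1) ^ 2 - b)) := by
      field_simp; ring
    have a3 : 2 * n * (2 * n) * (1 - b) - -(2 * (1 - 2 * n)) - (1 + (1 - 2 * n) ^ 2) =
        - (2 * 2 * (n * n) * b) := by ring
    rw [a1, a2, a3, qc_neg h1, qc_neg h1]
    simp only [qc_mul, q22, q1, inv_eq_zero, hn, if_false]
    ring
  simp_rw [e]
  rw [sum_inv (fun k => ∑ b : F, (if k = 0 then 0 else 1) * (qc b * qc (1 - b) *
        (qc (k - 1) * qc ((k - 1) ^ 2 - b))))]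
  simp_rw [← Finset.mul_sum]
  rw [sum_ite_ne, qc_sum_translate (fun m => ∑ b : F, qc b * qc (1 - b) *
        (qc m * qc (m ^ 2 - b))) 1]
  rw [Finset.sum_comm]
  have e4 : ∑ b : F, qc b * qc (1 - b) * (qc (0 - 1 : F) * qc ((0 - 1) ^ 2 - b)) = -1 := by
    have := sum_ite_ne (fun b : F => qc b) 1
    rw [qc_sum hF, qc_one] at this
    rw [zero_sub] at this
    rw [← this]
    refine Finset.sum_congr rfl fun b _ => ?_
    have q := qc_sq (1 - b)
    have : 1 - b = 0 ↔ b = 1 := by rw [sub_eq_zero, eq_comm]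
    simp only [this] at q
    rw [← q]
    rw [zero_sub, h1, neg_one_sq]; ring
  rw [e4, sub_neg_eq_add]
  congr 1
  refine Finset.sum_congr rfl fun b _ => ?_
  rw [← Finset.mul_sum, jsum]; ring

lemma dsum_eq (hF : ringChar F ≠ 2) (h1 : qc (-1 : F) = 1) {g : F} (hg : qc g = -1) :
    dsum F = jsum (1 : F) ^ 2 - 2 * Fintype.card F := by
  have e1 := sum_sq hF (fun t : F => ∑ z : F, qc (t - 1) * qc (z ^ 2 - 4 * t) * qc (z - (1 + t)))
  simp only [add_mul, one_mul, Finset.sum_add_distrib] at e1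
  rw [dsum_one hF h1, dsum_two hF h1, ← dsum_step1 hF] at e1
  have e2 := sum_qcjsum hF h1 hg
  have e3 := jsum_sq_add hF h1 hg
  linarith


/-- indicator of nonzero squares -/
def ind (t : F) : ℤ := if qc t = 1 then 1 else 0

lemma qc_cases (t : F) (ht : t ≠ 0) : qc t = 1 ∨ qc t = -1 := by
  have := qc_sq' ht
  have h : (qc t - 1) * (qc t + 1) = 0 := by linear_combination this
  rcases mul_eq_zero.mp h with h | h
  · left; linarith
  · right; linarith

lemma two_ind (t : F) : 2 * ind t = qc t + qc t * qc t := by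
  by_cases ht : t = 0
  · simp [ht, ind]
  · rcases qc_cases t ht with h | h <;> simp [ind, h]

lemma ind_sq (t : F) : ind t * ind t = ind t := by
  unfold ind; split_ifs <;> simp

/-- inner sum -/
def csum (s : F) : ℤ := ∑ t : F, qc t * qc (t - 1) * qc (t - s)

/-- common neighbours of 0 and 1 -/
def gind (s : F) : ℤ := ind s * ind (s - 1)

/-- auxiliary -/
def fq (s : F) : ℤ := (1 + qc s) * (1 + qc (s - 1))

lemma four_gind (h1 : qc (-1 : F) = 1) (s : F) :
    4 * gind s = fq s - 2 * (if s = 0 then 1 else 0) - 2 * (if s = 1 then 1 else 0) := by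
  have : 4 * gind s = (2 * ind s) * (2 * ind (s - 1)) := by unfold gind; ring
  rw [this, two_ind, two_ind, fq, qc_sq, qc_sq]
  by_cases h0 : s = 0
  · subst h0
    simp [h1]
  by_cases h1 : s = 1
  · subst h1
    simp
  simp [h0, h1, sub_eq_zero]
  ring

lemma sum_four_gind (h1 : qc (-1 : F) = 1) (H : F → ℤ) :
    4 * ∑ s, gind s * H s = ∑ s, fq s * H s - 2 * H 0 - 2 * H 1 := by
  rw [Finset.mul_sum]
  simp_rw [← mul_assoc, four_gind h1, sub_mul, Finset.sum_sub_distrib]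
  simp

lemma sum_fq_mul (H : F → ℤ) : ∑ s, fq s * H s = ∑ s, H s + ∑ s, qc s * H s
    + ∑ s, qc (s - 1) * H s + ∑ s, qc s * qc (s - 1) * H s := by
  simp_rw [← Finset.sum_add_distrib]
  refine Finset.sum_congr rfl fun b _ => ?_
  unfold fq; ring

lemma sum_gind (hF : ringChar F ≠ 2) (h1 : qc (-1 : F) = 1) :
    4 * ∑ s : F, gind s = Fintype.card F - 5 := by
  have := sum_four_gind h1 (fun _ : F => 1)
  rw [sum_fq_mul] at this
  simp only [mul_one, qc_sum hF, sum_qc_lin' hF, sum_qc_quad0 hF] at this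
  simp at this
  linarith

lemma csum_mul (hF : ringChar F ≠ 2) (h1 : qc (-1 : F) = 1) (a : F) (ha : qc a * qc (a - 1) = 0) :
    ∑ s : F, qc (s - a) * csum s = 1 := by
  have : ∀ s, qc (s - a) * csum s =
      ∑ t : F, qc t * qc (t - 1) * (qc (s - t) * qc (s - a)) := by
    intro s
    rw [csum, Finset.mul_sum]
    refine Finset.sum_congr rfl fun b _ => ?_
    rw [qc_comm h1 b s]; ring
  simp_rw [this]
  rw [Finset.sum_comm]
  simp_rw [← Finset.mul_sum, sum_qc_quad hF, mul_sub, Finset.sum_sub_distrib, mul_one,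
    sum_qc_quad0 hF]
  simp [ha]

lemma csum_sum (hF : ringChar F ≠ 2) (h1 : qc (-1 : F) = 1) : ∑ s : F, csum s = 0 := by
  unfold csum
  rw [Finset.sum_comm]
  simp_rw [← Finset.mul_sum]
  have : ∀ t : F, ∑ s : F, qc (t - s) = 0 := by
    intro t; simp_rw [qc_comm h1 t]; exact sum_qc_lin' hF t
  simp [this]

lemma csum_zero (hF : ringChar F ≠ 2) (h1 : qc (-1 : F) = 1) : csum (0 : F) = -1 := by
  unfold csum
  have := sum_ite_ne (fun t : F => qc (t - 1)) 0
  rw [sum_qc_lin' hF, zero_sub, zero_sub, h1] at this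
  rw [← this]
  refine Finset.sum_congr rfl fun b _ => ?_
  rw [← qc_sq, sub_zero]; ring

lemma csum_one (hF : ringChar F ≠ 2) : csum (1 : F) = -1 := by
  unfold csum
  have := sum_ite_ne (fun t : F => qc t) 1
  rw [qc_sum hF, zero_sub, qc_one] at this
  rw [← this]
  refine Finset.sum_congr rfl fun b _ => ?_
  have := qc_sq (b - 1)
  simp only [sub_eq_zero] at this
  rw [← this]; ring

/-- edges among common neighbours -/
def nsum (F : Type*) [Field F] [Fintype F] [DecidableEq F] : ℤ :=
  ∑ s : F, ∑ t : F, gind s * gind t * ind (s - t)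

lemma qc_inner_sum (hF : ringChar F ≠ 2) (h1 : qc (-1 : F) = 1) (s : F) :
    gind s * (4 * ∑ t : F, gind t * qc (t - s)) = gind s * (csum s - 6) := by
  by_cases hs : gind s = 0
  · simp [hs]
  have hs1 : qc s = 1 := by
    by_contra h; apply hs; simp [gind, ind, h]
  have hs2 : qc (s - 1) = 1 := by
    by_contra h; apply hs; simp [gind, ind, h]
  have h0 : s ≠ 0 := by rintro rfl; simp at hs1
  have h01 : s ≠ 1 := by rintro rfl; simp at hs2
  congr 1
  rw [sum_four_gind h1 (fun t => qc (t - s)), sum_fq_mul, sum_qc_lin' hF, sum_qc_quad0 hF,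
    sum_qc_quad hF]
  rw [qc_comm h1 0, qc_comm h1 1, sub_zero, hs1, hs2, csum]
  simp [h0, h01.symm]
  ring

lemma nsum_eq (hF : ringChar F ≠ 2) (h1 : qc (-1 : F) = 1) :
    32 * nsum F = (Fintype.card F : ℤ) ^ 2 - 20 * Fintype.card F + 81 + dsum F := by
  have e : 2 * nsum F = ∑ s : F, gind s * ∑ t : F, gind t * qc (t - s) +
      (∑ s : F, gind s) * (∑ t : F, gind t) - ∑ s : F, gind s := by
    unfold nsum
    rw [Finset.sum_mul, Finset.mul_sum, ← Finset.sum_add_distrib, ← Finset.sum_sub_distrib]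
    refine Finset.sum_congr rfl fun s _ => ?_
    have : gind s = ∑ t, if t = s then gind s * gind t else 0 := by
      simp only [Finset.sum_ite_eq', Finset.mem_univ, if_true]
      unfold gind
      linear_combination -ind_sq s * (ind (s - 1) * ind (s - 1)) - ind s * ind_sq (s - 1)
    conv_rhs => rw [sub_eq_add_neg]; arg 2; rw [this]
    rw [← sub_eq_add_neg, Finset.mul_sum, Finset.mul_sum, Finset.mul_sum,
      ← Finset.sum_add_distrib, ← Finset.sum_sub_distrib]
    refine Finset.sum_congr rfl fun t _ => ?_
    have q := two_ind (s - t)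
    rw [qc_sq, qc_comm h1] at q
    simp only [sub_eq_zero, eq_comm (a := s)] at q
    by_cases hst : t = s
    · simp [hst] at q ⊢; right; exact q
    · simp only [hst, if_false] at q ⊢
      linear_combination gind s * gind t * q
  have e2 : 4 * ∑ s : F, gind s * ∑ t : F, gind t * qc (t - s) =
      ∑ s : F, gind s * csum s - 6 * ∑ s : F, gind s := by
    rw [Finset.mul_sum, Finset.mul_sum, ← Finset.sum_sub_distrib]
    refine Finset.sum_congr rfl fun s _ => ?_
    linear_combination qc_inner_sum hF h1 s
  have e3 := sum_four_gind h1 (fun s : F => csum s)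
  have c0 := csum_mul hF h1 0 (by simp)
  simp only [sub_zero] at c0
  have c2 : ∑ s : F, qc s * qc (s - 1) * csum s = dsum F := by
    unfold dsum csum
    simp_rw [Finset.mul_sum]
  rw [sum_fq_mul, csum_sum hF h1, c0, csum_mul hF h1 1 (by simp), csum_zero hF h1, csum_one hF,
    c2] at e3
  have e4 := sum_gind hF h1
  set T := ∑ s : F, gind s
  have : (Fintype.card F : ℤ) = 4 * T + 5 := by linarith
  rw [this]
  linear_combination 16 * e + 4 * e2 + e3


lemma jsum_one_mod (hF : ringChar F ≠ 2) (h1 : qc (-1 : F) = 1) :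
    ∃ k : ℤ, jsum (1 : F) = Fintype.card F - 3 - 4 * k := by
  have h2 : (2 : F) ≠ 0 := Ring.two_ne_zero hF
  have hne : (1 : F) ≠ -1 := by
    intro h
    exact h2 (by linear_combination h)
  let h : F → ℤ := fun m => qc m * qc (m ^ 2 - 1)
  let k : F → ℤ := fun m => if h m = -1 then 1 else 0
  have hh : ∀ m, h m = 1 - (if m = 0 then 1 else 0) - (if m = 1 then 1 else 0)
      - (if m = -1 then 1 else 0) - 2 * k m := by
    intro m
    by_cases m0 : m = 0
    · subst m0; simp [k, h]
    by_cases m1 : m = 1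
    · subst m1; simp [k, h, hne]
    by_cases m2 : m = -1
    · subst m2; simp [k, h, hne.symm]
    have m3 : m ^ 2 - 1 ≠ 0 := by
      intro e
      have : (m - 1) * (m + 1) = 0 := by linear_combination e
      rcases mul_eq_zero.mp this with e | e
      · exact m1 (by linear_combination e)
      · exact m2 (by linear_combination e)
    rcases qc_cases m m0 with a | a <;> rcases qc_cases _ m3 with b | b <;>
      simp [k, h, a, b, m0, m1, m2]
  have hk : ((∑ m, k m : ℤ) : ZMod 2) = 0 := by
    push_cast
    refine Finset.sum_ninvolution (fun m => -m) ?_ ?_ (by simp) (by simp)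
    · intro m
      have : k (-m) = k m := by simp [k, h, qc_neg h1]
      rw [this]
      exact CharTwo.add_self_eq_zero _
    · intro m hm e
      have : 2 * m = 0 := by linear_combination -e
      have : m = 0 := by simpa [h2] using this
      apply hm
      simp [this, k, h]
  rw [ZMod.intCast_zmod_eq_zero_iff_dvd] at hk
  obtain ⟨l, hl⟩ := hk
  refine ⟨l, ?_⟩
  have : jsum (1 : F) = ∑ m, h m := rfl
  rw [this]
  simp_rw [hh, Finset.sum_sub_distrib, ← Finset.mul_sum]
  rw [hl]
  simp
  ring

lemma sum_pow_all (i : ℕ) (hi : i ≠ 0) :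
    ∑ x : F, x ^ i = if Fintype.card F - 1 ∣ i then -1 else 0 := by
  rw [← FiniteField.sum_pow_units]
  let φ : Fˣ ↪ F := ⟨fun x ↦ x, Units.val_injective⟩
  have : Finset.univ.map φ = Finset.univ \ {0} := by
    ext x
    simpa only [Finset.mem_map, Finset.mem_univ, Function.Embedding.coeFn_mk, true_and,
      Finset.mem_sdiff, Finset.mem_singleton, φ] using! isUnit_iff_ne_zero
  calc
    ∑ x : F, x ^ i = ∑ x ∈ Finset.univ \ {(0 : F)}, x ^ i := by
      rw [← Finset.sum_sdiff ({0} : Finset F).subset_univ, Finset.sum_singleton, zero_pow hi,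
        add_zero]
    _ = ∑ x : Fˣ, (x ^ i : F) := by simp [φ, ← this, Finset.univ.sum_map φ]

lemma jsum_cast (hF : ringChar F ≠ 2) (n : ℕ) (hn : Fintype.card F = 4 * n + 1) :
    ((jsum (1 : F) : ℤ) : F) = - ((-1) ^ n * (Nat.choose (2 * n) n : F)) := by
  have hn0 : n ≠ 0 := by
    rintro rfl
    have := Fintype.one_lt_card (α := F)
    omega
  have hd : Fintype.card F / 2 = 2 * n := by omega
  have hq : ∀ a : F, ((qc a : ℤ) : F) = a ^ (2 * n) := by
    intro a
    rw [← hd]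
    exact quadraticChar_eq_pow_of_char_ne_two' hF a
  unfold jsum
  push_cast
  simp_rw [hq, sub_eq_add_neg, add_pow, Finset.mul_sum]
  rw [Finset.sum_comm]
  have : ∀ j ∈ Finset.range (2 * n + 1), ∑ m : F,
      m ^ (2 * n) * ((m ^ 2) ^ j * (-1) ^ (2 * n - j) * (Nat.choose (2 * n) j : F)) =
      if j = n then - ((-1) ^ n * (Nat.choose (2 * n) n : F)) else 0 := by
    intro j hj
    have hj' := Finset.mem_range.mp hj
    have e : ∀ m : F, m ^ (2 * n) * ((m ^ 2) ^ j * (-1) ^ (2 * n - j) * (Nat.choose (2 * n) j : F))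
        = ((-1) ^ (2 * n - j) * (Nat.choose (2 * n) j : F)) * m ^ (2 * n + 2 * j) := by
      intro m; rw [pow_add, pow_mul m 2 j]; ring
    simp_rw [e]
    rw [← Finset.mul_sum, sum_pow_all _ (by omega), hn, Nat.add_sub_cancel]
    by_cases hjn : j = n
    · subst hjn
      have : 4 * j ∣ 2 * j + 2 * j := ⟨1, by ring⟩
      rw [if_pos this, if_pos rfl, show 2 * j - j = j by omega]; ring
    · have : ¬ 4 * n ∣ 2 * n + 2 * j := by
        rintro ⟨c, hc⟩
        have c1 : 0 < c := by
          rcases Nat.eq_zero_or_pos c with h | h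
          · subst h; omega
          · exact h
        have c2 : c < 2 := by
          by_contra hcc
          have : 4 * n * 2 ≤ 4 * n * c := Nat.mul_le_mul_left _ (by omega)
          omega
        have : c = 1 := by omega
        subst this; omega
      rw [if_neg this, if_neg hjn, mul_zero]
  rw [Finset.sum_congr rfl this]
  simp
  intro h; omega

end QCsums

lemma not_dvd_central (p : ℕ) (hp : p.Prime) (hp4 : p % 4 = 1) (r : ℕ) :
    ∀ n : ℕ, p ^ r = 4 * n + 1 → ¬ p ∣ Nat.choose (2 * n) n := by
  have := Fact.mk hp
  have h2 := hp.two_le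
  induction r with
  | zero =>
    intro n hn
    have : n = 0 := by simpa using hn.symm
    subst this
    simp; omega
  | succ r ih =>
    intro n hn
    obtain ⟨c, hc⟩ : ∃ c, p = 4 * c + 1 := ⟨p / 4, by omega⟩
    obtain ⟨n', hn'⟩ : ∃ n', p ^ r = 4 * n' + 1 := by
      refine ⟨p ^ r / 4, ?_⟩
      have : p ^ r % 4 = 1 := by simp [Nat.pow_mod, hp4]
      omega
    have hnn : n = c + p * n' := by
      rw [pow_succ, hn'] at hn
      have : (4 * n' + 1) * p = 4 * (p * n') + p := by ring
      omega
    have h2n : 2 * n = 2 * c + p * (2 * n') := by rw [hnn]; ring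
    have key := Choose.choose_modEq_choose_mod_mul_choose_div_nat (n := 2 * n) (k := n) (p := p)
    have e1 : 2 * n % p = 2 * c := by
      rw [h2n, Nat.add_mul_mod_self_left, Nat.mod_eq_of_lt (by omega)]
    have e2 : n % p = c := by
      rw [hnn, Nat.add_mul_mod_self_left, Nat.mod_eq_of_lt (by omega)]
    have e3 : 2 * n / p = 2 * n' := by
      rw [h2n, Nat.add_mul_div_left _ _ (by omega), Nat.div_eq_of_lt (by omega), zero_add]
    have e4 : n / p = n' := by
      rw [hnn, Nat.add_mul_div_left _ _ (by omega), Nat.div_eq_of_lt (by omega), zero_add]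
    rw [e1, e2, e3, e4] at key
    intro hd
    have := (key.dvd_iff (dvd_refl p)).mp hd
    rcases (hp.dvd_mul).mp this with h | h
    · have h3 := Nat.choose_mul_factorial_mul_factorial (n := 2 * c) (k := c) (by omega)
      have : p ∣ Nat.factorial (2 * c) := by
        rw [← h3, mul_assoc]; exact dvd_mul_of_dvd_left h _
      rw [hp.dvd_factorial] at this
      omega
    · exact ih n' hn' h

lemma rep_three (p : ℕ) (hp : p.Prime) (hp4 : p % 4 = 3) (r : ℕ) :
    ∀ a b : ℤ, (p : ℤ) ^ r = a ^ 2 + b ^ 2 → a = 0 ∨ b = 0 := by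
  have := Fact.mk hp
  induction r using Nat.strong_induction_on with
  | _ r ih =>
    intro a b hab
    by_cases hr : r = 0
    · subst hr
      by_contra h
      push Not at h
      have ha := sq_pos_of_ne_zero h.1
      have hb := sq_pos_of_ne_zero h.2
      rw [pow_zero] at hab
      omega
    have hz : ((a : ZMod p)) ^ 2 + (b : ZMod p) ^ 2 = 0 := by
      have := congrArg (Int.cast : ℤ → ZMod p) hab
      push_cast at this
      rw [← this]; simp [hr]
    have hb0 : (b : ZMod p) = 0 := by
      by_contra hb
      exact ZMod.mod_four_ne_three_of_sq_eq_neg_sq' (x := (a : ZMod p)) hb (by linear_combination hz) hp4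
    have ha0 : (a : ZMod p) = 0 := by
      rw [hb0] at hz; simpa using hz
    rw [ZMod.intCast_zmod_eq_zero_iff_dvd] at ha0 hb0
    obtain ⟨a', rfl⟩ := ha0
    obtain ⟨b', rfl⟩ := hb0
    have hp0 : (p : ℤ) ≠ 0 := by exact_mod_cast hp.ne_zero
    obtain ⟨r', rfl⟩ : ∃ r', r = r' + 1 := ⟨r - 1, by omega⟩
    have h1 : (p : ℤ) ^ r' = p * (a' ^ 2 + b' ^ 2) := by
      apply mul_left_cancel₀ hp0
      rw [pow_succ] at hab
      linear_combination hab
    rcases r' with _ | r'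
    · exfalso
      rw [pow_zero] at h1
      have : (p : ℤ) ∣ 1 := ⟨_, h1⟩
      have : p ∣ 1 := by exact_mod_cast this
      exact hp.one_lt.ne' (Nat.dvd_one.mp this)
    · have h2 : (p : ℤ) ^ r' = a' ^ 2 + b' ^ 2 := by
        apply mul_left_cancel₀ hp0
        rw [pow_succ] at h1
        linear_combination h1
      rcases ih r' (by omega) a' b' h2 with h | h <;> simp [h]

lemma rep_one (p : ℕ) (hp : p.Prime) (hp2 : p ≠ 2) (r : ℕ) (x y X Y : ℤ)
    (h : (p : ℤ) ^ r = x ^ 2 + 4 * y ^ 2) (H : (p : ℤ) ^ r = X ^ 2 + 4 * Y ^ 2)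
    (hx : ¬ (p : ℤ) ∣ x) (hX : ¬ (p : ℤ) ∣ X) : x ^ 2 = X ^ 2 := by
  have hpi : Prime (p : ℤ) := Nat.prime_iff_prime_int.mp hp
  have hq0 : (0 : ℤ) < (p : ℤ) ^ r := pow_pos (by exact_mod_cast hp.pos) r
  by_cases hr : r = 0
  · subst hr
    rw [pow_zero] at h H
    have h3 : y ^ 2 = 0 := by have := sq_nonneg x; have := sq_nonneg y; omega
    have h4 : Y ^ 2 = 0 := by have := sq_nonneg X; have := sq_nonneg Y; omega
    linarith
  have hpq : (p : ℤ) ∣ (p : ℤ) ^ r := dvd_pow_self _ hr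
  have hp4 : ¬ (p : ℤ) ∣ 2 := by
    intro hd
    have : p ∣ 2 := by exact_mod_cast hd
    exact hp2 ((Nat.prime_dvd_prime_iff_eq hp Nat.prime_two).mp this)
  have key : 4 * ((x * Y - y * X) * (x * Y + y * X)) = (p : ℤ) ^ r * (x ^ 2 - X ^ 2) := by
    linear_combination X ^ 2 * h - x ^ 2 * H
  have small : ∀ u v : ℤ, (p : ℤ) ^ r * (p : ℤ) ^ r = u ^ 2 + 4 * v ^ 2 → (p : ℤ) ^ r ∣ v → v = 0 := by
    intro u v huv ⟨w, hw⟩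
    by_contra hv
    have hw0 : w ≠ 0 := by rintro rfl; simp at hw; exact hv hw
    have : 0 < w ^ 2 := sq_pos_of_ne_zero hw0
    rw [hw] at huv
    nlinarith [sq_nonneg u, mul_pos hq0 hq0]
  have hprod : (x * Y - y * X) * (x * Y + y * X) = 0 := by
    have hd : (p : ℤ) ^ r ∣ (x * Y - y * X) * (x * Y + y * X) := by
      have hc : IsCoprime ((p : ℤ) ^ r) 4 := by
        apply IsCoprime.pow_left
        rw [show (4 : ℤ) = 2 ^ 2 by norm_num]
        apply IsCoprime.pow_right
        exact (hpi.coprime_iff_not_dvd).mpr hp4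
      exact hc.dvd_of_dvd_mul_left ⟨_, key⟩
    by_cases h1 : (p : ℤ) ∣ x * Y - y * X
    · have h2 : ¬ (p : ℤ) ∣ x * Y + y * X := by
        intro h2
        have h3 : (p : ℤ) ∣ 2 * (x * Y) := by
          have := dvd_add h1 h2
          rwa [show x * Y - y * X + (x * Y + y * X) = 2 * (x * Y) by ring] at this
        have h4 : (p : ℤ) ∣ Y := by
          rcases hpi.dvd_or_dvd h3 with h | h
          · exact absurd h hp4
          · rcases hpi.dvd_or_dvd h with h | h
            · exact absurd h hx
            · exact h
        apply hX
        apply hpi.dvd_of_dvd_pow (n := 2)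
        have : X ^ 2 = (p : ℤ) ^ r - Y * (4 * Y) := by linear_combination -H
        rw [this]
        exact dvd_sub hpq (dvd_mul_of_dvd_left h4 _)
      have hc : IsCoprime ((p : ℤ) ^ r) (x * Y + y * X) :=
        IsCoprime.pow_left ((hpi.coprime_iff_not_dvd).mpr h2)
      have := hc.dvd_of_dvd_mul_right hd
      rw [small (x * X + 4 * y * Y) _ (by nth_rw 1 [h]; rw [H]; ring) this, zero_mul]
    · have hc : IsCoprime ((p : ℤ) ^ r) (x * Y - y * X) :=
        IsCoprime.pow_left ((hpi.coprime_iff_not_dvd).mpr h1)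
      have := hc.dvd_of_dvd_mul_left hd
      rw [small (x * X - 4 * y * Y) _ (by nth_rw 1 [h]; rw [H]; ring) this, mul_zero]
  rw [hprod, mul_zero] at key
  have := (mul_eq_zero.mp key.symm).resolve_left hq0.ne'
  linarith

lemma jsum_eq {F : Type*} [Field F] [Fintype F] [DecidableEq F] (hF : ringChar F ≠ 2)
    (h1 : qc (-1 : F) = 1) (q p r : ℕ) (x y : ℤ) (hp : p.Prime) (hqpr : q = p ^ r)
    (hq : Fintype.card F = q)
    (hq4 : q % 4 = 1)
    (hxy : (q : ℤ) = x ^ 2 + 4 * y ^ 2)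
    (hpx : p % 4 = 1 → ¬ (p : ℤ) ∣ x) : jsum (1 : F) ^ 2 = 4 * x ^ 2 := by
  have hr : r ≠ 0 := by
    rintro rfl
    have := Fintype.one_lt_card (α := F)
    simp at hqpr; omega
  have hp2 : p ≠ 2 := by
    rintro rfl
    have : 2 ∣ q := hqpr ▸ dvd_pow_self 2 hr
    omega
  obtain ⟨g, hg⟩ := quadraticChar_exists_neg_one (F := F) hF
  have hs := jsum_sq_add hF h1 (g := g) hg
  obtain ⟨k, hk⟩ := jsum_one_mod hF h1
  obtain ⟨n, hn⟩ : ∃ n, q = 4 * n + 1 := ⟨q / 4, by omega⟩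
  set X : ℤ := 2 * n - 1 - 2 * k with hX
  have hjX : jsum (1 : F) = 2 * X := by rw [hk, hq, hn, hX]; push_cast; ring
  obtain ⟨Y, hY⟩ : ∃ Y, jsum g = 4 * Y := by
    have e : jsum g ^ 2 = 4 ^ 2 * (n - (n - k) * (n - k - 1)) := by
      rw [hjX, hq, hn, hX] at hs
      push_cast at hs
      linear_combination hs
    have : (4 : ℤ) ^ 2 ∣ jsum g ^ 2 := ⟨_, e⟩
    rw [Int.pow_dvd_pow_iff (by norm_num)] at this
    exact this
  have hXY : (q : ℤ) = X ^ 2 + 4 * Y ^ 2 := by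
    rw [hjX, hY, hq] at hs
    linarith
  rw [hjX]
  have hpq : ((q : ℕ) : ℤ) = (p : ℤ) ^ r := by rw [hqpr]; push_cast; rfl
  suffices x ^ 2 = X ^ 2 by rw [this]; ring
  have hodd : p % 4 = 1 ∨ p % 4 = 3 := by
    have := hp.eq_two_or_odd
    omega
  rcases hodd with h4 | h4
  · refine rep_one p hp hp2 r x y X Y (hpq ▸ hxy) (hpq ▸ hXY) (hpx h4) ?_
    intro hd
    have hpF : CharP F p := by
      have := Fact.mk hp
      exact charP_of_card_eq_prime_pow (f := r) (by rw [hq, hqpr])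
    have h5 := jsum_cast hF n (hq.trans hn)
    have h6 : ((jsum (1 : F) : ℤ) : F) = 0 := by
      rw [CharP.intCast_eq_zero_iff F p, hjX]
      exact dvd_mul_of_dvd_right hd _
    rw [h6] at h5
    have h7 : ((Nat.choose (2 * n) n : ℕ) : F) = 0 := by
      have := h5.symm
      simpa using this
    rw [CharP.cast_eq_zero_iff F p] at h7
    exact not_dvd_central p hp h4 r n (by rw [← hqpr, hn]) h7
  · have a1 := rep_three p hp h4 r x (2 * y) (by rw [← hpq, hxy]; ring)
    have a2 := rep_three p hp h4 r X (2 * Y) (by rw [← hpq, hXY]; ring)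
    have a3 : ∀ u v : ℤ, (q : ℤ) = u ^ 2 + 4 * v ^ 2 → u ≠ 0 := by
      rintro u v h rfl
      rw [hn] at h
      push_cast at h
      omega
    have b1 := a1.resolve_left (a3 x y hxy)
    have b2 := a2.resolve_left (a3 X Y hXY)
    have c1 : y = 0 := by omega
    have c2 : Y = 0 := by omega
    rw [c1] at hxy
    rw [c2] at hXY
    linarith

lemma nsum_final {F : Type*} [Field F] [Fintype F] [DecidableEq F] (hF : ringChar F ≠ 2)
    (h1 : qc (-1 : F) = 1) (q p r : ℕ) (x y : ℤ) (hp : p.Prime) (hqpr : q = p ^ r)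
    (hq : Fintype.card F = q)
    (hq4 : q % 4 = 1)
    (hxy : (q : ℤ) = x ^ 2 + 4 * y ^ 2)
    (hpx : p % 4 = 1 → ¬ (p : ℤ) ∣ x) : 32 * nsum F = ((q : ℤ) - 9) ^ 2 - 16 * y ^ 2 := by
  obtain ⟨g, hg⟩ := quadraticChar_exists_neg_one (F := F) hF
  rw [nsum_eq hF h1, dsum_eq hF h1 (g := g) hg,
    jsum_eq hF h1 q p r x y hp hqpr hq hq4 hxy hpx, hq]
  linear_combination -4 * hxy


section QCcount
variable {F : Type*} [Field F] [Fintype F] [DecidableEq F]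

lemma ind_comm (h1 : qc (-1 : F) = 1) (s t : F) : ind (s - t) = ind (t - s) := by
  unfold ind; rw [qc_comm h1]

lemma ind_scale {b : F} (hb : qc b = 1) (c : F) : ind (b * c) = ind c := by
  unfold ind; rw [qc_mul, hb, one_mul]

lemma sum_ind (hF : ringChar F ≠ 2) : 2 * ∑ b : F, ind b = Fintype.card F - 1 := by
  rw [Finset.mul_sum]
  simp_rw [two_ind, Finset.sum_add_distrib, qc_sum hF, qc_sq]
  have := sum_ite_ne (F := F) (fun _ => 1) 0
  simpa using this

/-- indicator of an ordered 4-clique -/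
def phi (a b c d : F) : ℤ :=
  ind (b - a) * ind (c - a) * ind (d - a) * ind (c - b) * ind (d - b) * ind (d - c)

lemma sum_phi (hF : ringChar F ≠ 2) (h1 : qc (-1 : F) = 1) :
    2 * ∑ a : F, ∑ b : F, ∑ c : F, ∑ d : F, phi a b c d =
      Fintype.card F * (Fintype.card F - 1) * nsum F := by
  have e1 : ∀ a : F, ∑ b : F, ∑ c : F, ∑ d : F, phi a b c d =
      ∑ b : F, ∑ c : F, ∑ d : F, phi 0 b c d := by
    intro a
    rw [← qc_sum_translate (fun b => ∑ c : F, ∑ d : F, phi 0 b c d) a]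
    refine Finset.sum_congr rfl fun b _ => ?_
    rw [← qc_sum_translate (fun c => ∑ d : F, phi 0 (b - a) c d) a]
    refine Finset.sum_congr rfl fun c _ => ?_
    rw [← qc_sum_translate (fun d => phi 0 (b - a) (c - a) d) a]
    refine Finset.sum_congr rfl fun d _ => ?_
    simp [phi]
  have e2 : ∀ b : F, ∑ c : F, ∑ d : F, phi 0 b c d = ind b * nsum F := by
    intro b
    by_cases hb : qc b = 1
    · have hb0 : b ≠ 0 := by rintro rfl; simp at hb
      rw [← sum_scale _ hb0, nsum, Finset.mul_sum]
      refine Finset.sum_congr rfl fun c _ => ?_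
      rw [← sum_scale _ hb0, Finset.mul_sum]
      refine Finset.sum_congr rfl fun d _ => ?_
      have a1 : b * c - b = b * (c - 1) := by ring
      have a2 : b * d - b = b * (d - 1) := by ring
      have a3 : b * d - b * c = b * (d - c) := by ring
      simp only [phi, sub_zero, a1, a2, a3, ind_scale hb, gind]
      rw [ind_comm h1 d c]; ring
    · have : ind b = 0 := by simp [ind, hb]
      simp [phi, this]
  simp_rw [e1, e2]
  rw [← Finset.sum_mul, Finset.sum_const, nsmul_eq_mul, Finset.card_univ]
  linear_combination (Fintype.card F : ℤ) * nsum F * sum_ind (F := F) hF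

end QCcount

lemma clique_ordered {V : Type*} [Fintype V] [DecidableEq V] (G : SimpleGraph V) :
    Nat.card {f : Fin 4 → V // ∀ i j, i ≠ j → G.Adj (f i) (f j)} = 24 * G.cliqueCount 4 := by
  classical
  have inj : ∀ f : {f : Fin 4 → V // ∀ i j, i ≠ j → G.Adj (f i) (f j)},
      Function.Injective f.1 := by
    intro f i j hij
    by_contra h
    exact (f.2 i j h).ne hij
  have sext : ∀ A B : (Σ s : {s : Finset V // G.IsNClique 4 s}, (Fin 4 ≃ s.1)),
      A.1 = B.1 → (∀ i, (A.2 i : V) = (B.2 i : V)) → A = B := by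
    rintro ⟨s, e⟩ ⟨t, f⟩ h h'
    obtain rfl : s = t := h
    congr 1
    ext i
    exact h' i
  let e : {f : Fin 4 → V // ∀ i j, i ≠ j → G.Adj (f i) (f j)} ≃
      Σ s : {s : Finset V // G.IsNClique 4 s}, (Fin 4 ≃ s.1) :=
    { toFun := fun f => ⟨⟨Finset.univ.image f.1, by
          constructor
          · intro a ha b hb hab
            simp at ha hb
            obtain ⟨i, rfl⟩ := ha
            obtain ⟨j, rfl⟩ := hb
            exact f.2 i j (fun h => hab (by rw [h]))
          · rw [Finset.card_image_of_injective _ (inj f)]; simp⟩,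
          Equiv.ofBijective (fun i => ⟨f.1 i, by simp⟩) (by
            constructor
            · intro i j hij
              exact inj f (by simpa using hij)
            · rintro ⟨a, ha⟩
              simp at ha
              obtain ⟨i, rfl⟩ := ha
              exact ⟨i, rfl⟩)⟩
      invFun := fun s => ⟨fun i => (s.2 i).1, by
        intro i j hij
        refine s.1.2.isClique (s.2 i).2 (s.2 j).2 ?_
        intro h
        exact hij (s.2.injective (Subtype.ext h))⟩
      left_inv := fun f => by ext; rfl
      right_inv := by
        rintro ⟨⟨s, hs⟩, e⟩
        have h : Finset.univ.image (fun i => (e i).1) = s := by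
          ext a
          simp only [Finset.mem_image, Finset.mem_univ, true_and]
          constructor
          · rintro ⟨i, rfl⟩; exact (e i).2
          · intro ha; exact ⟨e.symm ⟨a, ha⟩, by simp⟩
        exact sext _ _ (Subtype.ext h) (fun i => rfl) }
  rw [Nat.card_congr e, Nat.card_sigma]
  have : ∀ s : {s : Finset V // G.IsNClique 4 s}, Nat.card (Fin 4 ≃ s.1) = 24 := by
    intro s
    have hc : Fintype.card (Fin 4) = Fintype.card s.1 := by simp [s.2.card_eq]
    rw [Nat.card_eq_fintype_card, Fintype.card_equiv (Fintype.equivOfCardEq hc)]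
    simp [Nat.factorial]
  simp_rw [this]
  rw [Finset.sum_const, SimpleGraph.cliqueCount, Nat.card_eq_fintype_card, smul_eq_mul, mul_comm,
    Finset.card_univ]

lemma clique_sum {V : Type*} [Fintype V] [DecidableEq V] (G : SimpleGraph V)
    (I : V → V → V → V → ℤ)
    (h1 : ∀ a b c d, G.Adj a b ∧ G.Adj a c ∧ G.Adj a d ∧ G.Adj b c ∧ G.Adj b d ∧ G.Adj c d →
      I a b c d = 1)
    (h0 : ∀ a b c d, ¬ (G.Adj a b ∧ G.Adj a c ∧ G.Adj a d ∧ G.Adj b c ∧ G.Adj b d ∧ G.Adj c d) →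
      I a b c d = 0) :
    24 * (G.cliqueCount 4 : ℤ) = ∑ a, ∑ b, ∑ c, ∑ d, I a b c d := by
  classical
  have h := clique_ordered G
  have h' : (24 : ℤ) * (G.cliqueCount 4 : ℤ) =
      Nat.card {f : Fin 4 → V // ∀ i j, i ≠ j → G.Adj (f i) (f j)} := by rw [h]; push_cast; ring
  rw [h']
  let e : V × V × V × V ≃ (Fin 4 → V) :=
    { toFun := fun x => ![x.1, x.2.1, x.2.2.1, x.2.2.2]
      invFun := fun f => (f 0, f 1, f 2, f 3)
      left_inv := fun x => rfl
      right_inv := fun f => by ext i; fin_cases i <;> rfl }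
  rw [Nat.card_eq_fintype_card, Fintype.card_subtype, Finset.card_filter]
  push_cast
  rw [← e.sum_comp]
  simp_rw [Fintype.sum_prod_type]
  refine Finset.sum_congr rfl fun a _ => Finset.sum_congr rfl fun b _ =>
    Finset.sum_congr rfl fun c _ => Finset.sum_congr rfl fun d _ => ?_
  have key : (∀ i j, i ≠ j → G.Adj (e (a, b, c, d) i) (e (a, b, c, d) j)) ↔
      (G.Adj a b ∧ G.Adj a c ∧ G.Adj a d ∧ G.Adj b c ∧ G.Adj b d ∧ G.Adj c d) := by
    constructor
    · intro H
      exact ⟨H 0 1 (by decide), H 0 2 (by decide), H 0 3 (by decide), H 1 2 (by decide),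
        H 1 3 (by decide), H 2 3 (by decide)⟩
    · rintro ⟨x1, x2, x3, x4, x5, x6⟩ i j hij
      fin_cases i <;> fin_cases j <;>
        first
          | exact absurd rfl hij
          | assumption
          | (refine SimpleGraph.Adj.symm ?_; assumption)
  by_cases H : (G.Adj a b ∧ G.Adj a c ∧ G.Adj a d ∧ G.Adj b c ∧ G.Adj b d ∧ G.Adj c d)
  · rw [if_pos (key.mpr H), h1 _ _ _ _ H]
  · rw [if_neg (fun h => H (key.mp h)), h0 _ _ _ _ H]

open IsLocalRing in
lemma sum_residue (R : Type*) [CommRing R] [IsLocalRing R] [Fintype R] [Fintype (ResidueField R)]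
    [DecidableEq (ResidueField R)] (H : ResidueField R → ℤ) :
    ∑ a : R, H (residue R a) = Nat.card (maximalIdeal R) * ∑ z, H z := by
  classical
  rw [← Finset.sum_fiberwise Finset.univ (fun a : R => residue R a), Finset.mul_sum]
  refine Finset.sum_congr rfl fun z _ => ?_
  rw [Finset.sum_congr rfl (g := fun _ => H z)]
  · rw [Finset.sum_const, nsmul_eq_mul]
    congr 2
    obtain ⟨a0, rfl⟩ := residue_surjective z
    rw [← Fintype.card_subtype, ← Nat.card_eq_fintype_card]
    refine Nat.card_congr ⟨fun a => ⟨a.1 - a0, ?_⟩, fun m => ⟨m.1 + a0, ?_⟩, ?_, ?_⟩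
    · rw [← residue_eq_zero_iff, map_sub, a.2, sub_self]
    · rw [map_add, (residue_eq_zero_iff _).mpr m.2, zero_add]
    · intro a; simp
    · intro a; simp
  · intro c hc; simp at hc; rw [hc]

open IsLocalRing in
lemma isSquare_of_residue_one (R : Type*) [CommRing R] [IsLocalRing R] [Fintype R]
    (hodd : Odd (Nat.card (maximalIdeal R))) (w : Rˣ) (hw : residue R w = 1) :
    ∃ v : Rˣ, w = v ^ 2 := by
  let K : Subgroup Rˣ := (Units.map (residue R : R →* ResidueField R)).ker
  have hK : ∀ u : Rˣ, u ∈ K ↔ residue R u = 1 := by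
    intro u
    rw [MonoidHom.mem_ker, Units.ext_iff]; rfl
  have e : Nat.card K = Nat.card (maximalIdeal R) := by
    refine Nat.card_congr ⟨fun u => ⟨(u.1 : R) - 1, ?_⟩, fun m => ⟨IsUnit.unit (a := 1 + m.1) ?_, ?_⟩, ?_, ?_⟩
    · rw [← residue_eq_zero_iff, map_sub, (hK _).mp u.2, map_one, sub_self]
    · rw [← residue_ne_zero_iff_isUnit, map_add, (residue_eq_zero_iff _).mpr m.2]; simp
    · rw [hK, IsUnit.unit_spec, map_add, (residue_eq_zero_iff _).mpr m.2]; simp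
    · intro u; ext; simp
    · intro m; ext; simp
  rw [← e] at hodd
  obtain ⟨k, hk⟩ := hodd
  have h1 : (⟨w, (hK w).mpr hw⟩ : K) ^ Nat.card K = 1 := pow_card_eq_one'
  have h2 : w ^ Nat.card K = 1 := congrArg Subtype.val h1
  refine ⟨w ^ (k + 1), ?_⟩
  rw [← pow_mul, show (k + 1) * 2 = (2 * k + 1) + 1 by ring, pow_succ, ← hk, h2, one_mul]

open IsLocalRing in
lemma unitary_adj (R : Type*) [CommRing R] [IsLocalRing R] [Fintype R] [Fintype (ResidueField R)]
    [DecidableEq (ResidueField R)] (hodd : Odd (Nat.card (maximalIdeal R)))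
    (h1 : qc (-1 : ResidueField R) = 1) (x y : R) :
    (unitaryCayleyGraph R 2).Adj x y ↔ qc (residue R y - residue R x) = 1 := by
  have fwd : ∀ x y : R, (∃ u : Rˣ, y - x = (u : R) ^ 2) → qc (residue R y - residue R x) = 1 := by
    rintro x y ⟨u, hu⟩
    rw [← map_sub, hu, map_pow, pow_two, qc_mul]
    exact qc_sq' ((residue_ne_zero_iff_isUnit _).mpr u.isUnit)
  unfold unitaryCayleyGraph
  rw [SimpleGraph.fromRel_adj]
  constructor
  · rintro ⟨_, h | h⟩
    · exact fwd _ _ h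
    · rw [qc_comm h1]; exact fwd _ _ h
  · intro h
    have hne : residue R y - residue R x ≠ 0 := by
      intro h0; rw [h0] at h; simp at h
    refine ⟨?_, Or.inl ?_⟩
    · rintro rfl; simp at hne
    · have hs : IsSquare (residue R y - residue R x) :=
        (quadraticChar_one_iff_isSquare hne).mp h
      obtain ⟨a, ha⟩ := hs
      obtain ⟨v, rfl⟩ := residue_surjective a
      have hv : IsUnit v := by
        rw [← residue_ne_zero_iff_isUnit]
        intro h0; rw [h0] at ha; simp [ha] at hne
      have hyx : IsUnit (y - x) := by
        rw [← residue_ne_zero_iff_isUnit, map_sub]; exact hne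
      obtain ⟨v, rfl⟩ := hv
      obtain ⟨w, hw⟩ := hyx
      have hw1 : residue R ((w * (v ^ 2)⁻¹ : Rˣ) : R) = 1 := by
        have e1 : ((w * (v ^ 2)⁻¹ : Rˣ) : R) * ((v : R) * v) = y - x := by
          rw [← hw, ← Units.val_mul, ← Units.val_mul]
          congr 1
          rw [pow_two, inv_mul_cancel_right]
        have e2 := congrArg (residue R) e1
        rw [map_mul, map_mul, map_sub, ha] at e2
        have : residue R (v : R) * residue R v ≠ 0 := by rw [← ha]; exact hne
        exact mul_right_cancel₀ this (by rw [e2, one_mul])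
      obtain ⟨t, ht⟩ := isSquare_of_residue_one R hodd _ hw1
      refine ⟨t * v, ?_⟩
      rw [← hw, ← Units.val_pow_eq_pow_val]
      congr 1
      rw [mul_pow, ← ht, inv_mul_cancel_right]


/-- Let `(R,𝔪)` be a finite commutative local ring with `|𝔪| = q^β` and residue field of size
`q = p^r` (`p` prime), where `gcd(2,|R|) = 1` and `q ≡ 1 (mod 4)`. Let `x, y ∈ ℤ` with
`q = x² + 4y²`, and `p ∤ x` when `p ≡ 1 (mod 4)`. Then
`K_4(G_R(2)) = q^(4β+1)(q-1)((q-9)² - 16y²)/(2⁹·3)`. -/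
theorem fourCliqueCount_unitaryCayley_two (R : Type*) [CommRing R] [IsLocalRing R] [Fintype R]
    (q β p r : ℕ) (x y : ℤ) (hp : p.Prime) (hqpr : q = p ^ r)
    (hm : Nat.card (IsLocalRing.maximalIdeal R) = q ^ β)
    (hq : Nat.card (IsLocalRing.ResidueField R) = q)
    (hk : Nat.gcd 2 (Fintype.card R) = 1)
    (hq4 : q % 4 = 1)
    (hxy : (q : ℤ) = x ^ 2 + 4 * y ^ 2)
    (hpx : p % 4 = 1 → ¬ (p : ℤ) ∣ x) :
    (2 ^ 9 * 3 : ℤ) * (unitaryCayleyGraph R 2).cliqueCount 4 =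
      (q : ℤ) ^ (4 * β + 1) * ((q : ℤ) - 1) * (((q : ℤ) - 9) ^ 2 - 16 * y ^ 2) := by
  classical
  haveI : Finite (IsLocalRing.ResidueField R) :=
    Finite.of_surjective _ (IsLocalRing.residue_surjective (R := R))
  letI : Fintype (IsLocalRing.ResidueField R) := Fintype.ofFinite _
  have hq' : Fintype.card (IsLocalRing.ResidueField R) = q := by
    rw [← Nat.card_eq_fintype_card]; exact hq
  have hF : ringChar (IsLocalRing.ResidueField R) ≠ 2 := by
    intro h
    have := FiniteField.even_card_of_char_two h
    omega
  have h1 : qc (-1 : IsLocalRing.ResidueField R) = 1 := by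
    rw [qc, quadraticChar_one_iff_isSquare (by simp), FiniteField.isSquare_neg_one_iff]
    omega
  have hodd : Odd (Nat.card (IsLocalRing.maximalIdeal R)) := by
    rw [hm]
    apply Odd.pow
    rw [Nat.odd_iff]; omega
  have adj := unitary_adj R hodd h1
  have hc := clique_sum (unitaryCayleyGraph R 2)
    (fun a b c d => phi (IsLocalRing.residue R a) (IsLocalRing.residue R b)
      (IsLocalRing.residue R c) (IsLocalRing.residue R d))
    (by
      intro a b c d h
      simp only [adj] at h
      obtain ⟨x1, x2, x3, x4, x5, x6⟩ := h
      simp [phi, ind, x1, x2, x3, x4, x5, x6])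
    (by
      intro a b c d h
      simp only [adj] at h
      simp only [phi, ind]
      by_contra hne
      apply h
      simp only [mul_eq_zero, not_or, ite_eq_right_iff, one_ne_zero, imp_false, not_not] at hne
      tauto)
  have e1 := fun u v w : IsLocalRing.ResidueField R => sum_residue R (fun z => phi u v w z)
  have e2 := fun u v : IsLocalRing.ResidueField R =>
    sum_residue R (fun z => ∑ d, phi u v z d)
  have e3 := fun u : IsLocalRing.ResidueField R =>
    sum_residue R (fun z => ∑ c, ∑ d, phi u z c d)
  have e4 := sum_residue R (fun z => ∑ b, ∑ c, ∑ d, phi z b c d)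
  simp only [e1, ← Finset.mul_sum] at hc
  simp only [e2, ← Finset.mul_sum] at hc
  simp only [e3, ← Finset.mul_sum] at hc
  rw [e4, hm] at hc
  have hphi := sum_phi hF h1
  have hn := nsum_final hF h1 q p r x y hp hqpr hq' hq4 hxy hpx
  rw [hq'] at hphi
  rw [← hn]
  have : (q : ℤ) ^ (4 * β + 1) = (q ^ β) ^ 4 * q := by rw [pow_succ, mul_comm 4, pow_mul]
  rw [this]
  push_cast at hc
  linear_combination 64 * hc + 32 * ((q : ℤ) ^ β) ^ 4 * hphi
end

section
/- Let (R,𝔪) be a finite commutative local ring with identity, with maximal ideal of size |𝔪| = q^β and residue field R/𝔪 of size q = p^r (p prime), where gcd(3,|R|) = 1, and 3 divides q−1 if q is even while 6 divides q−1 if q is odd. Let c ∈ ℤ be such that either (p ≡ 1 (mod 3) and there exists d ∈ ℤ with 4q = c² + 27d², c ≡ 1 (mod 3), and p does not divide c), or (p ≡ 2 (mod 3), r is even, and c = −2(−p)^(r/2)). Let χ₃ be a multiplicative character of 𝔽_q of order 3 and ε the trivial multiplicative character. Then the number of cliques of size 4 in G_R(3) satisfies K_4(G_R(3)) = (q^(4β+1)(q−1)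 / (2³ · 3⁷)) · [ q² + 5q(c−11) + 10c² − 85c + 316 + 12q² · ₃F₂(χ₃, χ₃, χ̄₃; ε, ε; 1)_q ]. -/
open Complex

/-- The binomial symbol `(ψ choose χ) = (ψ(-1)/q) · J(χ, conj ψ)`, where
`J(χ,ψ') = Σ_a χ(a) ψ'(1-a)` is the Jacobi sum. -/
noncomputable def charBinom {F : Type*} [Field F] [Fintype F] (ψ χ : MulChar F ℂ) : ℂ :=
  ψ (-1) / (Fintype.card F : ℂ) *
    jacobiSum χ (ψ.ringHomComp (starRingEnd ℂ))

/-- The hypergeometric sum `₃F₂(A,B,C;D,E;1)_q`, a sum over all multiplicative characters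
`χ` of `F`. -/
noncomputable def hyp3F2 {F : Type*} [Field F] [Fintype F]
    (A B C D E : MulChar F ℂ) : ℂ :=
  (Fintype.card F : ℂ) / ((Fintype.card F : ℂ) - 1) *
    ∑ᶠ χ : MulChar F ℂ,
      charBinom (A * χ) χ * charBinom (B * χ) (D * χ) * charBinom (C * χ) (E * χ) * χ 1

namespace CubicClique

/-- Exponent vectors. -/
abbrev Ex := Fin 3 × Fin 3 × Fin 3 × Fin 3 × Fin 3

/-- The four Coxeter generators of `S₅` acting on exponent vectors. -/
def act : Fin 4 → Ex → Ex
  | 0, (a, b, c, d, e) => (b, a, d, c, e)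
  | 1, (a, b, c, d, e) => (a, -(a + b + c + d + e), e, d, c)
  | 2, (a, b, c, d, e) => (c, d, a, b, e)
  | 3, (a, b, c, d, e) => (-(a + c + e), -(b + d + e), c, d, e)

/-- Orbit representatives. -/
def reps : List Ex :=
  [(0,0,0,0,0), (0,1,1,2,0), (0,0,0,1,0), (0,1,1,0,0), (0,2,1,1,0), (0,0,1,1,0), (0,1,0,1,0),
   (0,2,0,2,0), (1,1,1,1,0), (2,2,2,2,0), (1,2,1,1,2)]

/-- Base-8 table of the generator to apply next (`4` means finished). -/
def table : ℕ :=
  1127381854332981341252994673690750939203962221104996605103984495631021263187770422804700346933080211306274468134134584006831175834657731780934061012170532164685148693471691262388592333643440259118129590950676024170653788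

/-- One step towards the orbit representative. -/
def step (v : Ex) : Ex :=
  match table / 8 ^ ((((v.1.val * 3 + v.2.1.val) * 3 + v.2.2.1.val) * 3 + v.2.2.2.1.val) * 3 +
      v.2.2.2.2.val) % 8 with
  | 0 => act 0 v
  | 1 => act 1 v
  | 2 => act 2 v
  | 3 => act 3 v
  | _ => v

/-- The orbit representative. -/
def red : ℕ → Ex → Ex
  | 0, v => v
  | n + 1, v => red n (step v)

theorem red_inv {M : Type*} (S : Ex → M) (hS : ∀ i v, S (act i v) = S v) (n : ℕ) (v : Ex) :
    S (red n v) = S v := by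
  induction n generalizing v with
  | zero => rfl
  | succ n ih =>
    rw [red, ih, step]
    split <;> first | exact hS _ _ | rfl

theorem red_mem : ∀ v : Ex, red 9 v ∈ reps.toFinset := by decide +kernel

theorem red_counts : reps.map (fun x => (Finset.univ.filter fun v => red 9 v = x).card) =
    [1, 30, 30, 60, 60, 20, 5, 5, 10, 10, 12] := by decide +kernel

theorem sum_red (S : Ex → ℂ) (hS : ∀ i v, S (act i v) = S v) :
    ∑ v, S v = S (0,0,0,0,0) + 30 * S (0,1,1,2,0) + 30 * S (0,0,0,1,0) + 60 * S (0,1,1,0,0) +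
      60 * S (0,2,1,1,0) + 20 * S (0,0,1,1,0) + 5 * S (0,1,0,1,0) + 5 * S (0,2,0,2,0) +
      10 * S (1,1,1,1,0) + 10 * S (2,2,2,2,0) + 12 * S (1,2,1,1,2) := by
  have h1 : ∑ v, S v = ∑ v, S (red 9 v) := Finset.sum_congr rfl fun v _ => (red_inv S hS _ v).symm
  rw [h1, ← Finset.sum_fiberwise_of_maps_to (t := reps.toFinset) (fun v _ => red_mem v)]
  have h2 : ∀ x ∈ reps.toFinset, ∑ v with red 9 v = x, S (red 9 v) =
      (Finset.univ.filter fun v => red 9 v = x).card * S x := by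
    intro x _
    rw [Finset.sum_congr rfl (g := fun _ => S x)]
    · simp
    · intro v hv
      rw [(Finset.mem_filter.1 hv).2]
  rw [Finset.sum_congr rfl h2, List.sum_toFinset _ (by decide +kernel)]
  have h3 := red_counts
  simp only [reps, List.map_cons, List.map_nil, List.cons.injEq] at h3
  obtain ⟨e1, e2, e3, e4, e5, e6, e7, e8, e9, e10, e11, -⟩ := h3
  simp only [reps, List.map_cons, List.map_nil, List.sum_cons, List.sum_nil, e1, e2, e3, e4, e5, e6,
    e7, e8, e9, e10, e11]
  push_cast
  ring

end CubicClique

namespace CubicClique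

section chars
set_option linter.unusedSectionVars false
set_option linter.unusedSimpArgs false
variable {F : Type*} [Field F] [Fintype F]

/-- The powers of the cubic character. -/
noncomputable def X (χ : MulChar F ℂ) (i : Fin 3) : MulChar F ℂ := χ ^ (i : ℕ)

variable {χ : MulChar F ℂ}

theorem X_zero : X χ 0 = 1 := by simp [X]
theorem X_one : X χ 1 = χ := by simp [X]

theorem X_add (h : χ ^ 3 = 1) (i j : Fin 3) : X χ (i + j) = X χ i * X χ j := by
  rw [X, X, X, Fin.val_add, ← pow_add, pow_eq_pow_mod (i.val + j.val) h]

theorem X_neg (h : χ ^ 3 = 1) (i : Fin 3) : X χ (-i) = (X χ i)⁻¹ := by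
  apply eq_inv_of_mul_eq_one_left
  rw [← X_add h, neg_add_cancel, X_zero]

theorem X_two (h : χ ^ 3 = 1) : X χ 2 = χ⁻¹ := by
  have := X_neg h 1
  rwa [X_one] at this

theorem X_neg_one (h : χ ^ 3 = 1) (i : Fin 3) : X χ i (-1) = 1 := by
  have h1 : (X χ i) ^ 3 = 1 := by rw [X, ← pow_mul, mul_comm, pow_mul, h, one_pow]
  have h2 : ((-1 : F)) = (-1) ^ 3 := by norm_num
  rw [h2, map_pow, ← MulChar.pow_apply' _ (by norm_num), h1, MulChar.one_apply (by simp)]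

theorem X_symm (h : χ ^ 3 = 1) (i : Fin 3) (x y : F) : X χ i (x - y) = X χ i (y - x) := by
  rw [← neg_sub, ← neg_one_mul, map_mul, X_neg_one h, one_mul]

theorem X_ne (i : Fin 3) {x : F} (hx : x ≠ 0) : X χ i x ≠ 0 := by
  rw [← hx.isUnit.unit_spec]
  exact (MulChar.toUnitHom (X χ i) hx.isUnit.unit).ne_zero

theorem X_inv (i : Fin 3) (x : F) : X χ i x⁻¹ = (X χ i x)⁻¹ := by
  rw [← MulChar.inv_apply', MulChar.inv_apply_eq_inv']

/-- Inversion. -/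
def invE : F ≃ F := ⟨(·⁻¹), (·⁻¹), inv_inv, inv_inv⟩

theorem invE_apply (x : F) : invE x = x⁻¹ := rfl

/-- The summand. -/
noncomputable def Sm (χ : MulChar F ℂ) (v : Ex) (x y : F) : ℂ :=
  X χ v.1 x * X χ v.2.1 y * X χ v.2.2.1 (1 - x) * X χ v.2.2.2.1 (1 - y) * X χ v.2.2.2.2 (x - y)

/-- The basic double character sum. -/
noncomputable def S (χ : MulChar F ℂ) (v : Ex) : ℂ := ∑ x : F, ∑ y : F, Sm χ v x y

theorem S_act0 (h : χ ^ 3 = 1) (v : Ex) : S χ (act 0 v) = S χ v := by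
  obtain ⟨a, b, c, d, e⟩ := v
  rw [S, S, Finset.sum_comm]
  refine Finset.sum_congr rfl fun x _ => Finset.sum_congr rfl fun y _ => ?_
  simp only [Sm, act]
  rw [X_symm h e]
  ring

theorem S_act2 (h : χ ^ 3 = 1) (v : Ex) : S χ (act 2 v) = S χ v := by
  obtain ⟨a, b, c, d, e⟩ := v
  rw [S, S, ← (Equiv.subLeft (1 : F)).sum_comp]
  refine Finset.sum_congr rfl fun x _ => ?_
  rw [← (Equiv.subLeft (1 : F)).sum_comp]
  refine Finset.sum_congr rfl fun y _ => ?_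
  simp only [Sm, act, Equiv.subLeft_apply, sub_sub_cancel, sub_sub_sub_cancel_left]
  rw [X_symm h e]
  ring

theorem S_act3 (h : χ ^ 3 = 1) (v : Ex) : S χ (act 3 v) = S χ v := by
  obtain ⟨a, b, c, d, e⟩ := v
  rw [S, S, ← invE.sum_comp]
  refine Finset.sum_congr rfl fun x _ => ?_
  rw [← invE.sum_comp]
  refine Finset.sum_congr rfl fun y _ => ?_
  simp only [Sm, act, invE_apply]
  by_cases hx : x = 0
  · simp only [hx, inv_zero, MulChar.map_zero, zero_mul, mul_zero]
  by_cases hy : y = 0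
  · simp only [hy, inv_zero, MulChar.map_zero, zero_mul, mul_zero]
  have h1 : 1 - x⁻¹ = (x - 1) * x⁻¹ := by field_simp
  have h2 : 1 - y⁻¹ = (y - 1) * y⁻¹ := by field_simp
  have h3 : x⁻¹ - y⁻¹ = (y - x) * x⁻¹ * y⁻¹ := by field_simp
  have hX : ∀ i, X χ i x ≠ 0 := fun i => X_ne i hx
  have hY : ∀ i, X χ i y ≠ 0 := fun i => X_ne i hy
  have hi : ∀ i (z : F), X χ i z⁻¹ = (X χ i z)⁻¹ := fun i z => X_inv i z
  rw [h1, h2, h3]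
  simp only [X_neg h, X_add h, MulChar.inv_apply_eq_inv', MulChar.mul_apply, map_mul, inv_inv, hi]
  rw [X_symm h _ x 1, X_symm h _ y 1, X_symm h _ y x]
  have := hX a; have := hX c; have := hX e
  have := hY b; have := hY d; have := hY e
  field_simp

theorem S_act1 (h : χ ^ 3 = 1) (v : Ex) : S χ (act 1 v) = S χ v := by
  obtain ⟨a, b, c, d, e⟩ := v
  rw [S, S, Finset.sum_comm, Finset.sum_comm (f := fun x y => Sm χ (a, b, c, d, e) x y),
    ← invE.sum_comp]
  refine Finset.sum_congr rfl fun y _ => ?_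
  by_cases hy : y = 0
  · simp only [hy, Sm, act, invE_apply, inv_zero, MulChar.map_zero, zero_mul, mul_zero]
  rw [← Equiv.sum_comp (Equiv.mulRight₀ y⁻¹ (inv_ne_zero hy))]
  refine Finset.sum_congr rfl fun x _ => ?_
  have hE : (Equiv.mulRight₀ y⁻¹ (inv_ne_zero hy)) x = x * y⁻¹ := rfl
  simp only [Sm, act, invE_apply, hE]
  have h1 : 1 - x * y⁻¹ = (y - x) * y⁻¹ := by field_simp
  have h2 : 1 - y⁻¹ = (y - 1) * y⁻¹ := by field_simp
  have h3 : x * y⁻¹ - y⁻¹ = (x - 1) * y⁻¹ := by field_simp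
  have hY : ∀ i, X χ i y ≠ 0 := fun i => X_ne i hy
  have hi : ∀ i (z : F), X χ i z⁻¹ = (X χ i z)⁻¹ := fun i z => X_inv i z
  rw [h1, h2, h3]
  simp only [X_neg h, X_add h, MulChar.inv_apply_eq_inv', MulChar.mul_apply, map_mul, inv_inv, hi]
  rw [X_symm h _ x 1, X_symm h _ y 1, X_symm h _ y x]
  have := hY a; have := hY c; have := hY e
  have := hY b; have := hY d
  field_simp

theorem S_act (h : χ ^ 3 = 1) (i : Fin 4) (v : Ex) : S χ (act i v) = S χ v := by
  fin_cases i
  · exact S_act0 h v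
  · exact S_act1 h v
  · exact S_act2 h v
  · exact S_act3 h v

theorem S_zero (h : χ ^ 3 = 1) (a b c d : Fin 3) :
    S χ (a, b, c, d, 0) = jacobiSum (X χ a) (X χ c) * jacobiSum (X χ b) (X χ d) -
      jacobiSum (X χ (a + b)) (X χ (c + d)) := by
  classical
  rw [S, jacobiSum, jacobiSum, Finset.sum_mul_sum, jacobiSum, ← Finset.sum_sub_distrib]
  refine Finset.sum_congr rfl fun x _ => ?_
  rw [eq_sub_iff_add_eq, ← Finset.sum_erase_add _ _ (Finset.mem_univ x),
    ← Finset.sum_erase_add (Finset.univ : Finset F) (fun j => X χ a x * X χ c (1 - x) *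
      (X χ b j * X χ d (1 - j))) (Finset.mem_univ x)]
  have : Sm χ (a, b, c, d, 0) x x = 0 := by
    simp only [Sm, sub_self, MulChar.map_zero, mul_zero]
  rw [this, add_zero]
  congr 1
  · refine Finset.sum_congr rfl fun y hy => ?_
    have : x - y ≠ 0 := sub_ne_zero.2 (Finset.ne_of_mem_erase hy).symm
    simp only [Sm, X_zero, MulChar.one_apply this.isUnit]
    ring
  · rw [X_add h, X_add h, MulChar.mul_apply, MulChar.mul_apply]
    ring

theorem sum_S (h : χ ^ 3 = 1) (h1 : χ ≠ 1) (q : ℕ) (hF : Fintype.card F = q) (c : ℂ)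
    (hc : jacobiSum χ χ + jacobiSum χ⁻¹ χ⁻¹ = c) (hJ : jacobiSum χ χ * jacobiSum χ⁻¹ χ⁻¹ = q) :
    ∑ v, S χ v = (q : ℂ) ^ 2 + 5 * q * (c - 11) + 10 * c ^ 2 - 85 * c + 316
      + 12 * S χ (1,2,1,1,2) := by
  have h2 : χ⁻¹ ≠ 1 := by simpa using h1
  have hn : χ (-1) = 1 := by simpa [X_one] using X_neg_one h 1
  have hn' : χ⁻¹ (-1) = 1 := by simpa [X_two h] using X_neg_one h 2
  have e1 : jacobiSum (1 : MulChar F ℂ) 1 = q - 2 := by rw [jacobiSum_one_one, hF]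
  have e2 := jacobiSum_one_nontrivial h1
  have e3 := jacobiSum_one_nontrivial h2
  have e4 := jacobiSum_nontrivial_inv h1
  have e5 := jacobiSum_nontrivial_inv h2
  have e6 := jacobiSum_comm χ 1
  have e7 := jacobiSum_comm χ⁻¹ 1
  rw [inv_inv] at e5
  rw [hn] at e4
  rw [hn'] at e5
  rw [e2] at e6
  rw [e3] at e7
  have k1 : (1 + 2 : Fin 3) = 0 := rfl
  have k2 : (2 + 1 : Fin 3) = 0 := rfl
  have k3 : (1 + 1 : Fin 3) = 2 := rfl
  have k4 : (2 + 2 : Fin 3) = 1 := rfl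
  rw [sum_red _ (S_act h)]
  simp only [S_zero h, add_zero, zero_add, k1, k2, k3, k4, X_zero, X_one, X_two h, e1, e2, e3, e4,
    e5, e6, e7]
  subst hc
  generalize jacobiSum χ χ = J at *
  generalize jacobiSum χ⁻¹ χ⁻¹ = K at *
  rw [← hJ]
  ring

end chars
end CubicClique

namespace CubicClique

theorem not_dvd_choose (p m : ℕ) (hp : p.Prime) (hm : p = 3 * m + 1) (r : ℕ) :
    ∀ k, 3 * k + 1 = p ^ r → ¬ p ∣ (2 * k).choose k := by
  have := Fact.mk hp
  induction r with
  | zero =>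
    intro k hk
    have : k = 0 := by simpa using hk
    subst this
    simpa using hp.one_lt.ne'
  | succ r ih =>
    intro k hk
    -- `p ^ r ≡ 1 mod 3`
    have h1 : ∃ k', 3 * k' + 1 = p ^ r := by
      have : p ^ r % 3 = 1 := by
        rw [Nat.pow_mod, hm]
        simp [Nat.add_mod]
      exact ⟨p ^ r / 3, by omega⟩
    obtain ⟨k', hk'⟩ := h1
    have h2 : k = m + p * k' := by
      have : 3 * k + 1 = 3 * (m + p * k') + 1 := by
        rw [hk, pow_succ, ← hk']
        nlinarith
      omega
    have h3 : (2 * k) = 2 * m + p * (2 * k') := by rw [h2]; ring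
    have hL := Choose.choose_modEq_choose_mod_mul_choose_div_nat (n := 2 * k) (k := k) (p := p)
    have e1 : k % p = m := by rw [h2, Nat.add_mul_mod_self_left, Nat.mod_eq_of_lt (by omega)]
    have e2 : 2 * k % p = 2 * m := by
      rw [h3, Nat.add_mul_mod_self_left, Nat.mod_eq_of_lt (by have := hp.two_le; omega)]
    have e3 : k / p = k' := by
      rw [h2, Nat.add_mul_div_left _ _ hp.pos, Nat.div_eq_of_lt (by omega), zero_add]
    have e4 : 2 * k / p = 2 * k' := by
      rw [h3, Nat.add_mul_div_left _ _ hp.pos, Nat.div_eq_of_lt (by have := hp.two_le; omega),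
        zero_add]
    rw [e1, e2, e3, e4] at hL
    intro hd
    have hd' := (hL.dvd_iff dvd_rfl).1 hd
    rcases (hp.dvd_mul).1 hd' with h | h
    · have : (2 * m).choose m ∣ (2 * m).factorial := by
        rw [← Nat.choose_mul_factorial_mul_factorial (show m ≤ 2 * m by omega), mul_assoc]
        exact dvd_mul_right _ _
      have := (hp.dvd_factorial).1 (h.trans this)
      omega
    · exact ih k' hk' h

theorem c_unique (p r : ℕ) (hr : r ≠ 0) (hp : p.Prime) (hp3 : p % 3 = 1) (c d c' d' : ℤ)
    (h : 4 * ((p ^ r : ℕ) : ℤ) = c ^ 2 + 27 * d ^ 2) (h' : 4 * ((p ^ r : ℕ) : ℤ) = c' ^ 2 + 27 * d' ^ 2)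
    (hc : c % 3 = 1) (hc' : c' % 3 = 1) (hpc : ¬ (p : ℤ) ∣ c) (hpc' : ¬ (p : ℤ) ∣ c') : c = c' := by
  have hpZ : Prime (p : ℤ) := Nat.prime_iff_prime_int.1 hp
  have hpos : (0 : ℤ) < ((p ^ r : ℕ) : ℤ) := by exact_mod_cast pow_pos hp.pos r
  set Q : ℤ := ((p ^ r : ℕ) : ℤ) with hQ
  have hQp : Q = (p : ℤ) ^ r := by rw [hQ]; push_cast; rfl
  have hprod : (c * d' - c' * d) * (c * d' + c' * d) = Q * (4 * (d' ^ 2 - d ^ 2)) := by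
    linear_combination (- d' ^ 2) * h + d ^ 2 * h'
  -- a claim valid up to sign
  have key : ∀ e : ℤ, e ^ 2 = d ^ 2 → Q ∣ c * d' - c' * e → c = c' := by
    intro e he ⟨t, ht⟩
    have h16 : 16 * Q ^ 2 = (c * c' + 27 * e * d') ^ 2 + 27 * (Q * t) ^ 2 := by
      rw [← ht]
      have : 16 * Q ^ 2 = (4 * Q) * (4 * Q) := by ring
      rw [this]
      nth_rewrite 1 [h]
      rw [h', ← he]
      ring
    have ht0 : t = 0 := by
      by_contra hne
      have : 1 ≤ t ^ 2 := by
        have := sq_nonneg t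
        have : t ^ 2 ≠ 0 := pow_ne_zero 2 hne
        omega
      nlinarith [sq_nonneg (c * c' + 27 * e * d'), pow_pos hpos 2]
    rw [ht0, mul_zero] at ht
    have h5 : Q * (4 * (d' ^ 2 - d ^ 2)) = 0 := by
      rw [← hprod]
      have : (c * d' - c' * d) * (c * d' + c' * d) = (c * d' - c' * e) * (c * d' + c' * e) := by
        linear_combination c' ^ 2 * he
      rw [this, ht, zero_mul]
    have h6 : d' ^ 2 - d ^ 2 = 0 := by
      rcases mul_eq_zero.1 h5 with h | h
      · omega
      · omega
    have h7 : c ^ 2 = c' ^ 2 := by linear_combination h' - h + 27 * h6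
    rcases sq_eq_sq_iff_eq_or_eq_neg.1 h7 with h | h
    · exact h
    · omega
  have hcop : ∀ z : ℤ, ¬ (p : ℤ) ∣ z → IsCoprime Q z := by
    intro z hz
    rw [hQp]
    exact ((hpZ.coprime_iff_not_dvd).2 hz).pow_left
  by_cases h1 : (p : ℤ) ∣ c * d' - c' * d
  · have h2 : ¬ (p : ℤ) ∣ c * d' + c' * d := by
      intro h2
      have h3 : (p : ℤ) ∣ 2 * (c * d') := by
        have := dvd_add h1 h2
        ring_nf at this ⊢
        exact this
      have hp2 : ¬ (p : ℤ) ∣ 2 := by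
        intro h
        have h' : p ∣ 2 := by exact_mod_cast h
        have := (Nat.prime_dvd_prime_iff_eq hp Nat.prime_two).1 h'
        omega
      have h4 : (p : ℤ) ∣ d' := by
        rcases hpZ.dvd_or_dvd h3 with h | h
        · exact absurd h hp2
        · exact (hpZ.dvd_or_dvd h).resolve_left hpc
      have h5 : (p : ℤ) ∣ Q := by rw [hQp]; exact dvd_pow_self _ hr
      apply hpc'
      have h6 : (p : ℤ) ∣ c' ^ 2 := by
        have : c' ^ 2 = 4 * Q - 27 * d' * d' := by linear_combination -h'
        rw [this]
        exact dvd_sub (Dvd.dvd.mul_left h5 _) (Dvd.dvd.mul_left h4 _)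
      exact hpZ.dvd_of_dvd_pow h6
    apply key d rfl
    exact (hcop _ h2).dvd_of_dvd_mul_right ⟨_, hprod⟩
  · apply key (-d) (by ring)
    have : c * d' - c' * -d = c * d' + c' * d := by ring
    rw [this]
    exact (hcop _ h1).dvd_of_dvd_mul_left ⟨_, hprod⟩

theorem inert_dvd (p : ℕ) (hp : p.Prime) (hp3 : p % 3 = 2) (a b : ℤ)
    (h : (p : ℤ) ∣ a ^ 2 - a * b + b ^ 2) : (p : ℤ) ∣ a ∧ (p : ℤ) ∣ b := by
  have := Fact.mk hp
  rw [← ZMod.intCast_zmod_eq_zero_iff_dvd] at h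
  simp only [← ZMod.intCast_zmod_eq_zero_iff_dvd]
  push_cast at h
  generalize (a : ZMod p) = x at *
  generalize (b : ZMod p) = y at *
  have h3 : (3 : ZMod p) ≠ 0 := by
    intro h0
    have : ((3 : ℕ) : ZMod p) = 0 := by exact_mod_cast h0
    rw [ZMod.natCast_eq_zero_iff] at this
    have := (Nat.prime_dvd_prime_iff_eq hp Nat.prime_three).1 this
    omega
  have hy : y = 0 := by
    by_contra hy
    have ht : (x / y) ^ 2 - x / y + 1 = 0 := by
      field_simp
      linear_combination h
    set t := x / y
    have h6 : (-t) ^ 3 = 1 := by linear_combination (-(t + 1)) * ht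
    have h7 : -t ≠ 1 := by
      intro h7
      apply h3
      have : t = -1 := by linear_combination -h7
      rw [this] at ht
      linear_combination ht
    have ho : orderOf (-t) = 3 := orderOf_eq_prime h6 h7
    have ht0 : -t ≠ 0 := by
      intro h0
      rw [h0] at h6
      norm_num at h6
    have hd : orderOf (-t) ∣ p - 1 := orderOf_dvd_of_pow_eq_one (ZMod.pow_card_sub_one_eq_one ht0)
    rw [ho] at hd
    omega
  refine ⟨?_, hy⟩
  rw [hy] at h
  simpa using h

theorem inert_desc (p : ℕ) (hp : p.Prime) (hp3 : p % 3 = 2) (r : ℕ) : ∀ a b : ℤ,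
    a ^ 2 - a * b + b ^ 2 = (p : ℤ) ^ (2 * r) →
    ∃ a' b' : ℤ, a = (p : ℤ) ^ r * a' ∧ b = (p : ℤ) ^ r * b' ∧ a' ^ 2 - a' * b' + b' ^ 2 = 1 := by
  have hp0 : (p : ℤ) ≠ 0 := by exact_mod_cast hp.ne_zero
  induction r with
  | zero => intro a b h; exact ⟨a, b, by simp, by simp, by simpa using h⟩
  | succ r ih =>
    intro a b h
    obtain ⟨⟨x, rfl⟩, ⟨y, rfl⟩⟩ := inert_dvd p hp hp3 a b (by
      rw [h]; exact dvd_pow_self _ (by omega))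
    have h2 : x ^ 2 - x * y + y ^ 2 = (p : ℤ) ^ (2 * r) := by
      have : (p : ℤ) ^ 2 * (x ^ 2 - x * y + y ^ 2) = (p : ℤ) ^ 2 * (p : ℤ) ^ (2 * r) := by
        rw [← pow_add]
        rw [show 2 + 2 * r = 2 * (r + 1) by ring, ← h]
        ring
      exact mul_left_cancel₀ (pow_ne_zero 2 hp0) this
    obtain ⟨a', b', h3, h4, h5⟩ := ih x y h2
    exact ⟨a', b', by rw [h3]; ring, by rw [h4]; ring, h5⟩

theorem inert_case (p : ℕ) (hp : p.Prime) (hp3 : p % 3 = 2) (r : ℕ) (a b : ℤ)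
    (h : a ^ 2 - a * b + b ^ 2 = (p : ℤ) ^ (2 * r)) (ha : a % 3 = 2) (hb : (3 : ℤ) ∣ b) :
    2 * a - b = -2 * (-(p : ℤ)) ^ r := by
  obtain ⟨x, y, rfl, rfl, h1⟩ := inert_desc p hp hp3 r a b h
  have h3 : Prime (3 : ℤ) := Int.prime_three
  have hy3 : (3 : ℤ) ∣ y := by
    rcases h3.dvd_or_dvd hb with h | h
    · have := h3.dvd_of_dvd_pow h
      omega
    · exact h
  have hy : y = 0 := by
    obtain ⟨z, rfl⟩ := hy3
    by_contra hne
    have hz : z ≠ 0 := by rintro rfl; simp at hne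
    have : z ^ 2 ≠ 0 := pow_ne_zero 2 hz
    have : 1 ≤ z ^ 2 := by have := sq_nonneg z; omega
    nlinarith [sq_nonneg (2 * x - 3 * z)]
  subst hy
  have hx : x = 1 ∨ x = -1 := by
    exact sq_eq_sq_iff_eq_or_eq_neg.1 (show x ^ 2 = 1 ^ 2 by linear_combination h1)
  have hpm : ((p : ℤ) ^ r - (-1) ^ r) % 3 = 0 := by
    apply Int.emod_eq_zero_of_dvd
    have : (p : ℤ) - (-1) ∣ (p : ℤ) ^ r - (-1) ^ r := sub_dvd_pow_sub_pow _ _ r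
    exact Dvd.dvd.trans (by omega) this
  rw [neg_pow (p : ℤ) r]
  rcases neg_one_pow_eq_or ℤ r with hr | hr <;> rw [hr] at hpm ⊢ <;> rcases hx with hx | hx <;>
    rw [hx] at ha ⊢ <;> omega

end CubicClique

namespace CubicClique
section hyper
variable {F : Type*} [Field F] [Fintype F]

theorem sum_all_chars [DecidableEq F] [Fintype (MulChar F ℂ)] (a : F) :
    ∑ φ : MulChar F ℂ, φ a = if a = 1 then (Fintype.card F : ℂ) - 1 else 0 := by
  split_ifs with ha
  · subst ha
    simp only [map_one, Finset.sum_const, Finset.card_univ, nsmul_eq_mul, mul_one]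
    have h1 := MulChar.card_eq_card_units_of_hasEnoughRootsOfUnity F ℂ
    rw [Nat.card_eq_fintype_card, Nat.card_eq_fintype_card, Fintype.card_units] at h1
    rw [h1, Nat.cast_sub Fintype.card_pos, Nat.cast_one]
  · obtain ⟨χ, hχ⟩ := MulChar.exists_apply_ne_one_of_hasEnoughRootsOfUnity F ℂ ha
    refine eq_zero_of_mul_eq_self_left hχ ?_
    simp only [Finset.mul_sum, ← MulChar.mul_apply]
    exact Fintype.sum_bijective _ (Group.mulLeft_bijective χ) _ _ fun χ' => rfl

open Classical in
/-- The involution `u ↦ u / (u - 1)` fixing `1`. -/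
noncomputable def flipE : F ≃ F where
  toFun u := if u = 1 then 1 else u / (u - 1)
  invFun u := if u = 1 then 1 else u / (u - 1)
  left_inv u := by
    by_cases hu : u = 1
    · simp [hu]
    · have h1 : u - 1 ≠ 0 := sub_ne_zero.2 hu
      have h2 : u / (u - 1) ≠ 1 := by
        intro h
        rw [div_eq_one_iff_eq h1] at h
        exact one_ne_zero (by linear_combination h : (1 : F) = 0)
      simp only [hu, h2, if_false]
      have h3 : u / (u - 1) - 1 = 1 / (u - 1) := by field_simp; ring
      rw [h3]
      field_simp
  right_inv u := by
    by_cases hu : u = 1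
    · simp [hu]
    · have h1 : u - 1 ≠ 0 := sub_ne_zero.2 hu
      have h2 : u / (u - 1) ≠ 1 := by
        intro h
        rw [div_eq_one_iff_eq h1] at h
        exact one_ne_zero (by linear_combination h : (1 : F) = 0)
      simp only [hu, h2, if_false]
      have h3 : u / (u - 1) - 1 = 1 / (u - 1) := by field_simp; ring
      rw [h3]
      field_simp

theorem ringHomComp_conj (ψ : MulChar F ℂ) : ψ.ringHomComp (starRingEnd ℂ) = ψ⁻¹ :=
  MulChar.star_eq_inv ψ

theorem charBinom_eq (A φ : MulChar F ℂ) (hA : A (-1) = 1) :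
    charBinom (A * φ) φ = jacobiSum φ A / (Fintype.card F : ℂ) := by
  rw [charBinom, ringHomComp_conj, div_mul_eq_mul_div, MulChar.mul_apply, hA, one_mul]
  congr 1
  rw [jacobiSum, jacobiSum, ← Equiv.sum_comp flipE (fun x => φ x * A (1 - x)), Finset.mul_sum]
  refine Finset.sum_congr rfl fun u _ => ?_
  by_cases hu : u = 1
  · simp only [hu, flipE, Equiv.coe_fn_mk, if_true, sub_self, MulChar.map_zero, mul_zero]
  have h1 : u - 1 ≠ 0 := sub_ne_zero.2 hu
  have h1' : 1 - u ≠ 0 := sub_ne_zero.2 (Ne.symm hu)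
  simp only [flipE, Equiv.coe_fn_mk, hu, if_false]
  have h3 : 1 - u / (u - 1) = (1 - u)⁻¹ := by field_simp; ring
  have h4 : u / (u - 1) = (-1) * u * (1 - u)⁻¹ := by field_simp; ring
  rw [h3, h4, MulChar.inv_apply', MulChar.mul_apply, map_mul, map_mul]
  ring

theorem hyp_eq {χ : MulChar F ℂ} (h : χ ^ 3 = 1) :
    (Fintype.card F : ℂ) ^ 2 * hyp3F2 χ χ (χ.ringHomComp (starRingEnd ℂ)) 1 1 =
      S χ (1,2,1,1,2) := by
  classical
  let _ := Fintype.ofFinite (MulChar F ℂ)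
  have hq0 : (Fintype.card F : ℂ) ≠ 0 := by exact_mod_cast Fintype.card_ne_zero
  have hq1 : (Fintype.card F : ℂ) - 1 ≠ 0 := by
    rw [sub_ne_zero]
    exact_mod_cast (Fintype.one_lt_card (α := F)).ne'
  have hn : χ (-1) = 1 := by simpa [X_one] using X_neg_one h 1
  have hn' : χ⁻¹ (-1) = 1 := by simpa [X_two h] using X_neg_one h 2
  rw [hyp3F2, finsum_eq_sum_of_fintype, ringHomComp_conj]
  simp only [one_mul, charBinom_eq _ _ hn, charBinom_eq _ _ hn', MulChar.map_one, mul_one]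
  have key : ∑ φ : MulChar F ℂ, jacobiSum φ χ * jacobiSum φ χ * jacobiSum φ χ⁻¹ =
      ((Fintype.card F : ℂ) - 1) * S χ (1,2,1,1,2) := by
    have e1 : ∀ φ : MulChar F ℂ, jacobiSum φ χ * jacobiSum φ χ * jacobiSum φ χ⁻¹ =
        ∑ s, ∑ t, ∑ r, χ (1 - s) * χ (1 - t) * χ⁻¹ (1 - r) * φ (s * t * r) := by
      intro φ
      rw [jacobiSum, jacobiSum, Finset.sum_mul_sum, Finset.sum_mul]
      refine Finset.sum_congr rfl fun s _ => ?_
      rw [Finset.sum_mul]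
      refine Finset.sum_congr rfl fun t _ => ?_
      rw [Finset.mul_sum]
      refine Finset.sum_congr rfl fun r _ => ?_
      rw [map_mul, map_mul]
      ring
    rw [Finset.sum_congr rfl fun φ _ => e1 φ, Finset.sum_comm, S, Finset.mul_sum]
    refine Finset.sum_congr rfl fun s _ => ?_
    rw [Finset.sum_comm, Finset.mul_sum, ← Equiv.sum_comp invE]
    refine Finset.sum_congr rfl fun y _ => ?_
    rw [Finset.sum_comm]
    simp only [← Finset.mul_sum]
    have e2 := fun a : F => sum_all_chars a
    simp only [e2, invE_apply, Sm, X_one, X_two h]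
    by_cases hs : s = 0
    · simp [hs, MulChar.map_zero]
    by_cases hy : y = 0
    · simp [hy, MulChar.map_zero]
    rw [Finset.sum_eq_single (y * s⁻¹)]
    · have : s * y⁻¹ * (y * s⁻¹) = 1 := by field_simp
      rw [if_pos this]
      have h2 : 1 - y⁻¹ = (-1) * (1 - y) * y⁻¹ := by field_simp; ring
      have h3 : 1 - y * s⁻¹ = (s - y) * s⁻¹ := by field_simp
      rw [h2, h3, map_mul, map_mul, map_mul, hn, ← MulChar.inv_apply' χ y, ← MulChar.inv_apply' χ⁻¹ s,
        inv_inv]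
      ring
    · intro r _ hr
      rw [if_neg, mul_zero]
      intro h0
      apply hr
      field_simp at h0 ⊢
      linear_combination h0
    · simp
  have : ∀ φ : MulChar F ℂ, jacobiSum φ χ / (Fintype.card F : ℂ) *
      (jacobiSum φ χ / (Fintype.card F : ℂ)) * (jacobiSum φ χ⁻¹ / (Fintype.card F : ℂ)) =
      jacobiSum φ χ * jacobiSum φ χ * jacobiSum φ χ⁻¹ * ((Fintype.card F : ℂ) ^ 3)⁻¹ := by
    intro φ
    field_simp
  rw [Finset.sum_congr rfl fun φ _ => this φ, ← Finset.sum_mul, key]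
  field_simp

end hyper
end CubicClique

namespace CubicClique
section jac
set_option linter.unusedSectionVars false
variable {F : Type*} [Field F] [Fintype F]

theorem power_sum (i : ℕ) (hi : 0 < i) :
    ∑ x : F, x ^ i = if Fintype.card F - 1 ∣ i then -1 else 0 := by
  classical
  rw [← FiniteField.sum_pow_units F i, ← Finset.sum_erase_add _ _ (Finset.mem_univ (0 : F)),
    zero_pow hi.ne', add_zero]
  symm
  refine Finset.sum_bij (fun (u : Fˣ) _ => (u : F)) ?_ ?_ ?_ ?_
  · intro u _; simp
  · intro u _ v _ h; exact Units.ext h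
  · intro x hx
    exact ⟨Units.mk0 x (Finset.ne_of_mem_erase hx), Finset.mem_univ _, rfl⟩
  · intro u _; simp

theorem beta_sum (m : ℕ) (hm : 0 < m) :
    ∑ x : F, (x * (1 - x)) ^ m = ∑ j ∈ Finset.range (m + 1),
      (-1) ^ j * (m.choose j : F) * (if Fintype.card F - 1 ∣ m + j then -1 else 0) := by
  have : ∀ x : F, (x * (1 - x)) ^ m =
      ∑ j ∈ Finset.range (m + 1), (-1) ^ j * (m.choose j : F) * x ^ (m + j) := by
    intro x
    rw [mul_pow, sub_eq_neg_add, add_pow, Finset.mul_sum]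
    refine Finset.sum_congr rfl fun j _ => ?_
    rw [neg_pow, one_pow, pow_add]
    ring
  rw [Finset.sum_congr rfl fun x _ => this x, Finset.sum_comm]
  refine Finset.sum_congr rfl fun j _ => ?_
  rw [← Finset.mul_sum, power_sum _ (by omega)]

theorem beta_sum_one (k : ℕ) (hk : 3 * k + 1 = Fintype.card F) (hk0 : 0 < k) :
    ∑ x : F, (x * (1 - x)) ^ k = 0 := by
  rw [beta_sum k hk0]
  refine Finset.sum_eq_zero fun j hj => ?_
  rw [if_neg, mul_zero]
  intro hd
  have := Nat.le_of_dvd (by omega) hd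
  rw [Finset.mem_range] at hj
  omega

theorem beta_sum_two (k : ℕ) (hk : 3 * k + 1 = Fintype.card F) (hk0 : 0 < k) :
    ∑ x : F, (x * (1 - x)) ^ (2 * k) = -((-1) ^ k * ((2 * k).choose k : F)) := by
  rw [beta_sum (2 * k) (by omega), Finset.sum_eq_single k]
  · rw [if_pos, mul_neg, mul_one]
    rw [← hk]
    exact ⟨1, by omega⟩
  · intro j hj hne
    rw [if_neg, mul_zero]
    rintro ⟨t, ht⟩
    rw [Finset.mem_range] at hj
    have h1 : Fintype.card F - 1 = 3 * k := by omega
    rw [h1] at ht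
    have : t ≠ 0 := by rintro rfl; omega
    have : t ≠ 1 := by rintro rfl; omega
    have : 2 ≤ t := by omega
    nlinarith
  · intro h
    exact absurd (Finset.mem_range.2 (by omega)) h

variable {χ : MulChar F ℂ}

theorem order_three_facts (hχ : orderOf χ = 3) : χ ^ 3 = 1 ∧ χ ≠ 1 ∧ χ * χ ≠ 1 := by
  refine ⟨hχ ▸ pow_orderOf_eq_one χ, ?_, ?_⟩
  · intro h
    rw [h, orderOf_one] at hχ
    omega
  · intro h
    rw [← pow_two] at h
    have := orderOf_dvd_of_pow_eq_one h
    rw [hχ] at this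
    omega

/-- Discrete logarithm description of the cubic character. -/
theorem cube_log (hχ : orderOf χ = 3) : ∃ g : Fˣ, (∀ u : Fˣ, ∃ n : ℕ, u = g ^ n) ∧
    orderOf g = Fintype.card F - 1 ∧ ∀ n : ℕ, χ ((g : F) ^ n) = 1 ↔ 3 ∣ n := by
  classical
  obtain ⟨h3, h1, -⟩ := order_three_facts hχ
  obtain ⟨g, hg⟩ := IsCyclic.exists_generator (α := Fˣ)
  have hgn : ∀ u : Fˣ, ∃ n : ℕ, u = g ^ n := by
    intro u
    have := (mem_powers_iff_mem_zpowers (x := g) (y := u)).2 (hg u)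
    obtain ⟨n, hn⟩ := this
    exact ⟨n, hn.symm⟩
  refine ⟨g, hgn, ?_, ?_⟩
  · rw [orderOf_eq_card_of_forall_mem_zpowers hg, Nat.card_eq_fintype_card, Fintype.card_units]
  · have hg1 : χ g ≠ 1 := by
      intro h
      apply h1
      ext u
      obtain ⟨n, rfl⟩ := hgn u
      rw [Units.val_pow_eq_pow_val, map_pow, h, one_pow, MulChar.one_apply (g.isUnit.pow n)]
    have hg3 : (χ g) ^ 3 = 1 := by
      rw [← MulChar.pow_apply' _ (by norm_num), h3, MulChar.one_apply g.isUnit]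
    have ho : orderOf (χ g) = 3 := orderOf_eq_prime hg3 hg1
    intro n
    rw [map_pow, ← orderOf_dvd_iff_pow_eq_one, ho]

theorem three_dvd (hχ : orderOf χ = 3) : ∃ k, 3 * k + 1 = Fintype.card F ∧ 0 < k := by
  obtain ⟨g, -, ho, hn⟩ := cube_log hχ
  have h2 : 1 < Fintype.card F := Fintype.one_lt_card
  have h1 : (g : F) ^ (Fintype.card F - 1) = 1 := by
    rw [← ho, ← Units.val_pow_eq_pow_val, pow_orderOf_eq_one, Units.val_one]
  obtain ⟨k, hk⟩ := (hn (Fintype.card F - 1)).1 (by rw [h1, map_one])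
  exact ⟨k, by omega, by omega⟩

theorem chi_cube (hχ : orderOf χ = 3) (y : F) (hy : y ≠ 0) :
    χ y = 1 ↔ ∃ z : F, z ≠ 0 ∧ y = z ^ 3 := by
  obtain ⟨h3, -, -⟩ := order_three_facts hχ
  constructor
  · intro h
    obtain ⟨g, hgn, -, hn⟩ := cube_log hχ
    obtain ⟨n, hu⟩ := hgn (Units.mk0 y hy)
    have hy' : y = (g : F) ^ n := by rw [← Units.val_pow_eq_pow_val, ← hu]; rfl
    rw [hy'] at h
    obtain ⟨m, rfl⟩ := (hn n).1 h
    exact ⟨(g : F) ^ m, pow_ne_zero _ g.ne_zero, by rw [hy', ← pow_mul, mul_comm]⟩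
  · rintro ⟨z, hz, rfl⟩
    rw [map_pow, ← MulChar.pow_apply' _ (by norm_num), h3, MulChar.one_apply hz.isUnit]

theorem chi_pow (hχ : orderOf χ = 3) (k : ℕ) (hk : 3 * k + 1 = Fintype.card F) (hk0 : 0 < k)
    (y : F) (hy : y ≠ 0) : χ y = 1 ↔ y ^ k = 1 := by
  obtain ⟨g, hgn, ho, hn⟩ := cube_log hχ
  obtain ⟨n, hu⟩ := hgn (Units.mk0 y hy)
  have hy' : y = (g : F) ^ n := by rw [← Units.val_pow_eq_pow_val, ← hu]; rfl
  rw [hy', hn, ← pow_mul, ← Units.val_pow_eq_pow_val, Units.val_eq_one, ← orderOf_dvd_iff_pow_eq_one,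
    ho, ← hk, Nat.add_sub_cancel]
  exact (Nat.mul_dvd_mul_iff_right hk0).symm

theorem sum_three (z : ℂ) (h : z ^ 3 = 1) (h1 : z ≠ 1) : 1 + z + z ^ 2 = 0 := by
  have : (z - 1) * (1 + z + z ^ 2) = 0 := by linear_combination h
  exact (mul_eq_zero.1 this).resolve_left (sub_ne_zero.2 h1)

theorem chi_pow_three (hχ : orderOf χ = 3) (y : F) (hy : y ≠ 0) : χ y ^ 3 = 1 := by
  rw [← MulChar.pow_apply' _ (by norm_num), (order_three_facts hχ).1, MulChar.one_apply hy.isUnit]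

theorem chi_inv (hχ : orderOf χ = 3) (y : F) : χ⁻¹ y = χ y ^ 2 := by
  obtain ⟨h3, -, -⟩ := order_three_facts hχ
  have : χ⁻¹ = χ ^ 2 := by
    apply inv_eq_of_mul_eq_one_left
    rw [← pow_succ, h3]
  rw [this, MulChar.pow_apply' _ (by norm_num)]

theorem trace_mod (hχ : orderOf χ = 3) (c : ℤ)
    (hc : jacobiSum χ χ + jacobiSum χ⁻¹ χ⁻¹ = c) (k : ℕ) (hk : 3 * k + 1 = Fintype.card F)
    (hk0 : 0 < k) : (c : F) = -((-1) ^ k * ((2 * k).choose k : F)) := by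
  classical
  let t : F → ℤ := fun y => if y = 0 then 0 else if χ y = 1 then 2 else -1
  have ht : ∀ y, ((t y : ℤ) : ℂ) = χ y + χ⁻¹ y := by
    intro y
    simp only [t]
    split_ifs with h0 h1
    · simp [h0, MulChar.map_zero]
    · rw [chi_inv hχ, h1]; norm_num
    · rw [chi_inv hχ]
      have := sum_three _ (chi_pow_three hχ y h0) h1
      push_cast
      linear_combination -this
  have ht' : ∀ y, ((t y : ℤ) : F) = y ^ k + y ^ (2 * k) := by
    intro y
    simp only [t]
    split_ifs with h0 h1
    · rw [h0, zero_pow hk0.ne', zero_pow (by omega)]; simp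
    · rw [mul_comm 2 k, pow_mul, (chi_pow hχ k hk hk0 y h0).1 h1]; norm_num
    · have h2 : y ^ k ≠ 1 := fun h => h1 ((chi_pow hχ k hk hk0 y h0).2 h)
      have h3 : (y ^ k) ^ 3 = 1 := by
        rw [← pow_mul, mul_comm, ← FiniteField.pow_card_sub_one_eq_one y h0, ← hk,
          Nat.add_sub_cancel]
      have h4 : (y ^ k - 1) * (1 + y ^ k + (y ^ k) ^ 2) = 0 := by linear_combination h3
      have h5 := (mul_eq_zero.1 h4).resolve_left (sub_ne_zero.2 h2)
      rw [mul_comm 2 k, pow_mul]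
      push_cast
      linear_combination -h5
  have h1 : c = ∑ x : F, t (x * (1 - x)) := by
    have : (c : ℂ) = ((∑ x : F, t (x * (1 - x)) : ℤ) : ℂ) := by
      push_cast
      rw [← hc, jacobiSum, jacobiSum, ← Finset.sum_add_distrib]
      refine Finset.sum_congr rfl fun x _ => ?_
      rw [ht, map_mul, map_mul]
    exact_mod_cast this
  rw [h1]
  push_cast
  simp only [ht', Finset.sum_add_distrib]
  rw [beta_sum_one k hk hk0, beta_sum_two k hk hk0, zero_add]

theorem jacobi_form (hχ : orderOf χ = 3) : ∃ m n : ℤ,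
    jacobiSum χ χ + jacobiSum χ⁻¹ χ⁻¹ = ((2 * (3 * n - 1) - 3 * (n - m) : ℤ) : ℂ) ∧
    jacobiSum χ χ * jacobiSum χ⁻¹ χ⁻¹ = (Fintype.card F : ℂ) ∧
    ((3 * n - 1) ^ 2 - (3 * n - 1) * (3 * (n - m)) + (3 * (n - m)) ^ 2 : ℤ) = Fintype.card F := by
  obtain ⟨h3, h1, h2⟩ := order_three_facts hχ
  obtain ⟨k, hk, hk0⟩ := three_dvd hχ
  have hprod : jacobiSum χ χ * jacobiSum χ⁻¹ χ⁻¹ = (Fintype.card F : ℂ) := by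
    apply jacobiSum_mul_jacobiSum_inv _ h1 h1 h2
    rw [ringChar.eq_zero]
    exact (CharP.ringChar_ne_zero_of_finite F).symm
  obtain ⟨μ, hμ⟩ : ∃ μ : ℂ, IsPrimitiveRoot μ 3 := ⟨_, Complex.isPrimitiveRoot_exp 3 (by norm_num)⟩
  have hμ0 : 1 + μ + μ ^ 2 = 0 := sum_three μ hμ.pow_eq_one (hμ.ne_one (by norm_num))
  obtain ⟨z, hz, hJ⟩ := exists_jacobiSum_eq_neg_one_add (n := 3) (by norm_num) h3 h3
    ⟨k, by omega⟩ hμ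
  have hz' : ∃ m n : ℤ, z = m + n * μ := by
    clear hJ
    induction hz using Algebra.adjoin_induction with
    | mem x hx => exact ⟨0, 1, by rw [Set.mem_singleton_iff.1 hx]; simp⟩
    | algebraMap r => exact ⟨r, 0, by simp⟩
    | add x y _ _ hx hy =>
      obtain ⟨a, b, rfl⟩ := hx
      obtain ⟨a', b', rfl⟩ := hy
      exact ⟨a + a', b + b', by push_cast; ring⟩
    | mul x y _ _ hx hy =>
      obtain ⟨a, b, rfl⟩ := hx
      obtain ⟨a', b', rfl⟩ := hy
      exact ⟨a * a' - b * b', a * b' + b * a' - b * b', by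
        push_cast; linear_combination (b * b') * hμ0⟩
  obtain ⟨m, n, rfl⟩ := hz'
  have hconj : (starRingEnd ℂ) μ = μ ^ 2 := by
    have hn : ‖μ‖ = 1 := hμ.norm'_eq_one (by norm_num)
    have h5 : (starRingEnd ℂ) μ * μ = 1 := by
      rw [mul_comm, Complex.mul_conj, Complex.normSq_eq_norm_sq, hn]; simp
    have h6 : μ ^ 3 = 1 := hμ.pow_eq_one
    calc (starRingEnd ℂ) μ = (starRingEnd ℂ) μ * μ ^ 3 := by rw [h6, mul_one]
      _ = ((starRingEnd ℂ) μ * μ) * μ ^ 2 := by ring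
      _ = μ ^ 2 := by rw [h5, one_mul]
  have hJ1 : jacobiSum χ χ = (3 * n - 1) + 3 * (n - m) * μ := by
    rw [hJ]; linear_combination (m + n * μ - 3 * n) * hμ0
  have hJ2 : jacobiSum χ⁻¹ χ⁻¹ = (3 * n - 1) + 3 * (n - m) * μ ^ 2 := by
    rw [← ringHomComp_conj, jacobiSum_ringHomComp, hJ1]
    have c3 : (starRingEnd ℂ) 3 = 3 := map_ofNat _ 3
    simp [hconj, c3]
  refine ⟨m, n, ?_, hprod, ?_⟩
  · rw [hJ1, hJ2]
    push_cast
    linear_combination (3 * (n - m) : ℂ) * hμ0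
  · have : (((3 * n - 1) ^ 2 - (3 * n - 1) * (3 * (n - m)) + (3 * (n - m)) ^ 2 : ℤ) : ℂ) =
        ((Fintype.card F : ℤ) : ℂ) := by
      push_cast
      rw [← hprod, hJ1, hJ2]
      have h6 : μ ^ 3 = 1 := hμ.pow_eq_one
      linear_combination (-(3 * n - 1) * (3 * (n - m)) : ℂ) * hμ0 - (3 * (n - m)) ^ 2 * h6
    exact_mod_cast this

theorem jacobi_trace (hχ : orderOf χ = 3) (q p r : ℕ) (c : ℤ) (hp : p.Prime) (hqpr : q = p ^ r)
    (hc : (p % 3 = 1 ∧ (∃ d : ℤ, 4 * (q : ℤ) = c ^ 2 + 27 * d ^ 2) ∧ c % 3 = 1 ∧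
            ¬ (p : ℤ) ∣ c) ∨
          (p % 3 = 2 ∧ ∃ r' : ℕ, r = 2 * r' ∧ c = -2 * (-(p : ℤ)) ^ r'))
    (hF : Fintype.card F = q) :
    jacobiSum χ χ + jacobiSum χ⁻¹ χ⁻¹ = (c : ℂ) ∧
    jacobiSum χ χ * jacobiSum χ⁻¹ χ⁻¹ = (q : ℂ) := by
  obtain ⟨m, n, h1, h2, h3⟩ := jacobi_form hχ
  rw [hF] at h2 h3
  refine ⟨?_, h2⟩
  rw [h1]
  norm_cast
  obtain ⟨k, hk, hk0⟩ := three_dvd hχ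
  rcases hc with ⟨hp3, ⟨d, hd⟩, hc3, hpc⟩ | ⟨hp3, r', hr, hc⟩
  · symm
    have hr : r ≠ 0 := by
      rintro rfl
      rw [hF, hqpr, pow_zero] at hk
      omega
    subst hqpr
    refine c_unique p r hr hp hp3 c d _ (n - m) hd ?_ hc3 (by omega) hpc ?_
    · rw [← h3]; ring
    · have := Fact.mk hp
      have hch : CharP F p := charP_of_card_eq_prime_pow hF
      rw [← CharP.intCast_eq_zero_iff F p, trace_mod hχ _ h1 k hk hk0, neg_eq_zero, mul_eq_zero, not_or]
      refine ⟨pow_ne_zero _ (by simp), ?_⟩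
      rw [CharP.cast_eq_zero_iff F p]
      exact not_dvd_choose p (p / 3) hp (by omega) r k (by rw [hk, hF])
  · rw [hc]
    apply inert_case p hp hp3 r' _ _ _ (by omega) ⟨_, rfl⟩
    rw [h3, hqpr, hr]
    push_cast
    rfl

end jac
end CubicClique

namespace CubicClique
section counting
set_option linter.unusedSectionVars false
variable {F : Type*} [Field F] [Fintype F]

/-- Nonzero cubes. -/
def IsC (x : F) : Prop := ∃ z : F, z ≠ 0 ∧ x = z ^ 3

open Classical in
/-- Indicator function of the nonzero cubes. -/
noncomputable def ind (x : F) : ℂ := if IsC x then 1 else 0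

theorem IsC.ne_zero {x : F} (h : IsC x) : x ≠ 0 := by
  obtain ⟨z, hz, rfl⟩ := h
  exact pow_ne_zero 3 hz

theorem IsC.mul_iff {u : F} (hu : IsC u) (x : F) : IsC (u * x) ↔ IsC x := by
  obtain ⟨w, hw, rfl⟩ := hu
  constructor
  · rintro ⟨z, hz, h⟩
    refine ⟨w⁻¹ * z, mul_ne_zero (inv_ne_zero hw) hz, ?_⟩
    rw [mul_pow, ← h]
    field_simp
  · rintro ⟨z, hz, rfl⟩
    exact ⟨w * z, mul_ne_zero hw hz, by ring⟩

theorem IsC.neg {u : F} (hu : IsC u) : IsC (-u) := by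
  obtain ⟨w, hw, rfl⟩ := hu
  exact ⟨-w, neg_ne_zero.2 hw, by ring⟩

theorem isC_neg (u : F) : IsC (-u) ↔ IsC u :=
  ⟨fun h => by simpa using h.neg, fun h => h.neg⟩

theorem ind_mul {u : F} (hu : IsC u) (x : F) : ind (u * x) = ind x := by
  classical
  unfold ind
  exact if_congr (hu.mul_iff x) rfl rfl

theorem ind_neg (x y : F) : ind (x - y) = ind (y - x) := by
  rw [← neg_sub]
  classical
  unfold ind
  exact if_congr (isC_neg _) rfl rfl

variable {χ : MulChar F ℂ}

theorem sum_X (hχ : orderOf χ = 3) (x : F) : ∑ i : Fin 3, X χ i x = 3 * ind x := by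
  obtain ⟨h3, -, -⟩ := order_three_facts hχ
  rw [Fin.sum_univ_three, X_zero, X_one, X_two h3, chi_inv hχ, ind]
  by_cases h0 : x = 0
  · rw [if_neg (fun h => h.ne_zero h0), h0, MulChar.map_zero, MulChar.map_zero]; simp
  rw [MulChar.one_apply (Ne.isUnit h0)]
  split_ifs with h
  · rw [(chi_cube hχ x h0).2 h]; norm_num
  · rw [sum_three _ (chi_pow_three hχ x h0) (fun h1 => h ((chi_cube hχ x h0).1 h1)), mul_zero]

theorem sum_S_ind (hχ : orderOf χ = 3) : ∑ v, S χ v =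
    3 ^ 5 * ∑ x : F, ∑ y : F, ind x * ind y * ind (1 - x) * ind (1 - y) * ind (x - y) := by
  simp only [S]
  rw [Finset.sum_comm, Finset.mul_sum]
  refine Finset.sum_congr rfl fun x _ => ?_
  rw [Finset.sum_comm, Finset.mul_sum]
  refine Finset.sum_congr rfl fun y _ => ?_
  simp only [Fintype.sum_prod_type, Sm, ← Finset.mul_sum, ← Finset.sum_mul, sum_X hχ]
  ring

theorem sum_ind (hχ : orderOf χ = 3) : 3 * ∑ x : F, ind x = (Fintype.card F : ℂ) - 1 := by
  classical
  obtain ⟨h3, h1, -⟩ := order_three_facts hχ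
  have h2 : χ⁻¹ ≠ 1 := by simpa using h1
  rw [Finset.mul_sum, ← Finset.sum_congr rfl fun x _ => sum_X hχ x]
  simp only [Fin.sum_univ_three, Finset.sum_add_distrib, X_zero, X_one, X_two h3]
  rw [MulChar.sum_eq_zero_of_ne_one h1, MulChar.sum_eq_zero_of_ne_one h2,
    MulChar.sum_one_eq_card_units, Fintype.card_units, Nat.cast_sub Fintype.card_pos]
  simp

/-- The weight of an ordered quadruple. -/
noncomputable def wt (a b c d : F) : ℂ :=
  ind (b - a) * ind (c - a) * ind (d - a) * ind (c - b) * ind (d - b) * ind (d - c)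

theorem sum_wt (hχ : orderOf χ = 3) : 3 * ∑ a : F, ∑ b : F, ∑ c : F, ∑ d : F, wt a b c d =
    (Fintype.card F : ℂ) * ((Fintype.card F : ℂ) - 1) *
      ∑ x : F, ∑ y : F, ind x * ind y * ind (1 - x) * ind (1 - y) * ind (x - y) := by
  set M := ∑ x : F, ∑ y : F, ind x * ind y * ind (1 - x) * ind (1 - y) * ind (x - y) with hM
  have h1 : ∀ a : F, ∑ b : F, ∑ c : F, ∑ d : F, wt a b c d =
      ∑ b : F, ∑ c : F, ∑ d : F, wt 0 b c d := by
    intro a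
    rw [← Equiv.sum_comp (Equiv.addRight a)]
    refine Finset.sum_congr rfl fun b _ => ?_
    rw [← Equiv.sum_comp (Equiv.addRight a)]
    refine Finset.sum_congr rfl fun c _ => ?_
    rw [← Equiv.sum_comp (Equiv.addRight a)]
    refine Finset.sum_congr rfl fun d _ => ?_
    simp [wt]
  have h2 : ∀ u : F, ∑ c : F, ∑ d : F, wt 0 u c d = ind u * M := by
    intro u
    by_cases hu : IsC u
    · rw [hM, Finset.mul_sum, ← Equiv.sum_comp (Equiv.mulLeft₀ u hu.ne_zero)]
      refine Finset.sum_congr rfl fun x _ => ?_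
      rw [Finset.mul_sum, ← Equiv.sum_comp (Equiv.mulLeft₀ u hu.ne_zero)]
      refine Finset.sum_congr rfl fun y _ => ?_
      have e : ∀ x, (Equiv.mulLeft₀ u hu.ne_zero) x = u * x := fun _ => rfl
      have e1 : u * x - u = u * (x - 1) := by ring
      have e2 : u * y - u = u * (y - 1) := by ring
      have e3 : u * y - u * x = u * (y - x) := by ring
      simp only [wt, e, sub_zero, e1, e2, e3, ind_mul hu]
      rw [ind_neg x 1, ind_neg y 1, ind_neg y x]
      ring
    · have : ind u = 0 := by rw [ind, if_neg hu]
      simp [wt, this]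
  rw [Finset.sum_congr rfl fun a _ => h1 a, Finset.sum_const, Finset.sum_congr rfl fun u _ => h2 u,
    ← Finset.sum_mul, Finset.card_univ, nsmul_eq_mul]
  linear_combination (Fintype.card F : ℂ) * M * sum_ind hχ

theorem fiber_sum {R : Type*} [CommRing R] [Fintype R] (φ : R →+* F)
    (hφ : Function.Surjective φ) (N : ℕ) (hN : Nat.card (RingHom.ker φ) = N) (f : F → ℂ) :
    ∑ x : R, f (φ x) = N * ∑ y : F, f y := by
  classical
  rw [← Finset.sum_fiberwise (s := Finset.univ) (g := φ), Finset.mul_sum]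
  refine Finset.sum_congr rfl fun y _ => ?_
  rw [Finset.sum_congr rfl (g := fun _ => f y) (by
    intro x hx; rw [(Finset.mem_filter.1 hx).2]), Finset.sum_const, nsmul_eq_mul]
  congr 2
  rw [← hN, Nat.card_eq_fintype_card, ← Fintype.card_coe]
  obtain ⟨x0, hx0⟩ := hφ y
  refine Fintype.card_congr ⟨fun x => ⟨x.1 - x0, ?_⟩, fun k => ⟨k.1 + x0, ?_⟩, ?_, ?_⟩
  · rw [RingHom.mem_ker, map_sub, (Finset.mem_filter.1 x.2).2, hx0, sub_self]
  · have := (RingHom.mem_ker).1 k.2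
    simp [this, hx0]
  · intro x; simp
  · intro k; simp

theorem sum_wt_R {R : Type*} [CommRing R] [Fintype R] (φ : R →+* F)
    (hφ : Function.Surjective φ) (N : ℕ) (hN : Nat.card (RingHom.ker φ) = N) :
    ∑ a : R, ∑ b : R, ∑ c : R, ∑ d : R, wt (φ a) (φ b) (φ c) (φ d) =
      (N : ℂ) ^ 4 * ∑ a : F, ∑ b : F, ∑ c : F, ∑ d : F, wt a b c d := by
  have h := fun f => fiber_sum φ hφ N hN f
  have e1 : ∀ a b c : F, ∑ d : R, wt a b c (φ d) = N * ∑ d : F, wt a b c d :=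
    fun a b c => h (wt a b c)
  have e2 : ∀ a b : F, ∑ c : R, ((N : ℂ) * ∑ d : F, wt a b (φ c) d) =
      N * ∑ c : F, (N : ℂ) * ∑ d : F, wt a b c d :=
    fun a b => h (fun c => (N : ℂ) * ∑ d : F, wt a b c d)
  have e3 : ∀ a : F, ∑ b : R, ((N : ℂ) * ∑ c : F, (N : ℂ) * ∑ d : F, wt a (φ b) c d) =
      N * ∑ b : F, (N : ℂ) * ∑ c : F, (N : ℂ) * ∑ d : F, wt a b c d :=
    fun a => h (fun b => (N : ℂ) * ∑ c : F, (N : ℂ) * ∑ d : F, wt a b c d)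
  simp only [e1, e2, e3]
  rw [h (fun a => (N : ℂ) * ∑ b : F, (N : ℂ) * ∑ c : F, (N : ℂ) * ∑ d : F, wt a b c d)]
  simp only [← Finset.mul_sum]
  ring

/-- Cubes of units in a finite local ring in which `3` is a unit. -/
theorem cube_lift {R : Type*} [CommRing R] [IsLocalRing R] [Fintype R] (h3 : IsUnit (3 : R))
    (φ : R →+* F) (hφ : Function.Surjective φ) [IsLocalHom φ] (x : R) :
    (∃ u : Rˣ, x = (u : R) ^ 3) ↔ IsC (φ x) := by
  constructor
  · rintro ⟨u, rfl⟩
    exact ⟨φ u, (u.isUnit.map φ).ne_zero, by rw [map_pow]⟩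
  · rintro ⟨z, hz, hx⟩
    obtain ⟨y, rfl⟩ := hφ z
    have hy : IsUnit y := isUnit_of_map_unit φ y hz.isUnit
    obtain ⟨y, rfl⟩ := hy
    have hxu : IsUnit x := isUnit_of_map_unit φ x (by rw [hx]; exact (hz.isUnit).pow 3)
    obtain ⟨x, rfl⟩ := hxu
    let K : Subgroup Rˣ := (Units.map (φ : R →* F)).ker
    have hK : ∀ v : Rˣ, v ∈ K ↔ φ v = 1 := by
      intro v
      rw [MonoidHom.mem_ker, Units.ext_iff]
      rfl
    let cub : K →* K := powMonoidHom 3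
    have hinj : Function.Injective cub := by
      rw [injective_iff_map_eq_one]
      intro v hv
      have hv' : ((v : Rˣ) : R) ^ 3 = 1 := by
        have := congrArg (fun w : K => ((w : Rˣ) : R)) hv
        simpa [cub] using this
      have hv1 : φ ((v : Rˣ) : R) = 1 := (hK _).1 v.2
      have hu : IsUnit (((v : Rˣ) : R) ^ 2 + (v : Rˣ) + 1) := by
        apply isUnit_of_map_unit φ
        have : φ (((v : Rˣ) : R) ^ 2 + (v : Rˣ) + 1) = φ 3 := by
          rw [map_add, map_add, map_pow, hv1, map_one, map_ofNat]
          norm_num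
        rw [this]
        exact h3.map φ
      have h0 : (((v : Rˣ) : R) ^ 2 + (v : Rˣ) + 1) * (((v : Rˣ) : R) - 1) = 0 := by
        linear_combination hv'
      have h1 := (hu.mul_right_eq_zero).1 h0
      apply Subtype.ext
      apply Units.ext
      simpa using sub_eq_zero.1 h1
    have hsurj : Function.Surjective cub := Finite.surjective_of_injective hinj
    have hmem : x * (y ^ 3)⁻¹ ∈ K := by
      rw [MonoidHom.mem_ker, map_mul, map_inv, mul_inv_eq_one]
      ext
      simpa using hx
    obtain ⟨w, hw⟩ := hsurj ⟨_, hmem⟩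
    have hw' : (w : Rˣ) ^ 3 = x * (y ^ 3)⁻¹ := congrArg Subtype.val hw
    refine ⟨(w : Rˣ) * y, ?_⟩
    rw [← Units.val_pow_eq_pow_val, mul_pow, hw', inv_mul_cancel_right]

end counting

section cliques

theorem clique_count {V : Type*} [Fintype V] (G : SimpleGraph V) :
    24 * G.cliqueCount 4 = Nat.card {f : Fin 4 → V // ∀ i j, i ≠ j → G.Adj (f i) (f j)} := by
  classical
  have hinj : ∀ f : {f : Fin 4 → V // ∀ i j, i ≠ j → G.Adj (f i) (f j)},
      Function.Injective f.1 := by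
    intro f i j hij
    by_contra hne
    exact (f.2 i j hne).ne hij
  let im : {f : Fin 4 → V // ∀ i j, i ≠ j → G.Adj (f i) (f j)} →
      {s : Finset V // G.IsNClique 4 s} := fun f => ⟨Finset.univ.image f.1, by
    constructor
    · intro x hx y hy hxy
      simp only [Finset.coe_image, Finset.coe_univ, Set.image_univ, Set.mem_range] at hx hy
      obtain ⟨i, rfl⟩ := hx
      obtain ⟨j, rfl⟩ := hy
      exact f.2 i j (fun h => hxy (by rw [h]))
    · rw [Finset.card_image_of_injective _ (hinj f)]
      simp⟩
  rw [← Nat.card_congr (Equiv.sigmaFiberEquiv im), Nat.card_sigma]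
  have hfib : ∀ s : {s : Finset V // G.IsNClique 4 s}, Nat.card {f // im f = s} = 24 := by
    intro s
    have e : {f // im f = s} ≃ (Fin 4 ≃ s.1) :=
      { toFun := fun f => Equiv.ofBijective (fun i => ⟨f.1.1 i, by
          have h0 := Finset.mem_image_of_mem f.1.1 (Finset.mem_univ i)
          have e : Finset.univ.image f.1.1 = s.1 := congrArg Subtype.val f.2
          exact e ▸ h0⟩) (by
          rw [Fintype.bijective_iff_injective_and_card]
          refine ⟨fun i j h => hinj f.1 (congrArg Subtype.val h), ?_⟩
          rw [Fintype.card_coe, s.2.card_eq, Fintype.card_fin])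
        invFun := fun g => ⟨⟨fun i => (g i : V), fun i j hij => s.2.isClique (g i).2 (g j).2
          (fun h => hij (g.injective (Subtype.ext h)))⟩, by
            apply Subtype.ext
            ext x
            simp only [im, Finset.mem_image, Finset.mem_univ, true_and]
            constructor
            · rintro ⟨i, rfl⟩; exact (g i).2
            · intro hx; exact ⟨g.symm ⟨x, hx⟩, by simp⟩⟩
        left_inv := fun f => by
          apply Subtype.ext
          apply Subtype.ext
          rfl
        right_inv := fun g => by
          ext i
          rfl }
    rw [Nat.card_congr e, Nat.card_eq_fintype_card, Fintype.card_equiv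
      (Fintype.equivOfCardEq (by rw [Fintype.card_coe, s.2.card_eq, Fintype.card_fin]))]
    rfl
  rw [Finset.sum_congr rfl fun s _ => hfib s, Finset.sum_const, SimpleGraph.cliqueCount,
    Finset.card_univ, Nat.card_eq_fintype_card, smul_eq_mul, mul_comm]

/-- Functions on `Fin 4` as quadruples. -/
def quad (V : Type*) : (Fin 4 → V) ≃ V × V × V × V where
  toFun f := (f 0, f 1, f 2, f 3)
  invFun t := ![t.1, t.2.1, t.2.2.1, t.2.2.2]
  left_inv f := by
    funext i
    fin_cases i <;> rfl
  right_inv t := rfl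

theorem clique_sum {V : Type*} [Fintype V] (G : SimpleGraph V) (I : V → V → ℂ)
    (hI1 : ∀ x y, G.Adj x y → I x y = 1) (hI0 : ∀ x y, ¬ G.Adj x y → I x y = 0) :
    (24 : ℂ) * (G.cliqueCount 4 : ℂ) = ∑ a, ∑ b, ∑ c, ∑ d,
      I a b * I a c * I a d * I b c * I b d * I c d := by
  classical
  have h := clique_count G
  have h' : (24 : ℂ) * (G.cliqueCount 4 : ℂ) = (Nat.card {f : Fin 4 → V //
    ∀ i j, i ≠ j → G.Adj (f i) (f j)} : ℂ) := by exact_mod_cast h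
  rw [h', Nat.card_eq_fintype_card, Fintype.card_subtype, ← Finset.sum_boole]
  rw [← Equiv.sum_comp (quad V).symm]
  simp only [Fintype.sum_prod_type]
  refine Finset.sum_congr rfl fun a _ => Finset.sum_congr rfl fun b _ =>
    Finset.sum_congr rfl fun c _ => Finset.sum_congr rfl fun d _ => ?_
  have hiff : (∀ i j, i ≠ j → G.Adj ((quad V).symm (a, b, c, d) i) ((quad V).symm (a, b, c, d) j)) ↔
      (G.Adj a b ∧ G.Adj a c ∧ G.Adj a d ∧ G.Adj b c ∧ G.Adj b d ∧ G.Adj c d) := by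
    constructor
    · intro h
      exact ⟨h 0 1 (by decide), h 0 2 (by decide), h 0 3 (by decide), h 1 2 (by decide),
        h 1 3 (by decide), h 2 3 (by decide)⟩
    · rintro ⟨h1, h2, h3, h4, h5, h6⟩ i j hij
      fin_cases i <;> fin_cases j <;> first
        | exact absurd rfl hij
        | assumption
        | (apply SimpleGraph.Adj.symm; assumption)
  have hI : ∀ x y, I x y = if G.Adj x y then 1 else 0 := by
    intro x y
    split_ifs with h
    · exact hI1 x y h
    · exact hI0 x y h
  rw [if_congr hiff rfl rfl]
  simp only [hI]
  by_cases h1 : G.Adj a b <;> by_cases h2 : G.Adj a c <;> by_cases h3 : G.Adj a d <;>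
    by_cases h4 : G.Adj b c <;> by_cases h5 : G.Adj b d <;> by_cases h6 : G.Adj c d <;>
    simp [h1, h2, h3, h4, h5, h6]

end cliques
end CubicClique

/-- Let `(R,𝔪)` be a finite commutative local ring with `|𝔪| = q^β` and residue field of size
`q = p^r` (`p` prime), `gcd(3,|R|) = 1`, and `3 ∣ q-1` if `q` even, `6 ∣ q-1` if `q` odd.
Let `c` be as in the statement and `χ₃` a multiplicative character of `𝔽_q` of order `3`.
Then `K_4(G_R(3)) = (q^(4β+1)(q-1)/(2³·3⁷)) · [q² + 5q(c-11) + 10c² - 85c + 316 +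
12q²·₃F₂(χ₃,χ₃,χ̄₃;ε,ε;1)_q]`. -/
theorem fourCliqueCount_unitaryCayley_three (R : Type*) [CommRing R] [IsLocalRing R]
    [Fintype R] (q β p r : ℕ) (c : ℤ) (hp : p.Prime) (hqpr : q = p ^ r)
    (hm : Nat.card (IsLocalRing.maximalIdeal R) = q ^ β)
    (hq : Nat.card (IsLocalRing.ResidueField R) = q)
    (hk : Nat.gcd 3 (Fintype.card R) = 1)
    (hdiv : (Even q → 3 ∣ q - 1) ∧ (Odd q → 6 ∣ q - 1))
    (hc : (p % 3 = 1 ∧ (∃ d : ℤ, 4 * (q : ℤ) = c ^ 2 + 27 * d ^ 2) ∧ c % 3 = 1 ∧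
            ¬ (p : ℤ) ∣ c) ∨
          (p % 3 = 2 ∧ ∃ r' : ℕ, r = 2 * r' ∧ c = -2 * (-(p : ℤ)) ^ r'))
    (F : Type*) [Field F] [Fintype F] (hF : Fintype.card F = q)
    (χ₃ : MulChar F ℂ) (hχ₃ : orderOf χ₃ = 3) :
    (2 ^ 3 * 3 ^ 7 : ℂ) * ((unitaryCayleyGraph R 3).cliqueCount 4 : ℂ) =
      (q : ℂ) ^ (4 * β + 1) * ((q : ℂ) - 1) *
        ((q : ℂ) ^ 2 + 5 * (q : ℂ) * ((c : ℂ) - 11) + 10 * (c : ℂ) ^ 2 - 85 * (c : ℂ) + 316 +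
          12 * (q : ℂ) ^ 2 * hyp3F2 χ₃ χ₃ (χ₃.ringHomComp (starRingEnd ℂ)) 1 1) := by
  classical
  obtain ⟨h3, h1, -⟩ := CubicClique.order_three_facts hχ₃
  obtain ⟨hJs, hJp⟩ := CubicClique.jacobi_trace hχ₃ q p r c hp hqpr hc hF
  have hS := CubicClique.sum_S h3 h1 q hF (c : ℂ) hJs hJp
  have hH := CubicClique.hyp_eq h3
  have hI := CubicClique.sum_S_ind hχ₃
  have hW := CubicClique.sum_wt hχ₃
  have : Finite (IsLocalRing.ResidueField R) :=
    Finite.of_surjective _ (IsLocalRing.residue_surjective (R := R))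
  let _ : Fintype (IsLocalRing.ResidueField R) := Fintype.ofFinite _
  let e : IsLocalRing.ResidueField R ≃+* F := FiniteField.ringEquivOfCardEq (by
    rw [hF, ← hq, Nat.card_eq_fintype_card])
  let φ : R →+* F := (e : IsLocalRing.ResidueField R →+* F).comp (IsLocalRing.residue R)
  have hφ : Function.Surjective φ := e.surjective.comp IsLocalRing.residue_surjective
  have hker : RingHom.ker φ = IsLocalRing.maximalIdeal R := by
    ext x
    rw [RingHom.mem_ker, ← IsLocalRing.residue_eq_zero_iff]
    change e (IsLocalRing.residue R x) = 0 ↔ _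
    exact map_eq_zero_iff e e.injective
  have : IsLocalHom φ := ⟨fun x hx => by
    by_contra hn
    have : x ∈ RingHom.ker φ := by
      rw [hker]
      exact (IsLocalRing.mem_maximalIdeal x).2 hn
    exact hx.ne_zero ((RingHom.mem_ker).1 this)⟩
  have h3u : IsUnit (3 : R) := by
    have hb := Nat.gcd_eq_gcd_ab 3 (Fintype.card R)
    rw [hk] at hb
    have hb' := congrArg (Int.cast : ℤ → R) hb
    push_cast at hb'
    rw [Nat.cast_card_eq_zero, zero_mul, add_zero] at hb'
    exact IsUnit.of_mul_eq_one _ hb'.symm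
  have hadj : ∀ x y : R, (unitaryCayleyGraph R 3).Adj x y ↔ CubicClique.IsC (φ y - φ x) := by
    intro x y
    rw [unitaryCayleyGraph, SimpleGraph.fromRel_adj, CubicClique.cube_lift h3u φ hφ,
      CubicClique.cube_lift h3u φ hφ, map_sub, map_sub]
    constructor
    · rintro ⟨-, h | h⟩
      · exact h
      · rw [← CubicClique.isC_neg, neg_sub]
        exact h
    · intro h
      refine ⟨?_, Or.inl h⟩
      rintro rfl
      exact h.ne_zero (sub_self _)
  have hK := CubicClique.clique_sum (unitaryCayleyGraph R 3)
    (fun x y => CubicClique.ind (φ y - φ x))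
    (fun x y h => if_pos ((hadj x y).1 h)) (fun x y h => if_neg (fun h' => h ((hadj x y).2 h')))
  have hWR := CubicClique.sum_wt_R φ hφ (q ^ β) (by rw [hker, hm])
  have hK' : (24 : ℂ) * ((unitaryCayleyGraph R 3).cliqueCount 4 : ℂ) =
      ∑ a : R, ∑ b : R, ∑ c : R, ∑ d : R, CubicClique.wt (φ a) (φ b) (φ c) (φ d) := hK
  rw [hWR] at hK'
  rw [hF] at hW hH
  rw [← hH, hI] at hS
  push_cast at hK'
  rw [pow_succ (q : ℂ) (4 * β), mul_comm 4 β, pow_mul]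
  linear_combination (3 ^ 6 : ℂ) * hK' + (3 ^ 5 : ℂ) * ((q : ℂ) ^ β) ^ 4 * hW
    + ((q : ℂ) ^ β) ^ 4 * (q : ℂ) * ((q : ℂ) - 1) * hS
end
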